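/- arXiv:1808.03593 — 3 statements merged into one kernel-verified Lean document; each statement's English description precedes it below -/
import Mathlib

section
/- Let p be an odd prime, K a finite field extension of ℚ_p, and Q a nondegenerate quadratic form on an n-dimensional K-vector space. Then there is a bijection Φ from the set of orbits of the conjugation action of O(Q) on the set of all nilpotent elements of so(Q) to the set of pairs (λ, c), where λ ∈ Λ(n) and c assigns to each distinct odd value j occurring in λ an isometry class c_j of nondegenerate quadratic forms of degree m_j(λ) over K, subject to the condition that the orthogonal sum over j of representatives of the c_j is Witt equivalent to Q (for λ with no odd parts this condition reads: Q is Witt equivalent to the zero form). Moreover, Φ sends each orbit consisting of elements of Jordan type λ to a pair whose first component is λ. -/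
/-- A quadratic form of degree `m` over `K`: a quadratic form on `Fin m → K`. -/
abbrev QF (K : Type) [Field K] (m : ℕ) : Type := QuadraticForm K (Fin m → K)

/-- Two quadratic forms are isometric if there is a linear equivalence of the underlying
spaces carrying one to the other. -/
def QIsom {K : Type} [Field K] {M M' : Type} [AddCommGroup M] [Module K M]
    [AddCommGroup M'] [Module K M'] (Q : QuadraticForm K M) (Q' : QuadraticForm K M') : Prop :=
  ∃ φ : M ≃ₗ[K] M', ∀ x, Q' (φ x) = Q x

/-- The hyperbolic plane `(x, y) ↦ x * y` on `K²`. -/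
noncomputable def HypForm (K : Type) [Field K] : QuadraticForm K (K × K) :=
  QuadraticMap.linMulLin (LinearMap.fst K K K) (LinearMap.snd K K K)

/-- Orthogonal sum of `m` copies of the hyperbolic plane. -/
noncomputable def HypSum (K : Type) [Field K] (m : ℕ) : QuadraticForm K (Fin m → K × K) :=
  QuadraticMap.pi (fun _ : Fin m => HypForm K)

/-- Witt equivalence of quadratic forms. -/
def WittEquiv {K : Type} [Field K] {M M' : Type} [AddCommGroup M] [Module K M]
    [AddCommGroup M'] [Module K M'] (Q : QuadraticForm K M) (Q' : QuadraticForm K M') : Prop :=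
  ∃ a b : ℕ, QIsom (Q.prod (HypSum K a)) (Q'.prod (HypSum K b))

/-- A quadratic form is nondegenerate if its polar bilinear form is nondegenerate. -/
def QNondeg {K : Type} [Field K] {M : Type} [AddCommGroup M] [Module K M]
    (Q : QuadraticForm K M) : Prop :=
  ∀ v, (∀ w, QuadraticMap.polar (⇑Q) v w = 0) → v = 0

/-- The diagonal quadratic form `⟨a₁, …, a_m⟩`. -/
noncomputable def diagQF {K : Type} [Field K] {m : ℕ} (r : Fin m → Kˣ) : QF K m :=
  QuadraticMap.weightedSumSquares K (fun i => (r i : K))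

/-- The Lie algebra `so(Q)`. -/
def soSet {K : Type} [Field K] {M : Type} [AddCommGroup M] [Module K M]
    (Q : QuadraticForm K M) : Set (Module.End K M) :=
  {X | ∀ v w, QuadraticMap.polar (⇑Q) (X v) w + QuadraticMap.polar (⇑Q) v (X w) = 0}

/-- Membership in the orthogonal group `O(Q)` (as invertible linear maps preserving `Q`). -/
def InO {K : Type} [Field K] {M : Type} [AddCommGroup M] [Module K M]
    (Q : QuadraticForm K M) (g : M ≃ₗ[K] M) : Prop :=
  ∀ v, Q (g v) = Q v

/-- Membership in the special orthogonal group `SO(Q)`. -/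
def InSO {K : Type} [Field K] {M : Type} [AddCommGroup M] [Module K M]
    (Q : QuadraticForm K M) (g : M ≃ₗ[K] M) : Prop :=
  InO Q g ∧ LinearMap.det (g : M →ₗ[K] M) = 1

/-- A nilpotent endomorphism has Jordan type `λ` when `dim ker (X^i) = Σ_j min(i, λ_j)`. -/
def HasJordanType {K : Type} [Field K] {M : Type} [AddCommGroup M] [Module K M]
    {n : ℕ} (X : Module.End K M) (lam : Nat.Partition n) : Prop :=
  ∀ i : ℕ, Module.finrank K (LinearMap.ker (X ^ i)) = (lam.parts.map (fun part => min i part)).sum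

/-- `Λ(n)`: partitions of `n` in which every even part has even multiplicity. -/
def LambdaSet (n : ℕ) : Set (Nat.Partition n) :=
  {lam | ∀ j : ℕ, Even j → Even (lam.parts.count j)}


/-- The data of a pair `(λ, c)`: a partition `λ ∈ Λ(n)` together with a choice, for each
distinct odd value `j` of `λ`, of a nondegenerate quadratic form of degree `m_j(λ)`, whose
orthogonal sum is Witt equivalent to `Q`. -/
def PairData (K : Type) [Field K] {n : ℕ} (Q : QF K n) : Type :=
  Σ lam : {l : Nat.Partition n // l ∈ LambdaSet n},
    {Qt : ∀ j : {j : ℕ // j ∈ lam.1.parts.toFinset.filter (fun j : ℕ => Odd j)},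
        QF K (lam.1.parts.count j.1) //
      (∀ j, QNondeg (Qt j)) ∧ WittEquiv (QuadraticMap.pi (fun j => Qt j)) Q}

/-- Two pair data are equivalent when they have the same partition and componentwise
isometric forms; quotienting gives pairs `(λ, c)` of a partition and a tuple of isometry
classes. -/
def PairRel (K : Type) [Field K] {n : ℕ} (Q : QF K n) (x y : PairData K Q) : Prop :=
  x.1 = y.1 ∧ ∀ jx jy, (jx.1 : ℕ) = jy.1 → QIsom (x.2.1 jx) (y.2.1 jy)

namespace NO
variable {K : Type} [Field K]

/-- A nondegenerate `ε`-symmetric bilinear form together with a skew endomorphism. -/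
structure Nil (ε : K) (V : Type) [AddCommGroup V] [Module K V] where
  B : V →ₗ[K] V →ₗ[K] K
  X : V →ₗ[K] V
  symm : ∀ v w, B w v = ε * B v w
  nd : ∀ v, (∀ w, B v w = 0) → v = 0
  skew : ∀ v w, B (X v) w = - B v (X w)

section
variable {ε : K} {V V' V'' P P' : Type} [AddCommGroup V] [Module K V] [AddCommGroup V'] [Module K V']
  [AddCommGroup V''] [Module K V''] [AddCommGroup P] [Module K P] [AddCommGroup P'] [Module K P']

def Iso (N : Nil ε V) (N' : Nil ε V') : Prop :=
  ∃ φ : V ≃ₗ[K] V', (∀ v w, N'.B (φ v) (φ w) = N.B v w) ∧ ∀ v, φ (N.X v) = N'.X (φ v)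

theorem Iso.refl (N : Nil ε V) : Iso N N := ⟨LinearEquiv.refl _ _, by simp, by simp⟩

theorem Iso.symm {N : Nil ε V} {N' : Nil ε V'} (h : Iso N N') : Iso N' N := by
  obtain ⟨φ, h1, h2⟩ := h
  refine ⟨φ.symm, fun v w => ?_, fun v => ?_⟩
  · rw [← h1]; simp
  · apply φ.injective; rw [h2]; simp

theorem Iso.trans {N : Nil ε V} {N' : Nil ε V'} {N'' : Nil ε V''} (h : Iso N N')
    (h' : Iso N' N'') : Iso N N'' := by
  obtain ⟨φ, h1, h2⟩ := h
  obtain ⟨ψ, h3, h4⟩ := h'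
  exact ⟨φ.trans ψ, fun v w => by simp [h3, h1], fun v => by simp [h2, h4]⟩

theorem Nil.nd' (N : Nil ε V) (v : V) (h : ∀ w, N.B w v = 0) : v = 0 :=
  N.nd v fun w => by rw [N.symm w v, h, mul_zero]

theorem Nil.skew_pow (N : Nil ε V) (i : ℕ) (v w : V) :
    N.B ((N.X ^ i) v) w = (-1) ^ i * N.B v ((N.X ^ i) w) := by
  induction i generalizing v w with
  | zero => simp
  | succ i ih =>
    have e1 : (N.X ^ (i + 1)) v = (N.X ^ i) (N.X v) := by rw [pow_succ]; rfl
    have e2 : (N.X ^ (i + 1)) w = N.X ((N.X ^ i) w) := by rw [pow_succ']; rfl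
    rw [e1, e2, ih, N.skew]
    ring

/-- Orthogonal sum of two. -/
def Nil.prod (N : Nil ε V) (M : Nil ε P) : Nil ε (V × P) where
  B := N.B.compl₁₂ (LinearMap.fst K V P) (LinearMap.fst K V P) +
    M.B.compl₁₂ (LinearMap.snd K V P) (LinearMap.snd K V P)
  X := N.X.prodMap M.X
  symm v w := by simp [N.symm v.1 w.1, M.symm v.2 w.2, mul_add]
  nd v h := by
    ext
    · exact N.nd _ fun w => by simpa using h (w, 0)
    · exact M.nd _ fun w => by simpa using h (0, w)
  skew v w := by simp [N.skew, M.skew, add_comm]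

@[simp] theorem Nil.prod_B (N : Nil ε V) (M : Nil ε P) (v w : V × P) :
    (N.prod M).B v w = N.B v.1 w.1 + M.B v.2 w.2 := rfl

@[simp] theorem Nil.prod_X (N : Nil ε V) (M : Nil ε P) (v : V × P) :
    (N.prod M).X v = (N.X v.1, M.X v.2) := rfl

@[simp] theorem Nil.prod_pow (N : Nil ε V) (M : Nil ε P) (i : ℕ) (v : V × P) :
    ((N.prod M).X ^ i) v = ((N.X ^ i) v.1, (M.X ^ i) v.2) := by
  induction i generalizing v with
  | zero => simp
  | succ i ih => simp only [pow_succ, Module.End.mul_apply, ih, Nil.prod_X]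

theorem Iso.prod {N : Nil ε V} {N' : Nil ε V'} {M : Nil ε P} {M' : Nil ε P'} (h : Iso N N')
    (h' : Iso M M') : Iso (N.prod M) (N'.prod M') := by
  obtain ⟨φ, h1, h2⟩ := h
  obtain ⟨ψ, h3, h4⟩ := h'
  exact ⟨φ.prodCongr ψ, fun v w => by simp [h1, h3], fun v => by simp [h2, h4]⟩

/-- Orthogonal sum of a family. -/
def Nil.pi {ι : Type} [Fintype ι] [DecidableEq ι] {F : ι → Type} [∀ i, AddCommGroup (F i)]
    [∀ i, Module K (F i)] (N : ∀ i, Nil ε (F i)) : Nil ε (∀ i, F i) where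
  B := ∑ i, (N i).B.compl₁₂ (LinearMap.proj i) (LinearMap.proj i)
  X := LinearMap.pi fun i => (N i).X ∘ₗ LinearMap.proj i
  symm v w := by
    simp only [LinearMap.sum_apply, LinearMap.compl₁₂_apply, LinearMap.proj_apply, Finset.mul_sum]
    exact Finset.sum_congr rfl fun i _ => (N i).symm _ _
  nd v h := by
    ext i
    refine (N i).nd _ fun w => ?_
    have := h (Pi.single i w)
    simp only [LinearMap.sum_apply, LinearMap.compl₁₂_apply, LinearMap.proj_apply] at this
    rw [Finset.sum_eq_single i] at this
    · simpa using this
    · intro j _ hj; simp [hj]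
    · simp
  skew v w := by
    simp only [LinearMap.sum_apply, LinearMap.compl₁₂_apply, LinearMap.proj_apply]
    rw [← Finset.sum_neg_distrib]
    exact Finset.sum_congr rfl fun i _ => (N i).skew _ _

section
variable {ι : Type} [Fintype ι] [DecidableEq ι] {F : ι → Type} [∀ i, AddCommGroup (F i)]
    [∀ i, Module K (F i)] (N : ∀ i, Nil ε (F i))

theorem Nil.pi_B (v w : ∀ i, F i) :
    (Nil.pi N).B v w = ∑ i, (N i).B (v i) (w i) := by
  simp [Nil.pi, LinearMap.sum_apply]

theorem Nil.pi_X (v : ∀ i, F i) (i : ι) : (Nil.pi N).X v i = (N i).X (v i) := rfl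

theorem Nil.pi_pow (k : ℕ) (v : ∀ i, F i) (i : ι) :
    ((Nil.pi N).X ^ k) v i = ((N i).X ^ k) (v i) := by
  induction k generalizing v with
  | zero => simp
  | succ k ih => simp only [pow_succ, Module.End.mul_apply, ih, Nil.pi_X]
end

/-- Splitting off a nondegenerate stable subspace. -/
theorem split_off (N : Nil ε V) (M : Nil ε P) [FiniteDimensional K P] (φ : P →ₗ[K] V)
    (h1 : ∀ v w, N.B (φ v) (φ w) = M.B v w) (h2 : ∀ v, φ (M.X v) = N.X (φ v)) :
    ∃ (U : Submodule K V) (N' : Nil ε U), (∀ x, x ∈ U ↔ ∀ u, N.B (φ u) x = 0) ∧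
      (∀ x : U, (N'.X x : V) = N.X x) ∧ Iso N (M.prod N') := by
  let U : Submodule K V :=
    { carrier := {x | ∀ u, N.B (φ u) x = 0}
      zero_mem' := by simp
      add_mem' := by intro a b ha hb u; simp [ha u, hb u]
      smul_mem' := by intro c a ha u; simp [ha u] }
  have hU : ∀ x, x ∈ U ↔ ∀ u, N.B (φ u) x = 0 := fun x => Iff.rfl
  have hU' : ∀ x ∈ U, ∀ u, N.B x (φ u) = 0 := fun x hx u => by
    rw [N.symm (φ u) x, (hU x).1 hx, mul_zero]
  have hX : ∀ x ∈ U, N.X x ∈ U := fun x hx => (hU _).2 fun u => by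
    have := N.skew (φ u) x
    rw [← h2, (hU x).1 hx] at this
    simpa using this
  have hinj : Function.Injective (M.B.flip) := by
    rw [← LinearMap.ker_eq_bot, LinearMap.ker_eq_bot']
    intro m hm
    exact M.nd' m fun w => by simpa using LinearMap.congr_fun hm w
  have hsurj : Function.Surjective (M.B.flip) :=
    (LinearMap.injective_iff_surjective_of_finrank_eq_finrank
      (Subspace.dual_finrank_eq (K := K) (V := P)).symm).1 hinj
  have hdec : ∀ x : V, ∃ u : P, x - φ u ∈ U := by
    intro x
    obtain ⟨u, hu⟩ := hsurj ((N.B.flip x) ∘ₗ φ)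
    refine ⟨u, (hU _).2 fun w => ?_⟩
    have := LinearMap.congr_fun hu w
    simp only [LinearMap.flip_apply, LinearMap.comp_apply] at this
    rw [map_sub, h1, this, sub_self]
  let N' : Nil ε U :=
    { B := N.B.compl₁₂ U.subtype U.subtype
      X := N.X.restrict hX
      symm := fun v w => N.symm _ _
      nd := by
        intro v hv
        apply Subtype.ext
        refine N.nd _ fun w => ?_
        obtain ⟨u, hu⟩ := hdec w
        have h3 : N.B v (w - φ u) = 0 := hv ⟨_, hu⟩
        rw [map_sub, hU' v v.2 u, sub_zero] at h3
        exact h3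
      skew := fun v w => N.skew _ _ }
  refine ⟨U, N', hU, fun x => rfl, ?_⟩
  have hiso : Iso (M.prod N') N := by
    let f : P × U →ₗ[K] V := φ.coprod U.subtype
    have hf : ∀ v w, N.B (f v) (f w) = (M.prod N').B v w := by
      rintro ⟨a, b⟩ ⟨c, d⟩
      have e1 := (hU _).1 d.2 a
      have e2 := hU' _ b.2 c
      simp only [f, LinearMap.coprod_apply, Submodule.subtype_apply, map_add, LinearMap.add_apply,
        h1, e1, e2, Nil.prod_B]
      simp [N']
    have hfi : Function.Injective f := by
      rw [← LinearMap.ker_eq_bot, LinearMap.ker_eq_bot']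
      intro m hm
      exact (M.prod N').nd m fun w => by rw [← hf, hm]; simp
    have hfs : Function.Surjective f := by
      intro x
      obtain ⟨u, hu⟩ := hdec x
      exact ⟨(u, ⟨_, hu⟩), by simp [f]⟩
    refine ⟨LinearEquiv.ofBijective f ⟨hfi, hfs⟩, fun v w => hf v w, ?_⟩
    rintro ⟨a, b⟩
    change f ((M.prod N').X (a, b)) = N.X (f (a, b))
    simp only [f, LinearMap.coprod_apply, Nil.prod_X, h2, map_add]
    rfl
  exact hiso.symm

end
end NO

namespace NO
variable {K : Type} [Field K]
section
variable {ε : K} {V V' P : Type} [AddCommGroup V] [Module K V] [AddCommGroup V'] [Module K V']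
  [AddCommGroup P] [Module K P] {W W' : Type} [AddCommGroup W] [Module K W]
  [AddCommGroup W'] [Module K W']

def shift (K : Type) [Field K] (W : Type) [AddCommGroup W] [Module K W] (k : ℕ) :
    (Fin (k + 1) → W) →ₗ[K] (Fin (k + 1) → W) where
  toFun u := Fin.cons 0 (fun i : Fin k => u i.castSucc)
  map_add' u v := by
    ext i
    refine Fin.cases ?_ (fun i => ?_) i <;> simp
  map_smul' c u := by
    ext i
    refine Fin.cases ?_ (fun i => ?_) i <;> simp

@[simp] theorem shift_zero (k : ℕ) (u : Fin (k + 1) → W) : shift K W k u 0 = 0 := rfl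
@[simp] theorem shift_succ (k : ℕ) (u : Fin (k + 1) → W) (i : Fin k) :
    shift K W k u i.succ = u i.castSucc := rfl

theorem shift_pow (k m : ℕ) (u : Fin (k + 1) → W) (i : Fin (k + 1)) :
    ((shift K W k) ^ m) u i =
      if m ≤ (i : ℕ) then u ⟨i - m, by omega⟩ else 0 := by
  induction m generalizing i with
  | zero => simp
  | succ m ih =>
    rw [pow_succ', Module.End.mul_apply]
    refine Fin.cases ?_ (fun i => ?_) i
    · simp
    · rw [shift_succ, ih]
      simp

theorem shift_pow_top (k m : ℕ) (hm : k < m) : (shift K W k) ^ m = 0 := by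
  refine LinearMap.ext fun u => funext fun i => ?_
  rw [shift_pow, if_neg (by omega)]
  rfl

/-- The block of height `k + 1`. -/
def Block (k : ℕ) (b : W →ₗ[K] W →ₗ[K] K) (hs : ∀ v w, b w v = (-1) ^ k * b v w)
    (hn : ∀ v, (∀ w, b v w = 0) → v = 0) : Nil (1 : K) (Fin (k + 1) → W) where
  B := ∑ i : Fin (k + 1), ((-1 : K) ^ (i : ℕ)) • b.compl₁₂ (LinearMap.proj i) (LinearMap.proj i.rev)
  X := shift K W k
  symm v w := by
    simp only [LinearMap.sum_apply, LinearMap.smul_apply, LinearMap.compl₁₂_apply,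
      LinearMap.proj_apply, one_mul, smul_eq_mul]
    rw [← Equiv.sum_comp Fin.revPerm]
    refine Finset.sum_congr rfl fun i _ => ?_
    simp only [Fin.revPerm_apply, Fin.rev_rev, Fin.val_rev]
    rw [hs, ← mul_assoc, ← pow_add]
    congr 1
    have : k + 1 - ((i : ℕ) + 1) + k = i + 2 * (k - i) := by omega
    rw [this, pow_add, pow_mul]; simp
  nd v h := by
    ext i
    refine hn _ fun w => ?_
    have := h (Pi.single i.rev w)
    simp only [LinearMap.sum_apply, LinearMap.smul_apply, LinearMap.compl₁₂_apply,
      LinearMap.proj_apply, smul_eq_mul] at this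
    rw [Finset.sum_eq_single i] at this
    · simpa using this
    · intro j _ hj
      rw [Pi.single_eq_of_ne (by simpa using hj)]; simp
    · simp
  skew v w := by
    simp only [LinearMap.sum_apply, LinearMap.smul_apply, LinearMap.compl₁₂_apply,
      LinearMap.proj_apply, smul_eq_mul]
    rw [Fin.sum_univ_succ, Fin.sum_univ_castSucc (n := k)]
    simp only [shift_zero, shift_succ, Fin.rev_last, Fin.rev_castSucc, Fin.rev_succ, map_zero,
      LinearMap.zero_apply, mul_zero, zero_add, add_zero, Fin.val_succ, Fin.val_castSucc]
    rw [← Finset.sum_neg_distrib]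
    exact Finset.sum_congr rfl fun i _ => by ring

section
variable (k : ℕ) (b : W →ₗ[K] W →ₗ[K] K) (hs : ∀ v w, b w v = (-1) ^ k * b v w)
    (hn : ∀ v, (∀ w, b v w = 0) → v = 0)

theorem Block_B (u v : Fin (k + 1) → W) : (Block k b hs hn).B u v =
    ∑ i : Fin (k + 1), (-1 : K) ^ (i : ℕ) * b (u i) (v i.rev) := by
  simp [Block, LinearMap.sum_apply]

theorem Block_X : (Block k b hs hn).X = shift K W k := rfl

theorem finrank_ker_shift (i : ℕ) [FiniteDimensional K W] :
    Module.finrank K (LinearMap.ker ((shift K W k) ^ i)) = min i (k + 1) * Module.finrank K W := by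
  obtain ⟨m, hm⟩ : ∃ m, m = min i (k + 1) := ⟨_, rfl⟩
  rw [← hm]
  let g : (Fin m → W) →ₗ[K] (Fin (k + 1) → W) :=
    { toFun := fun a t => if h : k + 1 - m ≤ (t : ℕ) then a ⟨t - (k + 1 - m), by omega⟩ else 0
      map_add' := by
        intro a c; ext t; simp only [Pi.add_apply]; split_ifs <;> simp
      map_smul' := by
        intro a c; ext t; simp only [Pi.smul_apply]; split_ifs <;> simp }
  have hg : ∀ a (t : Fin (k + 1)), g a t =
    if h : k + 1 - m ≤ (t : ℕ) then a ⟨t - (k + 1 - m), by omega⟩ else 0 := fun _ _ => rfl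
  have hinj : Function.Injective g := by
    intro a c h
    ext t
    have := congrFun h ⟨t + (k + 1 - m), by omega⟩
    rw [hg, hg] at this
    simpa using this
  have hr : LinearMap.ker ((shift K W k) ^ i) = LinearMap.range g := by
    ext u
    simp only [LinearMap.mem_ker, LinearMap.mem_range]
    constructor
    · intro h
      refine ⟨fun t => u ⟨t + (k + 1 - m), by omega⟩, ?_⟩
      ext t
      rw [hg]
      split_ifs with h1
      · congr 1; ext; simp; omega
      · have := congrFun h ⟨t + i, by omega⟩
        rw [shift_pow] at this
        simpa using this.symm
    · rintro ⟨a, rfl⟩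
      ext t
      rw [shift_pow]
      split_ifs with h1
      · rw [hg, dif_neg (by simp; omega)]; rfl
      · rfl
  rw [hr, LinearMap.finrank_range_of_inj hinj, Module.finrank_pi_fintype]
  simp
end

/-- The `j`-th form on `ker X^j` vanishes. -/
def Zero (N : Nil ε V) (j : ℕ) : Prop :=
  ∀ u v, (N.X ^ j) u = 0 → (N.X ^ j) v = 0 → N.B u ((N.X ^ (j - 1)) v) = 0

/-- The `j`-th form on `ker X^j` reduces to `b`. -/
def Red (N : Nil ε V) (j : ℕ) (b : W →ₗ[K] W →ₗ[K] K) : Prop :=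
  ∃ f : V →ₗ[K] W, (∀ w, ∃ v, (N.X ^ j) v = 0 ∧ f v = w) ∧
    ∀ u v, (N.X ^ j) u = 0 → (N.X ^ j) v = 0 → b (f u) (f v) = N.B u ((N.X ^ (j - 1)) v)

theorem Block_zero (k : ℕ) (b : W →ₗ[K] W →ₗ[K] K) (hs hn) (j : ℕ) (hj : j ≠ k + 1) (hj0 : 0 < j) :
    Zero (Block k b hs hn) j := by
  intro u v hu hv
  rw [Block_X] at hu hv
  rw [Block_B, Block_X]
  refine Finset.sum_eq_zero fun i _ => ?_
  by_cases h1 : (i : ℕ) + j < k + 1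
  · have := congrFun hu ⟨i + j, h1⟩
    rw [shift_pow] at this
    have h2 : u i = 0 := by simpa using this
    simp [h2]
  · rw [shift_pow]
    split_ifs with h2
    · rw [Fin.val_rev] at h2
      have := congrFun hv ⟨j, by omega⟩
      rw [shift_pow] at this
      have h3 : v 0 = 0 := by simpa using this
      have h4 : (⟨(i.rev : ℕ) - (j - 1), by omega⟩ : Fin (k + 1)) = 0 := by
        ext; simp [Fin.val_rev]; omega
      rw [h4, h3]; simp
    · simp

theorem Block_red (k : ℕ) (b : W →ₗ[K] W →ₗ[K] K) (hs hn) :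
    Red (Block k b hs hn) (k + 1) b := by
  refine ⟨LinearMap.proj 0, fun w => ⟨Pi.single 0 w, ?_, by simp⟩, fun u v _ _ => ?_⟩
  · rw [Block_X, shift_pow_top _ _ (by omega)]; rfl
  · rw [Block_B, Block_X, Fin.sum_univ_succ]
    have : ∀ i : Fin k, ((shift K W k) ^ k) v i.succ.rev = 0 := fun i => by
      rw [shift_pow, if_neg (by have := i.2; simp [Fin.val_rev]; omega)]
    simp only [Nat.add_sub_cancel, this, map_zero, mul_zero, Finset.sum_const_zero, add_zero]
    rw [shift_pow, if_pos (by simp)]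
    simp

theorem Iso.pow {N : Nil ε V} {N' : Nil ε V'} {φ : V ≃ₗ[K] V'}
    (h : ∀ v, φ (N.X v) = N'.X (φ v)) (i : ℕ) (v : V) : φ ((N.X ^ i) v) = (N'.X ^ i) (φ v) := by
  induction i generalizing v with
  | zero => simp
  | succ i ih => simp only [pow_succ, Module.End.mul_apply, ih, h]

theorem Red.iso {N : Nil ε V} {N' : Nil ε V'} {j : ℕ} {b : W →ₗ[K] W →ₗ[K] K} (h : Red N j b)
    (hi : Iso N' N) : Red N' j b := by
  obtain ⟨f, h1, h2⟩ := h
  obtain ⟨φ, h3, h4⟩ := hi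
  refine ⟨f ∘ₗ φ, fun w => ?_, fun u v hu hv => ?_⟩
  · obtain ⟨v, hv, rfl⟩ := h1 w
    refine ⟨φ.symm v, ?_, by simp⟩
    apply φ.injective
    rw [Iso.pow h4]; simp [hv]
  · rw [← h3, Iso.pow h4]
    apply h2
    · rw [LinearEquiv.coe_coe, ← Iso.pow h4, hu, map_zero]
    · rw [LinearEquiv.coe_coe, ← Iso.pow h4, hv, map_zero]

theorem Iso.finrank_ker {N : Nil ε V} {N' : Nil ε V'} (hi : Iso N N') (i : ℕ) :
    Module.finrank K (LinearMap.ker (N.X ^ i)) = Module.finrank K (LinearMap.ker (N'.X ^ i)) := by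
  obtain ⟨φ, h3, h4⟩ := hi
  have : LinearMap.ker (N'.X ^ i) = (LinearMap.ker (N.X ^ i)).map (φ : V →ₗ[K] V') := by
    ext x
    simp only [Submodule.mem_map, LinearMap.mem_ker]
    constructor
    · intro h
      refine ⟨φ.symm x, ?_, by simp⟩
      apply φ.injective
      rw [Iso.pow h4]; simp [h]
    · rintro ⟨y, hy, rfl⟩
      have := Iso.pow h4 i y
      simp only [LinearEquiv.coe_coe]
      rw [← this, hy, map_zero]
  rw [this]
  exact (LinearEquiv.finrank_map_eq φ _).symm

theorem finrank_ker_prod (N : Nil ε V) (M : Nil ε P) [FiniteDimensional K V]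
    [FiniteDimensional K P] (i : ℕ) :
    Module.finrank K (LinearMap.ker ((N.prod M).X ^ i)) =
      Module.finrank K (LinearMap.ker (N.X ^ i)) + Module.finrank K (LinearMap.ker (M.X ^ i)) := by
  let e : LinearMap.ker ((N.prod M).X ^ i) ≃ₗ[K]
      LinearMap.ker (N.X ^ i) × LinearMap.ker (M.X ^ i) :=
    { toFun := fun x =>
        (⟨x.1.1, by have := x.2; simp only [LinearMap.mem_ker, Nil.prod_pow, Prod.ext_iff] at this; exact this.1⟩,
         ⟨x.1.2, by have := x.2; simp only [LinearMap.mem_ker, Nil.prod_pow, Prod.ext_iff] at this; exact this.2⟩)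
      map_add' := fun _ _ => rfl
      map_smul' := fun _ _ => rfl
      invFun := fun x => ⟨(x.1.1, x.2.1), by
        simp only [LinearMap.mem_ker, Nil.prod_pow]
        rw [LinearMap.mem_ker.1 x.1.2, LinearMap.mem_ker.1 x.2.2]; rfl⟩
      left_inv := fun _ => rfl
      right_inv := fun _ => rfl }
  rw [e.finrank_eq, Module.finrank_prod]

theorem finrank_ker_pi {ι : Type} [Fintype ι] [DecidableEq ι] {F : ι → Type}
    [∀ i, AddCommGroup (F i)] [∀ i, Module K (F i)] [∀ i, FiniteDimensional K (F i)]
    (N : ∀ i, Nil ε (F i)) (k : ℕ) :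
    Module.finrank K (LinearMap.ker ((Nil.pi N).X ^ k)) =
      ∑ i, Module.finrank K (LinearMap.ker ((N i).X ^ k)) := by
  let e : LinearMap.ker ((Nil.pi N).X ^ k) ≃ₗ[K] (∀ i, LinearMap.ker ((N i).X ^ k)) :=
    { toFun := fun x i => ⟨x.1 i, by
        have := congrFun (LinearMap.mem_ker.1 x.2) i
        rw [Nil.pi_pow] at this
        exact this⟩
      map_add' := fun _ _ => rfl
      map_smul' := fun _ _ => rfl
      invFun := fun x => ⟨fun i => (x i).1, by
        rw [LinearMap.mem_ker]
        ext i
        rw [Nil.pi_pow]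
        exact LinearMap.mem_ker.1 (x i).2⟩
      left_inv := fun _ => rfl
      right_inv := fun _ => rfl }
  rw [e.finrank_eq, Module.finrank_pi_fintype]

theorem Zero.prod {N : Nil ε V} {M : Nil ε P} {j : ℕ} (h : Zero N j) (h' : Zero M j) :
    Zero (N.prod M) j := by
  intro u v hu hv
  simp only [Nil.prod_pow, Prod.mk_eq_zero] at hu hv
  simp [h _ _ hu.1 hv.1, h' _ _ hu.2 hv.2]

theorem Zero.pi {ι : Type} [Fintype ι] [DecidableEq ι] {F : ι → Type}
    [∀ i, AddCommGroup (F i)] [∀ i, Module K (F i)] 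
    {N : ∀ i, Nil ε (F i)} {j : ℕ} (h : ∀ i, Zero (N i) j) : Zero (Nil.pi N) j := by
  intro u v hu hv
  rw [Nil.pi_B]
  refine Finset.sum_eq_zero fun i _ => ?_
  rw [Nil.pi_pow]
  have h1 := congrFun hu i
  have h2 := congrFun hv i
  rw [Nil.pi_pow] at h1 h2
  exact h i _ _ h1 h2

theorem Red.prod_left {N : Nil ε V} {M : Nil ε P} {j : ℕ} {b : W →ₗ[K] W →ₗ[K] K}
    (h : Red N j b) (h' : Zero M j) : Red (N.prod M) j b := by
  obtain ⟨f, h1, h2⟩ := h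
  refine ⟨f ∘ₗ LinearMap.fst K V P, fun w => ?_, fun u v hu hv => ?_⟩
  · obtain ⟨v, hv, rfl⟩ := h1 w
    exact ⟨(v, 0), by simp [hv], by simp⟩
  · simp only [Nil.prod_pow, Prod.mk_eq_zero] at hu hv
    simp [h2 _ _ hu.1 hv.1, h' _ _ hu.2 hv.2]

theorem Red.prod_right {N : Nil ε V} {M : Nil ε P} {j : ℕ} {b : W →ₗ[K] W →ₗ[K] K}
    (h : Red M j b) (h' : Zero N j) : Red (N.prod M) j b := by
  obtain ⟨f, h1, h2⟩ := h
  refine ⟨f ∘ₗ LinearMap.snd K V P, fun w => ?_, fun u v hu hv => ?_⟩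
  · obtain ⟨v, hv, rfl⟩ := h1 w
    exact ⟨(0, v), by simp [hv], by simp⟩
  · simp only [Nil.prod_pow, Prod.mk_eq_zero] at hu hv
    simp [h2 _ _ hu.2 hv.2, h' _ _ hu.1 hv.1]

theorem Red.pi {ι : Type} [Fintype ι] [DecidableEq ι] {F : ι → Type}
    [∀ i, AddCommGroup (F i)] [∀ i, Module K (F i)] 
    {N : ∀ i, Nil ε (F i)} {j : ℕ} {b : W →ₗ[K] W →ₗ[K] K} (i : ι) (h : Red (N i) j b)
    (h' : ∀ i', i' ≠ i → Zero (N i') j) : Red (Nil.pi N) j b := by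
  obtain ⟨f, h1, h2⟩ := h
  refine ⟨f ∘ₗ LinearMap.proj i, fun w => ?_, fun u v hu hv => ?_⟩
  · obtain ⟨v, hv, rfl⟩ := h1 w
    refine ⟨Pi.single i v, ?_, by simp⟩
    ext i'
    rw [Nil.pi_pow]
    by_cases hi : i' = i
    · subst hi; simp [hv]
    · simp [hi]
  · have h3 : ∀ i, ((N i).X ^ j) (u i) = 0 := fun i => by rw [← Nil.pi_pow, hu]; rfl
    have h4 : ∀ i, ((N i).X ^ j) (v i) = 0 := fun i => by rw [← Nil.pi_pow, hv]; rfl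
    rw [Nil.pi_B, Finset.sum_eq_single i]
    · rw [Nil.pi_pow]; exact h2 _ _ (h3 i) (h4 i)
    · intro i' _ hi
      rw [Nil.pi_pow]; exact h' i' hi _ _ (h3 i') (h4 i')
    · simp

/-- If the first factor contributes nothing, the reduction comes from the second factor. -/
theorem Red.of_prod {N : Nil ε V} {M : Nil ε P} {j : ℕ} {b : W →ₗ[K] W →ₗ[K] K}
    (hb : ∀ v, (∀ w, b v w = 0) → v = 0) (h : Red (N.prod M) j b) (h' : Zero N j) : Red M j b := by
  obtain ⟨f, h1, h2⟩ := h
  have h3 : ∀ u, (N.X ^ j) u = 0 → f (u, 0) = 0 := by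
    intro u hu
    refine hb _ fun w => ?_
    obtain ⟨v, hv, rfl⟩ := h1 w
    rw [h2 _ _ (by simp [hu]) hv]
    simp only [Nil.prod_pow, Prod.mk_eq_zero] at hv
    simp [h' _ _ hu hv.1]
  refine ⟨f ∘ₗ LinearMap.inr K V P, fun w => ?_, fun u v hu hv => ?_⟩
  · obtain ⟨v, hv, rfl⟩ := h1 w
    simp only [Nil.prod_pow, Prod.mk_eq_zero] at hv
    refine ⟨v.2, hv.2, ?_⟩
    have : v = (v.1, 0) + (0, v.2) := by simp
    rw [this, map_add, h3 _ hv.1]; simp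
  · rw [LinearMap.comp_apply, LinearMap.comp_apply, h2]
    · simp
    · simp [hu]
    · simp [hv]

/-- Isometry of bilinear forms. -/
def BIso (b : W →ₗ[K] W →ₗ[K] K) (b' : W' →ₗ[K] W' →ₗ[K] K) : Prop :=
  ∃ φ : W ≃ₗ[K] W', ∀ v w, b' (φ v) (φ w) = b v w

theorem BIso.symm {b : W →ₗ[K] W →ₗ[K] K} {b' : W' →ₗ[K] W' →ₗ[K] K} (h : BIso b b') :
    BIso b' b := by
  obtain ⟨φ, h⟩ := h
  exact ⟨φ.symm, fun v w => by rw [← h]; simp⟩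

theorem BIso.trans {W'' : Type} [AddCommGroup W''] [Module K W''] {b : W →ₗ[K] W →ₗ[K] K}
    {b' : W' →ₗ[K] W' →ₗ[K] K} {b'' : W'' →ₗ[K] W'' →ₗ[K] K} (h : BIso b b') (h' : BIso b' b'') :
    BIso b b'' := by
  obtain ⟨φ, h⟩ := h
  obtain ⟨ψ, h'⟩ := h'
  exact ⟨φ.trans ψ, fun v w => by simp [h', h]⟩

theorem Red.biso_right {N : Nil ε V} {j : ℕ} {b : W →ₗ[K] W →ₗ[K] K} {b' : W' →ₗ[K] W' →ₗ[K] K}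
    (h : Red N j b) (hb : BIso b b') : Red N j b' := by
  obtain ⟨f, h1, h2⟩ := h
  obtain ⟨φ, h3⟩ := hb
  refine ⟨φ ∘ₗ f, fun w => ?_, fun u v hu hv => ?_⟩
  · obtain ⟨v, hv, h⟩ := h1 (φ.symm w)
    exact ⟨v, hv, by simp [h]⟩
  · simp [h3, h2 u v hu hv]

theorem Red.unique {N : Nil ε V} {j : ℕ} {b : W →ₗ[K] W →ₗ[K] K} {b' : W' →ₗ[K] W' →ₗ[K] K}
    (hb : ∀ v, (∀ w, b v w = 0) → v = 0) (hb' : ∀ v, (∀ w, b' v w = 0) → v = 0)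
    (h : Red N j b) (h' : Red N j b') : BIso b b' := by
  obtain ⟨f, h1, h2⟩ := h
  obtain ⟨g, h3, h4⟩ := h'
  let S := LinearMap.ker (N.X ^ j)
  let f' := f.domRestrict S
  let g' := g.domRestrict S
  have hf : Function.Surjective f' := fun w => by
    obtain ⟨v, hv, h⟩ := h1 w
    exact ⟨⟨v, hv⟩, h⟩
  have hg : Function.Surjective g' := fun w => by
    obtain ⟨v, hv, h⟩ := h3 w
    exact ⟨⟨v, hv⟩, h⟩
  have e : ∀ u v : S, b (f' u) (f' v) = b' (g' u) (g' v) := fun u v =>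
    (h2 u v u.2 v.2).trans (h4 u v u.2 v.2).symm
  have hk : LinearMap.ker f' = LinearMap.ker g' := by
    ext u
    simp only [LinearMap.mem_ker]
    constructor
    · intro hu
      refine hb' _ fun w => ?_
      obtain ⟨v, rfl⟩ := hg w
      rw [← e, hu]; simp
    · intro hu
      refine hb _ fun w => ?_
      obtain ⟨v, rfl⟩ := hf w
      rw [e, hu]; simp
  let φ : W ≃ₗ[K] W' := (f'.quotKerEquivOfSurjective hf).symm ≪≫ₗ
    (Submodule.quotEquivOfEq _ _ hk) ≪≫ₗ (g'.quotKerEquivOfSurjective hg)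
  have hφ : ∀ u, φ (f' u) = g' u := by
    intro u
    have : (f'.quotKerEquivOfSurjective hf).symm (f' u) = Submodule.Quotient.mk u := by
      rw [LinearEquiv.symm_apply_eq]; rfl
    simp only [φ, LinearEquiv.trans_apply, this]
    rfl
  refine ⟨φ, fun v w => ?_⟩
  obtain ⟨v, rfl⟩ := hf v
  obtain ⟨w, rfl⟩ := hf w
  rw [hφ, hφ, e]

theorem Block_iso (k : ℕ) {b : W →ₗ[K] W →ₗ[K] K} (hs hn) {b' : W' →ₗ[K] W' →ₗ[K] K} (hs' hn')
    (h : BIso b b') : Iso (Block k b hs hn) (Block k b' hs' hn') := by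
  obtain ⟨φ, h⟩ := h
  refine ⟨LinearEquiv.piCongrRight fun _ => φ, fun v w => ?_, fun v => ?_⟩
  · simp [Block_B, h]
  · ext i
    rw [Block_X, Block_X]
    refine Fin.cases ?_ (fun i => ?_) i <;> simp

end
end NO

namespace NO
variable {K : Type} [Field K]
section
variable {ε : K} {V V' P : Type} [AddCommGroup V] [Module K V] [AddCommGroup V'] [Module K V']
  [AddCommGroup P] [Module K P] {W W' : Type} [AddCommGroup W] [Module K W]
  [AddCommGroup W'] [Module K W']

theorem pow_zero_of_le {X : V →ₗ[K] V} {k i : ℕ} (h : X ^ k = 0) (hi : k ≤ i) (v : V) :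
    (X ^ i) v = 0 := by
  rw [pow_eq_zero_of_le hi h]; rfl

theorem pow_pow_apply (X : V →ₗ[K] V) (i j : ℕ) (v : V) : (X ^ i) ((X ^ j) v) = (X ^ (i + j)) v := by
  rw [pow_add]; rfl

theorem Nil.symm_pow (N : Nil (1 : K) V) (i : ℕ) (v w : V) :
    N.B w ((N.X ^ i) v) = (-1) ^ i * N.B v ((N.X ^ i) w) := by
  rw [N.symm, one_mul, N.skew_pow]

/-- Every bilinear form is represented by an operator through a nondegenerate one. -/
theorem exists_rep [FiniteDimensional K W] (b β : W →ₗ[K] W →ₗ[K] K)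
    (hn : ∀ w, (∀ v, b v w = 0) → w = 0) : ∃ T : W →ₗ[K] W, ∀ v w, b v (T w) = β v w := by
  have hinj : Function.Injective (b.flip) := by
    rw [← LinearMap.ker_eq_bot, LinearMap.ker_eq_bot']
    intro m hm
    exact hn m fun w => by simpa using LinearMap.congr_fun hm w
  have hsurj : Function.Surjective (b.flip) :=
    (LinearMap.injective_iff_surjective_of_finrank_eq_finrank
      (Subspace.dual_finrank_eq (K := K) (V := W)).symm).1 hinj
  let e := LinearEquiv.ofBijective b.flip ⟨hinj, hsurj⟩
  refine ⟨e.symm.toLinearMap ∘ₗ β.flip, fun v w => ?_⟩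
  have : e (e.symm (β.flip w)) = β.flip w := e.apply_symm_apply _
  exact LinearMap.congr_fun this v

theorem adjust (h2 : (2 : K) ≠ 0) (N : Nil (1 : K) V) (k : ℕ) (hX : N.X ^ (k + 1) = 0)
    [FiniteDimensional K W] (s : W →ₗ[K] V)
    (hn : ∀ w, (∀ v, N.B (s v) ((N.X ^ k) (s w)) = 0) → w = 0) (r : ℕ) (hr : r ≤ k) :
    ∃ s' : W →ₗ[K] V, (∀ w, (N.X ^ k) (s' w) = (N.X ^ k) (s w)) ∧
      ∀ i v w, k - r ≤ i → i < k → N.B (s' v) ((N.X ^ i) (s' w)) = 0 := by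
  induction r with
  | zero => exact ⟨s, fun _ => rfl, fun i v w h1 h2 => by omega⟩
  | succ r ih =>
    obtain ⟨t, ht1, ht2⟩ := ih (by omega)
    obtain ⟨m, hm⟩ : ∃ m, m + (r + 1) = k := ⟨k - (r + 1), by omega⟩
    let b : W →ₗ[K] W →ₗ[K] K := N.B.compl₁₂ t ((N.X ^ k) ∘ₗ t)
    let β : W →ₗ[K] W →ₗ[K] K := N.B.compl₁₂ t ((N.X ^ m) ∘ₗ t)
    have hb : ∀ v w, b v w = N.B (t v) ((N.X ^ k) (t w)) := fun _ _ => rfl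
    have hβ : ∀ v w, β v w = N.B (t v) ((N.X ^ m) (t w)) := fun _ _ => rfl
    have hbs : ∀ v w, b v w = N.B (s v) ((N.X ^ k) (s w)) := fun v w => by
      rw [hb, ht1, N.symm_pow, ← N.symm_pow, N.symm, one_mul]
      have := N.skew_pow k (s w) (t v)
      rw [this, ht1, N.symm_pow k (s w) (s v)]
    obtain ⟨T, hT⟩ := exists_rep b ((-(1 / 2 : K)) • β) (fun w hw => hn w fun v => by
      rw [← hbs]; exact hw v)
    simp only [LinearMap.smul_apply, smul_eq_mul] at hT
    have key : ∀ i v w, N.B ((t + (N.X ^ (r + 1)) ∘ₗ t ∘ₗ T) v)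
        ((N.X ^ i) ((t + (N.X ^ (r + 1)) ∘ₗ t ∘ₗ T) w)) =
        N.B (t v) ((N.X ^ i) (t w)) + N.B (t v) ((N.X ^ (i + (r + 1))) (t (T w))) +
        ((-1) ^ (r + 1) * N.B (t (T v)) ((N.X ^ (r + 1 + i)) (t w)) +
        (-1) ^ (r + 1) * N.B (t (T v)) ((N.X ^ (r + 1 + (i + (r + 1)))) (t (T w)))) := by
      intro i v w
      simp only [LinearMap.add_apply, LinearMap.comp_apply, map_add, N.skew_pow, pow_pow_apply]
      ring
    refine ⟨t + (N.X ^ (r + 1)) ∘ₗ t ∘ₗ T, fun w => ?_, fun i v w h1 h3 => ?_⟩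
    · rw [← ht1]
      simp only [LinearMap.add_apply, LinearMap.comp_apply, map_add, pow_pow_apply]
      rw [pow_zero_of_le hX (i := k + (r + 1)) (by omega), add_zero]
    · rw [key]
      by_cases him : i = m
      · subst him
        rw [hm, add_comm (r + 1) i, hm, pow_zero_of_le hX (i := r + 1 + k) (by omega), ← hb, ← hb, hT]
        have e1 : b (T v) w = (-1) ^ k * b w (T v) := N.symm_pow k _ _
        have e2 : β w v = (-1) ^ i * β v w := N.symm_pow i _ _
        rw [e1, hT, e2, ← hβ]
        have e3 : ((-1 : K)) ^ (r + 1) * ((-1) ^ k * (-(1 / 2) * ((-1) ^ i * β v w))) =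
            -(1 / 2) * β v w * ((-1) ^ (i + (r + 1)) * (-1) ^ k) := by ring
        rw [e3, hm, ← pow_add, ← two_mul, pow_mul]
        simp only [even_two, Even.neg_pow, one_pow, map_zero, mul_zero, add_zero, mul_one]
        field_simp
        ring
      · rw [ht2 i v w (by omega) h3, pow_zero_of_le hX (i := i + (r + 1)) (by omega),
          pow_zero_of_le hX (i := r + 1 + i) (by omega),
          pow_zero_of_le hX (i := r + 1 + (i + (r + 1))) (by omega)]
        simp

theorem split_top (h2 : (2 : K) ≠ 0) [FiniteDimensional K V] (N : Nil (1 : K) V) (k : ℕ)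
    (hX : N.X ^ (k + 1) = 0) :
    ∃ (d : ℕ) (b : (Fin d → K) →ₗ[K] (Fin d → K) →ₗ[K] K) (hs : ∀ v w, b w v = (-1) ^ k * b v w)
      (hn : ∀ v, (∀ w, b v w = 0) → v = 0) (U : Submodule K V) (N' : Nil (1 : K) U),
      N'.X ^ k = 0 ∧ Iso N ((Block k b hs hn).prod N') := by
  obtain ⟨C, hC⟩ := Submodule.exists_isCompl (LinearMap.ker (N.X ^ k))
  let d := Module.finrank K C
  let e : (Fin d → K) ≃ₗ[K] C := (Module.finBasis K C).equivFun.symm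
  let s : (Fin d → K) →ₗ[K] V := C.subtype ∘ₗ e.toLinearMap
  have hs0 : ∀ v : V, ∃ w, (N.X ^ k) v = (N.X ^ k) (s w) := by
    intro v
    obtain ⟨y, hy, z, hz, rfl⟩ := Submodule.mem_sup.1
      (show v ∈ LinearMap.ker (N.X ^ k) ⊔ C by rw [hC.sup_eq_top]; trivial)
    refine ⟨e.symm ⟨z, hz⟩, ?_⟩
    simp [s, LinearMap.mem_ker.1 hy]
  have hn0 : ∀ w, (∀ v, N.B (s v) ((N.X ^ k) (s w)) = 0) → w = 0 := by
    intro w hw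
    have h1 : (N.X ^ k) (s w) = 0 := by
      refine N.nd _ fun v => ?_
      obtain ⟨u, hu⟩ := hs0 v
      rw [N.skew_pow, hu, N.symm_pow, hw]; simp
    have h3 : (e w : V) = 0 := by
      have := Submodule.mem_inf.2 ⟨LinearMap.mem_ker.2 h1, (e w).2⟩
      rw [hC.inf_eq_bot] at this
      exact this
    have h4 : e w = 0 := Subtype.ext h3
    simpa using h4
  obtain ⟨t, ht1, ht2⟩ := adjust h2 N k hX s hn0 k le_rfl
  let b : (Fin d → K) →ₗ[K] (Fin d → K) →ₗ[K] K := N.B.compl₁₂ t ((N.X ^ k) ∘ₗ t)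
  have hb : ∀ v w, b v w = N.B (t v) ((N.X ^ k) (t w)) := fun _ _ => rfl
  have hbs : ∀ v w, b v w = N.B (s v) ((N.X ^ k) (s w)) := fun v w => by
    rw [hb, ht1, N.symm, one_mul]
    have := N.skew_pow k (s w) (t v)
    rw [this, ht1, N.symm_pow k (s w) (s v)]
  have hs : ∀ v w, b w v = (-1) ^ k * b v w := fun v w => N.symm_pow k _ _
  have hn : ∀ v, (∀ w, b v w = 0) → v = 0 := fun v hv => hn0 v fun w => by
    rw [← hbs, hs v w, hv, mul_zero]
  let φ : (Fin (k + 1) → Fin d → K) →ₗ[K] V :=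
    ∑ i : Fin (k + 1), (N.X ^ (i : ℕ)) ∘ₗ t ∘ₗ LinearMap.proj i
  have hφ : ∀ u, φ u = ∑ i : Fin (k + 1), (N.X ^ (i : ℕ)) (t (u i)) := fun u => by
    simp [φ, LinearMap.sum_apply]
  have h1 : ∀ v w, N.B (φ v) (φ w) = (Block k b hs hn).B v w := by
    intro v w
    rw [hφ, hφ, Block_B]
    simp only [map_sum, LinearMap.sum_apply]
    rw [Finset.sum_comm]
    refine Finset.sum_congr rfl fun i _ => ?_
    rw [Finset.sum_eq_single i.rev]
    · rw [N.skew_pow, pow_pow_apply, hb]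
      congr 4
      rw [Fin.val_rev]; omega
    · intro j _ hj
      rw [N.skew_pow, pow_pow_apply]
      have : (j : ℕ) ≠ k - i := fun h => hj (by ext; rw [Fin.val_rev]; omega)
      rcases lt_or_ge ((i : ℕ) + j) k with h | h
      · rw [ht2 _ _ _ (by omega) h, mul_zero]
      · rw [pow_zero_of_le hX (by omega)]; simp
    · simp
  have h3 : ∀ v, φ ((Block k b hs hn).X v) = N.X (φ v) := by
    intro v
    rw [hφ, hφ, Block_X, Fin.sum_univ_succ, Fin.sum_univ_castSucc, map_add, map_sum]
    have e1 : ∀ i x, N.X ((N.X ^ i) x) = (N.X ^ (i + 1)) x := fun i x => by rw [pow_succ']; rfl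
    simp only [shift_zero, shift_succ, e1, Fin.val_last, hX, map_zero, zero_add, Fin.val_castSucc,
      Fin.val_succ, LinearMap.zero_apply, add_zero]
  obtain ⟨U, N', hU, hN', hiso⟩ := split_off N (Block k b hs hn) φ h1 h3
  refine ⟨d, b, hs, hn, U, N', ?_, hiso⟩
  have hp : ∀ i (x : U), ((N'.X ^ i) x : V) = (N.X ^ i) x := by
    intro i
    induction i with
    | zero => simp
    | succ i ih => intro x; simp only [pow_succ, Module.End.mul_apply, ih, hN']
  refine LinearMap.ext fun x => Subtype.ext ?_
  rw [hp]
  refine N.nd _ fun v => ?_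
  obtain ⟨u, hu⟩ := hs0 v
  rw [N.skew_pow, hu, ← ht1, N.symm, one_mul]
  have h5 := (hU _).1 x.2 (Pi.single (Fin.last k) u)
  rw [hφ, Finset.sum_eq_single (Fin.last k)] at h5
  · simp only [Fin.val_last, Pi.single_eq_same] at h5
    rw [h5, mul_zero]
  · intro j _ hj; simp [hj]
  · simp

end
end NO

namespace NO
variable {K : Type} [Field K]
section
variable {ε : K} {V V' P : Type} [AddCommGroup V] [Module K V] [AddCommGroup V'] [Module K V']
  [AddCommGroup P] [Module K P] {W W' : Type} [AddCommGroup W] [Module K W]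
  [AddCommGroup W'] [Module K W']

def plane (K : Type) [Field K] : Nil (-1 : K) (K × K) where
  B := LinearMap.mk₂ K (fun x y => x.1 * y.2 - x.2 * y.1)
    (by intros; simp; ring) (by intros; simp; ring) (by intros; simp; ring) (by intros; simp; ring)
  X := 0
  symm v w := by simp; ring
  nd v h := by
    have h1 := h (0, 1)
    have h2 := h (1, 0)
    simp at h1 h2
    ext
    · exact h1
    · exact h2
  skew v w := by simp

theorem plane_B (v w : K × K) : (plane K).B v w = v.1 * w.2 - v.2 * w.1 := rfl

/-- The standard symplectic space. -/
def Std (K : Type) [Field K] (e : ℕ) : Nil (-1 : K) (Fin e → K × K) := Nil.pi fun _ => plane K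

theorem Std_X (e : ℕ) : (Std K e).X = 0 := by
  refine LinearMap.ext fun v => funext fun i => ?_
  rfl

theorem Std_succ (e : ℕ) : Iso ((plane K).prod (Std K e)) (Std K (e + 1)) := by
  refine ⟨Fin.consLinearEquiv K (fun _ : Fin (e + 1) => K × K), fun v w => ?_, fun v => ?_⟩
  · rw [Std, Std, Nil.pi_B, Fin.sum_univ_succ, Nil.prod_B, Nil.pi_B]
    simp
  · rw [Std_X]
    have : ((plane K).prod (Std K e)).X v = 0 := by
      rw [Nil.prod_X, Std_X]; rfl
    rw [this]; simp

theorem sympl (h2 : (2 : K) ≠ 0) (n : ℕ) : ∀ (V : Type) [AddCommGroup V] [Module K V]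
    [FiniteDimensional K V] (N : Nil (-1 : K) V), N.X = 0 → Module.finrank K V = n →
    ∃ e, Iso N (Std K e) := by
  induction n using Nat.strong_induction_on with
  | _ n ih =>
  intro V _ _ _ N hX hV
  by_cases hn : n = 0
  · subst hn
    have : Subsingleton V := Module.finrank_zero_iff.1 hV
    exact ⟨0, ⟨0, 0, fun x => Subsingleton.elim _ _, fun x => Subsingleton.elim _ _⟩,
      fun v w => by rw [Subsingleton.elim v 0]; simp [Std, Nil.pi_B], fun v => Subsingleton.elim _ _⟩
  · have : Nontrivial V := Module.nontrivial_of_finrank_pos (R := K) (by omega)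
    obtain ⟨v, hv⟩ := exists_ne (0 : V)
    obtain ⟨w, hw⟩ : ∃ w, N.B v w ≠ 0 := by
      by_contra h
      push Not at h
      exact hv (N.nd v h)
    obtain ⟨w, hw⟩ : ∃ w, N.B v w = 1 := ⟨(N.B v w)⁻¹ • w, by simp [hw]⟩
    have hself : ∀ x, N.B x x = 0 := fun x => by
      have h3 := N.symm x x
      have : (2 : K) * N.B x x = 0 := by linear_combination h3
      exact (mul_eq_zero.1 this).resolve_left h2
    have hwv : N.B w v = -1 := by rw [N.symm v w, hw]; simp
    let φ : K × K →ₗ[K] V := (LinearMap.toSpanSingleton K V v).coprod (LinearMap.toSpanSingleton K V w)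
    obtain ⟨U, N', -, hX', hiso⟩ := split_off N (plane K) φ (by
      intro x y
      simp only [φ, LinearMap.coprod_apply, LinearMap.toSpanSingleton_apply, map_add, map_smul,
        LinearMap.add_apply, LinearMap.smul_apply, smul_eq_mul, hself, hw, hwv, plane_B]
      ring) (by intro x; rw [hX]; simp [plane])
    have hfr : Module.finrank K U < n := by
      obtain ⟨ψ, -⟩ := hiso
      have := ψ.finrank_eq
      rw [Module.finrank_prod, Module.finrank_prod] at this
      simp at this
      omega
    obtain ⟨e, he⟩ := ih _ hfr U N' (LinearMap.ext fun x => Subtype.ext (by rw [hX', hX]; rfl)) rfl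
    exact ⟨e + 1, (hiso.trans ((Iso.refl _).prod he)).trans (Std_succ e)⟩

theorem sympl_form (h2 : (2 : K) ≠ 0) [FiniteDimensional K W] (b : W →ₗ[K] W →ₗ[K] K)
    (hs : ∀ v w, b w v = -b v w) (hn : ∀ v, (∀ w, b v w = 0) → v = 0) :
    ∃ e, Module.finrank K W = 2 * e ∧ BIso b (Std K e).B := by
  let N : Nil (-1 : K) W := ⟨b, 0, by simpa using hs, hn, by simp⟩
  obtain ⟨e, φ, h1, -⟩ := sympl h2 _ W N rfl rfl
  refine ⟨e, ?_, φ, h1⟩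
  rw [φ.finrank_eq, Module.finrank_pi_fintype]
  simp [mul_comm]

theorem sympl_unique (h2 : (2 : K) ≠ 0) [FiniteDimensional K W] [FiniteDimensional K W']
    (b : W →ₗ[K] W →ₗ[K] K)
    (hs : ∀ v w, b w v = -b v w) (hn : ∀ v, (∀ w, b v w = 0) → v = 0)
    (b' : W' →ₗ[K] W' →ₗ[K] K)
    (hs' : ∀ v w, b' w v = -b' v w) (hn' : ∀ v, (∀ w, b' v w = 0) → v = 0)
    (h : Module.finrank K W = Module.finrank K W') : BIso b b' := by
  obtain ⟨e, h1, h3⟩ := sympl_form h2 b hs hn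
  obtain ⟨e', h1', h3'⟩ := sympl_form h2 b' hs' hn'
  obtain rfl : e = e' := by omega
  exact h3.trans h3'.symm

def JT (N : Nil ε V) (s : Multiset ℕ) : Prop :=
  ∀ i : ℕ, Module.finrank K (LinearMap.ker (N.X ^ i)) = (s.map (fun part => min i part)).sum

theorem exist (h2 : (2 : K) ≠ 0) (k : ℕ) : ∀ (V : Type) [AddCommGroup V] [Module K V]
    [FiniteDimensional K V] (N : Nil (1 : K) V), N.X ^ k = 0 →
    ∃ s : Multiset ℕ, (∀ x ∈ s, 0 < x ∧ x ≤ k) ∧ JT N s ∧ (∀ j, Even j → Even (s.count j)) ∧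
      ∀ j, Odd j → ∃ b : (Fin (s.count j) → K) →ₗ[K] (Fin (s.count j) → K) →ₗ[K] K,
        (∀ v w, b w v = b v w) ∧ (∀ v, (∀ w, b v w = 0) → v = 0) ∧ Red N j b := by
  induction k with
  | zero =>
    intro V _ _ _ N hX
    have hV : ∀ v : V, v = 0 := fun v => by
      have := LinearMap.congr_fun hX v
      simpa using this
    have : Subsingleton V := ⟨fun a b => by rw [hV a, hV b]⟩
    refine ⟨0, by simp, fun i => ?_, by simp, fun j hj => ?_⟩
    · simp [Module.finrank_zero_of_subsingleton]
    · have hs : ∀ x y : Fin (Multiset.count j 0) → K, x = y := by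
        rw [Multiset.count_zero]; exact fun x y => Subsingleton.elim _ _
      refine ⟨0, by simp, fun v _ => hs _ _, 0, fun w => ⟨0, by simp, hs _ _⟩, fun u v _ _ => ?_⟩
      rw [hV u, map_zero N.B, LinearMap.zero_apply]
      rfl
  | succ k ih =>
    intro V _ _ _ N hX
    obtain ⟨d, b, hs, hn, U, N', hX', hiso⟩ := split_top h2 N k hX
    obtain ⟨s, h1, h3, h4, h5⟩ := ih U N' hX'
    have hc : ∀ j, j ≠ k + 1 → (s + Multiset.replicate d (k + 1)).count j = s.count j := by
      intro j hj
      rw [Multiset.count_add, Multiset.count_replicate, if_neg (by omega), add_zero]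
    have hc' : (s + Multiset.replicate d (k + 1)).count (k + 1) = d := by
      rw [Multiset.count_add, Multiset.count_replicate_self, Multiset.count_eq_zero_of_notMem, zero_add]
      intro h
      have := h1 _ h
      omega
    refine ⟨s + Multiset.replicate d (k + 1), ?_, ?_, ?_, ?_⟩
    · intro x hx
      rcases Multiset.mem_add.1 hx with h | h
      · have := h1 x h; omega
      · have := Multiset.eq_of_mem_replicate h; omega
    · intro i
      rw [hiso.finrank_ker, finrank_ker_prod, Block_X, finrank_ker_shift, h3 i]
      simp [mul_comm, add_comm]
    · intro j hj
      by_cases hjk : j = k + 1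
      · subst hjk
        rw [hc']
        have hk : Odd k := by rw [Nat.even_add_one] at hj; exact Nat.not_even_iff_odd.1 hj
        obtain ⟨e, he, -⟩ := sympl_form h2 b (fun v w => by rw [hs, hk.neg_one_pow]; simp) hn
        simp at he
        exact ⟨e, by omega⟩
      · rw [hc j hjk]; exact h4 j hj
    · intro j hj
      by_cases hjk : j = k + 1
      · subst hjk
        rw [hc']
        have hk : Even k := by
          by_contra h
          have := Nat.not_even_iff_odd.1 h
          exact Nat.not_odd_iff_even.2 this.add_one hj
        refine ⟨b, fun v w => by rw [hs, hk.neg_one_pow, one_mul], hn, ?_⟩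
        refine Red.iso ((Block_red k b hs hn).prod_left ?_) hiso
        intro u v _ _
        rw [Nat.add_sub_cancel, hX']; simp
      · rw [hc j hjk]
        obtain ⟨b', h6, h7, h8⟩ := h5 j hj
        exact ⟨b', h6, h7, Red.iso (h8.prod_right (Block_zero k b hs hn j hjk hj.pos)) hiso⟩

theorem uniq (h2 : (2 : K) ≠ 0) (k : ℕ) : ∀ (V V' : Type) [AddCommGroup V] [Module K V]
    [FiniteDimensional K V] [AddCommGroup V'] [Module K V'] [FiniteDimensional K V']
    (N : Nil (1 : K) V) (N' : Nil (1 : K) V'), N.X ^ k = 0 → N'.X ^ k = 0 →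
    (∀ i, Module.finrank K (LinearMap.ker (N.X ^ i)) = Module.finrank K (LinearMap.ker (N'.X ^ i))) →
    (∀ j, Odd j → ∃ (m : ℕ) (b : (Fin m → K) →ₗ[K] (Fin m → K) →ₗ[K] K),
      (∀ v, (∀ w, b v w = 0) → v = 0) ∧ Red N j b ∧ Red N' j b) → Iso N N' := by
  induction k with
  | zero =>
    intro V V' _ _ _ _ _ _ N N' hX hX' _ _
    have hV : ∀ v : V, v = 0 := fun v => by
      have := LinearMap.congr_fun hX v
      simpa using this
    have hV' : ∀ v : V', v = 0 := fun v => by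
      have := LinearMap.congr_fun hX' v
      simpa using this
    exact ⟨⟨0, 0, fun x => by rw [hV x]; simp, fun x => by rw [hV' x]; simp⟩,
      fun v w => by rw [hV v]; simp, fun v => by rw [hV v]; simp⟩
  | succ k ih =>
    intro V V' _ _ _ _ _ _ N N' hX hX' hk hr
    obtain ⟨d, b, hs, hn, U, M, hM, hiso⟩ := split_top h2 N k hX
    obtain ⟨d', b', hs', hn', U', M', hM', hiso'⟩ := split_top h2 N' k hX'
    have e1 : ∀ i, min i (k + 1) * d + Module.finrank K (LinearMap.ker (M.X ^ i)) =
        min i (k + 1) * d' + Module.finrank K (LinearMap.ker (M'.X ^ i)) := by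
      intro i
      have := hk i
      rw [hiso.finrank_ker, hiso'.finrank_ker, finrank_ker_prod, finrank_ker_prod, Block_X, Block_X,
        finrank_ker_shift, finrank_ker_shift] at this
      simpa using this
    have hd : d = d' := by
      have a1 := e1 k
      have a2 := e1 (k + 1)
      have p1 : M.X ^ (k + 1) = 0 := pow_eq_zero_of_le (by omega) hM
      have p2 : M'.X ^ (k + 1) = 0 := pow_eq_zero_of_le (by omega) hM'
      rw [p1, p2] at a2
      rw [hM, hM'] at a1
      rw [min_eq_left (by omega)] at a1
      rw [min_self] at a2
      nlinarith
    subst hd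
    have hMM : Iso M M' := by
      refine ih U U' M M' hM hM' (fun i => by have := e1 i; omega) fun j hj => ?_
      by_cases hjk : j = k + 1
      · subst hjk
        refine ⟨0, 0, fun _ _ => Subsingleton.elim _ _, ⟨0, fun w => ⟨0, by simp, Subsingleton.elim _ _⟩, ?_⟩,
          ⟨0, fun w => ⟨0, by simp, Subsingleton.elim _ _⟩, ?_⟩⟩
        · intro u v _ _
          rw [Nat.add_sub_cancel, hM]; simp
        · intro u v _ _
          rw [Nat.add_sub_cancel, hM']; simp
      · obtain ⟨m, c, hc, hc1, hc2⟩ := hr j hj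
        exact ⟨m, c, hc, (hc1.iso hiso.symm).of_prod hc (Block_zero _ _ _ _ _ hjk hj.pos),
          (hc2.iso hiso'.symm).of_prod hc (Block_zero _ _ _ _ _ hjk hj.pos)⟩
    have hbb : BIso b b' := by
      rcases Nat.even_or_odd k with hk | hk
      · obtain ⟨m, c, hc, hc1, hc2⟩ := hr (k + 1) hk.add_one
        have r1 : Red N (k + 1) b := Red.iso ((Block_red k b hs hn).prod_left (by
          intro u v _ _
          rw [Nat.add_sub_cancel, hM]; simp)) hiso
        have r2 : Red N' (k + 1) b' := Red.iso ((Block_red k b' hs' hn').prod_left (by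
          intro u v _ _
          rw [Nat.add_sub_cancel, hM']; simp)) hiso'
        exact (Red.unique hn hc r1 hc1).trans (Red.unique hc hn' hc2 r2)
      · exact sympl_unique h2 b (fun v w => by rw [hs, hk.neg_one_pow]; simp) hn b'
          (fun v w => by rw [hs', hk.neg_one_pow]; simp) hn' rfl
    exact (hiso.trans ((Block_iso k hs hn hs' hn' hbb).prod hMM)).trans hiso'.symm

end
end NO

namespace NO
variable {K : Type} [Field K]
section
variable {V V' V'' P P' : Type} [AddCommGroup V] [Module K V] [AddCommGroup V'] [Module K V']
  [AddCommGroup V''] [Module K V'']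
  [AddCommGroup P] [Module K P] [AddCommGroup P'] [Module K P'] {W W' : Type} [AddCommGroup W]
  [Module K W] [AddCommGroup W'] [Module K W']

theorem qrefl (Q : QuadraticForm K V) : QIsom Q Q := ⟨LinearEquiv.refl _ _, fun _ => rfl⟩

theorem qsymm {Q : QuadraticForm K V} {Q' : QuadraticForm K V'} (h : QIsom Q Q') : QIsom Q' Q := by
  obtain ⟨φ, h⟩ := h
  exact ⟨φ.symm, fun x => by rw [← h]; simp⟩

theorem qtrans {Q : QuadraticForm K V} {Q' : QuadraticForm K V'} {Q'' : QuadraticForm K V''}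
    (h : QIsom Q Q') (h' : QIsom Q' Q'') : QIsom Q Q'' := by
  obtain ⟨φ, h⟩ := h
  obtain ⟨ψ, h'⟩ := h'
  exact ⟨φ.trans ψ, fun x => by simp [h, h']⟩

theorem qprod {Q : QuadraticForm K V} {Q' : QuadraticForm K V'} {R : QuadraticForm K P}
    {R' : QuadraticForm K P'} (h : QIsom Q Q') (h' : QIsom R R') :
    QIsom (Q.prod R) (Q'.prod R') := by
  obtain ⟨φ, h⟩ := h
  obtain ⟨ψ, h'⟩ := h'
  exact ⟨φ.prodCongr ψ, fun x => by simp [h, h']⟩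

theorem qassoc (Q : QuadraticForm K V) (Q' : QuadraticForm K V') (Q'' : QuadraticForm K V'') :
    QIsom ((Q.prod Q').prod Q'') (Q.prod (Q'.prod Q'')) :=
  ⟨LinearEquiv.prodAssoc K V V' V'', fun x => by simp [add_assoc]⟩

theorem qcomm (Q : QuadraticForm K V) (Q' : QuadraticForm K V') :
    QIsom (Q.prod Q') (Q'.prod Q) :=
  ⟨LinearEquiv.prodComm K V V', fun x => by simp [add_comm]⟩

/-- Hyperbolic space on a finite index type. -/
noncomputable def Hyp (K : Type) [Field K] (ι : Type) [Fintype ι] : QuadraticForm K (ι → K × K) :=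
  QuadraticMap.pi (fun _ : ι => HypForm K)

theorem Hyp_apply (ι : Type) [Fintype ι] (x : ι → K × K) :
    Hyp K ι x = ∑ i, (x i).1 * (x i).2 := by
  simp [Hyp, HypForm]

theorem HypSum_eq (m : ℕ) : HypSum K m = Hyp K (Fin m) := rfl

/-- Being a sum of hyperbolic planes. -/
def IsHyp (Q : QuadraticForm K V) : Prop := ∃ m, QIsom Q (HypSum K m)

theorem isHyp_Hyp (ι : Type) [Fintype ι] : IsHyp (Hyp K ι) := by
  refine ⟨Fintype.card ι, LinearEquiv.funCongrLeft K (K × K) (Fintype.equivFin ι).symm, fun x => ?_⟩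
  rw [HypSum_eq, Hyp_apply, Hyp_apply]
  exact Equiv.sum_comp (Fintype.equivFin ι).symm (fun i => (x i).1 * (x i).2)

theorem IsHyp.iso {Q : QuadraticForm K V} {Q' : QuadraticForm K V'} (h : IsHyp Q')
    (h' : QIsom Q Q') : IsHyp Q := by
  obtain ⟨m, hm⟩ := h
  exact ⟨m, qtrans h' hm⟩

theorem IsHyp.prod {Q : QuadraticForm K V} {Q' : QuadraticForm K V'} (h : IsHyp Q)
    (h' : IsHyp Q') : IsHyp (Q.prod Q') := by
  obtain ⟨m, hm⟩ := h
  obtain ⟨m', hm'⟩ := h'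
  refine (isHyp_Hyp (K := K) (Fin m ⊕ Fin m')).iso (qtrans (qprod hm hm') (qsymm ?_))
  refine ⟨LinearEquiv.sumArrowLequivProdArrow _ _ K _, fun x => ?_⟩
  simp [HypSum_eq, Hyp_apply]

theorem IsHyp.pi {ι : Type} [Fintype ι] {F : ι → Type}
    [∀ i, AddCommGroup (F i)] [∀ i, Module K (F i)] {Q : ∀ i, QuadraticForm K (F i)}
    (h : ∀ i, IsHyp (Q i)) : IsHyp (QuadraticMap.pi Q) := by
  choose m φ hφ using h
  refine (isHyp_Hyp (K := K) (Σ i, Fin (m i))).iso (qsymm ?_)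
  refine ⟨(LinearEquiv.piCurry K (fun (i : ι) (_ : Fin (m i)) => K × K)) ≪≫ₗ
    LinearEquiv.piCongrRight (fun i => (φ i).symm), fun x => ?_⟩
  rw [Hyp_apply, Fintype.sum_sigma, QuadraticMap.pi_apply]
  refine Finset.sum_congr rfl fun i _ => ?_
  rw [← hφ i, HypSum_eq, Hyp_apply]
  simp [Sigma.curry]

theorem qpi {ι : Type} [Fintype ι] {F G : ι → Type}
    [∀ i, AddCommGroup (F i)] [∀ i, Module K (F i)] [∀ i, AddCommGroup (G i)]
    [∀ i, Module K (G i)] {Q : ∀ i, QuadraticForm K (F i)} {Q' : ∀ i, QuadraticForm K (G i)}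
    (h : ∀ i, QIsom (Q i) (Q' i)) : QIsom (QuadraticMap.pi Q) (QuadraticMap.pi Q') := by
  choose φ hφ using h
  exact ⟨LinearEquiv.piCongrRight φ, fun x => by simp [hφ]⟩

theorem qpi_prod {ι : Type} [Fintype ι] {F G : ι → Type}
    [∀ i, AddCommGroup (F i)] [∀ i, Module K (F i)] [∀ i, AddCommGroup (G i)]
    [∀ i, Module K (G i)] (Q : ∀ i, QuadraticForm K (F i)) (Q' : ∀ i, QuadraticForm K (G i)) :
    QIsom (QuadraticMap.pi fun i => (Q i).prod (Q' i))
      ((QuadraticMap.pi Q).prod (QuadraticMap.pi Q')) := by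
  let e : (∀ i, F i × G i) ≃ₗ[K] (∀ i, F i) × (∀ i, G i) :=
    { toFun := fun x => (fun i => (x i).1, fun i => (x i).2)
      map_add' := fun _ _ => rfl
      map_smul' := fun _ _ => rfl
      invFun := fun y i => (y.1 i, y.2 i)
      left_inv := fun _ => rfl
      right_inv := fun _ => rfl }
  exact ⟨e, fun x => by simp [e, Finset.sum_add_distrib]⟩

/-- `Q` is `A` plus hyperbolic planes. -/
def HypOver (Q : QuadraticForm K V) (A : QuadraticForm K P) : Prop :=
  ∃ m, QIsom Q (A.prod (HypSum K m))

theorem hypOver_of {R : QuadraticForm K V'} {Q : QuadraticForm K V} {A : QuadraticForm K P}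
    (h : QIsom Q (A.prod R)) (hR : IsHyp R) : HypOver Q A := by
  obtain ⟨m, hm⟩ := hR
  exact ⟨m, qtrans h (qprod (qrefl _) hm)⟩

theorem isHyp_HypSum (m : ℕ) : IsHyp (HypSum K m) := ⟨m, qrefl _⟩

theorem HypOver.pi {ι : Type} [Fintype ι] {F G : ι → Type}
    [∀ i, AddCommGroup (F i)] [∀ i, Module K (F i)] [∀ i, AddCommGroup (G i)]
    [∀ i, Module K (G i)] {Q : ∀ i, QuadraticForm K (F i)} {A : ∀ i, QuadraticForm K (G i)}
    (h : ∀ i, HypOver (Q i) (A i)) : HypOver (QuadraticMap.pi Q) (QuadraticMap.pi A) := by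
  choose m hm using h
  exact hypOver_of (qtrans (qpi hm) (qpi_prod _ _)) (IsHyp.pi fun i => isHyp_HypSum (m i))

theorem HypOver.prod_hyp {Q : QuadraticForm K V} {A : QuadraticForm K P} {R : QuadraticForm K V'}
    (h : HypOver Q A) (hR : IsHyp R) : HypOver (Q.prod R) A := by
  obtain ⟨m, hm⟩ := h
  exact hypOver_of (qtrans (qprod hm (qrefl _)) (qassoc _ _ _)) ((isHyp_HypSum m).prod hR)

theorem QIsom.hypOver {Q : QuadraticForm K V} {Q' : QuadraticForm K V'} {A : QuadraticForm K P}
    (h : QIsom Q Q') (h' : HypOver Q' A) : HypOver Q A := by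
  obtain ⟨m, hm⟩ := h'
  exact ⟨m, qtrans h hm⟩

theorem witt_of_hypOver {Q : QuadraticForm K V} {A : QuadraticForm K P} (h : HypOver Q A) :
    WittEquiv A Q := by
  obtain ⟨m, hm⟩ := h
  obtain ⟨m', hm'⟩ := (isHyp_HypSum (K := K) m).prod (isHyp_HypSum 0)
  exact ⟨m', 0, qsymm (qtrans (qprod hm (qrefl _)) (qtrans (qassoc _ _ _) (qprod (qrefl _) hm')))⟩

theorem witt_symm {Q : QuadraticForm K V} {Q' : QuadraticForm K V'} (h : WittEquiv Q Q') :
    WittEquiv Q' Q := by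
  obtain ⟨a, b, h⟩ := h
  exact ⟨b, a, qsymm h⟩

theorem witt_isom {Q : QuadraticForm K V} {Q' : QuadraticForm K V'} {Q'' : QuadraticForm K V''}
    (h : WittEquiv Q Q') (h' : QIsom Q' Q'') : WittEquiv Q Q'' := by
  obtain ⟨a, b, h⟩ := h
  exact ⟨a, b, qtrans h (qprod h' (qrefl _))⟩

theorem HypSum_add (a b : ℕ) : QIsom ((HypSum K a).prod (HypSum K b)) (HypSum K (a + b)) := by
  refine qtrans (Q' := Hyp K (Fin a ⊕ Fin b))
    (qsymm ⟨LinearEquiv.sumArrowLequivProdArrow _ _ K _, fun x => ?_⟩)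
    ⟨LinearEquiv.funCongrLeft K (K × K) finSumFinEquiv.symm, fun x => ?_⟩
  · simp [HypSum_eq, Hyp_apply]
  · rw [HypSum_eq, Hyp_apply, Hyp_apply]
    exact Equiv.sum_comp finSumFinEquiv.symm (fun i => (x i).1 * (x i).2)

theorem witt_trans {Q : QuadraticForm K V} {Q' : QuadraticForm K V'} {Q'' : QuadraticForm K V''}
    (h : WittEquiv Q Q') (h' : WittEquiv Q' Q'') : WittEquiv Q Q'' := by
  obtain ⟨a, b, h⟩ := h
  obtain ⟨c, d, h'⟩ := h'
  refine ⟨a + c, d + b, ?_⟩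
  have e1 : QIsom (Q.prod (HypSum K (a + c))) ((Q.prod (HypSum K a)).prod (HypSum K c)) :=
    qtrans (qprod (qrefl _) (qsymm (HypSum_add _ _))) (qsymm (qassoc _ _ _))
  have e2 : QIsom ((Q'.prod (HypSum K b)).prod (HypSum K c))
      ((Q'.prod (HypSum K c)).prod (HypSum K b)) :=
    qtrans (qassoc _ _ _) (qtrans (qprod (qrefl _) (qcomm _ _)) (qsymm (qassoc _ _ _)))
  have e3 : QIsom ((Q''.prod (HypSum K d)).prod (HypSum K b)) (Q''.prod (HypSum K (d + b))) :=
    qtrans (qassoc _ _ _) (qprod (qrefl _) (HypSum_add _ _))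
  exact qtrans e1 (qtrans (qprod h (qrefl _)) (qtrans e2 (qtrans (qprod h' (qrefl _)) e3)))

/-- Witt's theorem for vectors. -/
theorem exists_move (h2 : (2 : K) ≠ 0) (Q : QuadraticForm K V) (x y : V) (hxy : Q x = Q y)
    (hx : Q x ≠ 0) : ∃ g : V ≃ₗ[K] V, (∀ v, Q (g v) = Q v) ∧ g x = y := by
  have hQadd : ∀ v w, Q (v + w) = Q v + Q w + QuadraticMap.polar Q v w := fun v w => by
    simp [QuadraticMap.polar]
  have refl : ∀ z, Q z ≠ 0 → ∃ g : V ≃ₗ[K] V, (∀ v, Q (g v) = Q v) ∧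
      ∀ v, g v = v - (QuadraticMap.polar Q z v / Q z) • z := by
    intro z hz
    let f : Module.Dual K V := (Q z)⁻¹ • (Q.polarBilin z)
    have hf : f z = 2 := by
      simp [f, QuadraticMap.polar_self]; field_simp
    have hfv : ∀ v, f v = QuadraticMap.polar Q z v / Q z := fun v => by
      simp [f]; field_simp
    refine ⟨Module.reflection hf, fun v => ?_, fun v => by rw [Module.reflection_apply, hfv]⟩
    rw [Module.reflection_apply, hfv, sub_eq_add_neg, hQadd, ← neg_smul, QuadraticMap.map_smul,
      QuadraticMap.polar_smul_right, QuadraticMap.polar_comm Q v z]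
    simp only [smul_eq_mul]
    field_simp
    ring
  have hp : QuadraticMap.polar Q x x = 2 * Q x := by
    rw [QuadraticMap.polar_self]; simp
  by_cases h : Q (x - y) = 0
  · have h1 : Q (x - y) = Q x + Q y - QuadraticMap.polar Q x y := by
      rw [sub_eq_add_neg, hQadd, QuadraticMap.map_neg, QuadraticMap.polar_neg_right]; ring
    have h3 : Q (x + y) = Q x + Q y + QuadraticMap.polar Q x y := hQadd x y
    have h4 : Q (x + y) = 2 * 2 * Q x := by linear_combination h3 + h1 - h - 2 * hxy
    have h5 : Q (x + y) ≠ 0 := by rw [h4]; exact mul_ne_zero (mul_ne_zero h2 h2) hx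
    obtain ⟨g, hg, hg'⟩ := refl (x + y) h5
    refine ⟨g.trans (LinearEquiv.neg K), fun v => by simp [hg], ?_⟩
    have h6 : QuadraticMap.polar Q (x + y) x = Q (x + y) := by
      rw [QuadraticMap.polar_add_left, hp, QuadraticMap.polar_comm Q y x]
      linear_combination -h3 + hxy
    simp only [LinearEquiv.trans_apply, LinearEquiv.neg_apply]
    rw [hg', h6, div_self h5, one_smul]; abel
  · obtain ⟨g, hg, hg'⟩ := refl (x - y) h
    refine ⟨g, hg, ?_⟩
    have h1 : Q (x - y) = Q x + Q y - QuadraticMap.polar Q x y := by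
      rw [sub_eq_add_neg, hQadd, QuadraticMap.map_neg, QuadraticMap.polar_neg_right]; ring
    have h6 : QuadraticMap.polar Q (x - y) x = Q (x - y) := by
      rw [QuadraticMap.polar_sub_left, hp, QuadraticMap.polar_comm Q y x]
      linear_combination -h1 + hxy
    rw [hg', h6, div_self h, one_smul]; abel

/-- The one-dimensional form `⟨c⟩`. -/
noncomputable def line (c : K) : QuadraticForm K K := c • QuadraticMap.sq

theorem line_apply (c x : K) : line c x = c * (x * x) := by simp [line]

theorem cancel_half (c : K) (h2 : (2 : K) ≠ 0) (hc : c ≠ 0) (Q : QuadraticForm K V)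
    (Q' : QuadraticForm K V') (φ : (V × K) ≃ₗ[K] (V' × K))
    (hφ : ∀ x, (Q'.prod (line c)) (φ x) = (Q.prod (line c)) x) (h1 : φ (0, 1) = (0, 1)) (v : V) :
    (φ (v, 0)).2 = 0 ∧ Q' (φ (v, 0)).1 = Q v := by
  have e1 := hφ (v, 0)
  have e2 := hφ (v, 1)
  have e3 : φ (v, 1) = φ (v, 0) + (0, 1) := by rw [← h1, ← map_add]; simp
  rw [e3] at e2
  simp only [QuadraticMap.prod_apply, line_apply, Prod.fst_add, Prod.snd_add, add_zero] at e1 e2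
  have e4 : 2 * c * (φ (v, 0)).2 = 0 := by linear_combination e2 - e1
  have e5 : (φ (v, 0)).2 = 0 := (mul_eq_zero.1 e4).resolve_left (mul_ne_zero h2 hc)
  refine ⟨e5, ?_⟩
  rw [e5] at e1
  simpa using e1

theorem cancel_line (c : K) (h2 : (2 : K) ≠ 0) (hc : c ≠ 0) {Q : QuadraticForm K V}
    {Q' : QuadraticForm K V'} (h : QIsom (Q.prod (line c)) (Q'.prod (line c))) : QIsom Q Q' := by
  obtain ⟨φ, hφ⟩ := h
  have hval : (Q'.prod (line c)) ((0, 1) : V' × K) = c := by simp [line_apply]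
  have hval' : (Q'.prod (line c)) (φ (0, 1)) = c := by rw [hφ]; simp [line_apply]
  obtain ⟨g, hg, hg1⟩ := exists_move h2 (Q'.prod (line c)) (φ (0, 1)) (0, 1)
    (by rw [hval, hval']) (by rw [hval']; exact hc)
  let ψ : (V × K) ≃ₗ[K] (V' × K) := φ.trans g
  have hψ : ∀ x, (Q'.prod (line c)) (ψ x) = (Q.prod (line c)) x := fun x => by
    simp only [ψ, LinearEquiv.trans_apply]; rw [hg, hφ]
  have hψ1 : ψ (0, 1) = (0, 1) := hg1
  have hψ' : ∀ x, (Q.prod (line c)) (ψ.symm x) = (Q'.prod (line c)) x := fun x => by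
    rw [← hψ]; simp
  have hψ1' : ψ.symm (0, 1) = (0, 1) := by rw [← hψ1]; simp
  have k1 := cancel_half c h2 hc Q Q' ψ hψ hψ1
  have k2 := cancel_half c h2 hc Q' Q ψ.symm hψ' hψ1'
  let e : V ≃ₗ[K] V' :=
    { toFun := fun v => (ψ (v, 0)).1
      map_add' := fun a b => by
        have : ((a + b, 0) : V × K) = (a, 0) + (b, 0) := by simp
        rw [this, map_add]; rfl
      map_smul' := fun r a => by
        have : ((r • a, 0) : V × K) = r • (a, 0) := by simp
        rw [this, map_smul]; rfl
      invFun := fun v => (ψ.symm (v, 0)).1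
      left_inv := fun v => by
        have : (((ψ (v, 0)).1, 0) : V' × K) = ψ (v, 0) := by ext <;> simp [(k1 v).1]
        simp only
        rw [this]; simp
      right_inv := fun v => by
        have : (((ψ.symm (v, 0)).1, 0) : V × K) = ψ.symm (v, 0) := by ext <;> simp [(k2 v).1]
        simp only
        rw [this]; simp }
  exact ⟨e, fun v => (k1 v).2⟩

theorem HypForm_iso (h2 : (2 : K) ≠ 0) : QIsom (HypForm K) ((line (1 : K)).prod (line (-1))) := by
  refine qsymm ⟨{ toFun := fun x => (x.1 + x.2, x.1 - x.2)
                  map_add' := fun a b => by ext <;> simp <;> ring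
                  map_smul' := fun a b => by ext <;> simp <;> ring
                  invFun := fun y => ((y.1 + y.2) / 2, (y.1 - y.2) / 2)
                  left_inv := fun x => by ext <;> simp <;> field_simp <;> ring
                  right_inv := fun x => by ext <;> simp <;> field_simp <;> ring }, fun x => ?_⟩
  simp [HypForm, line_apply]
  ring

theorem cancel_HypForm (h2 : (2 : K) ≠ 0) {Q : QuadraticForm K V}
    {Q' : QuadraticForm K V'} (h : QIsom (Q.prod (HypForm K)) (Q'.prod (HypForm K))) :
    QIsom Q Q' := by
  have e : ∀ {V : Type} [AddCommGroup V] [Module K V] (Q : QuadraticForm K V),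
      QIsom (Q.prod (HypForm K)) ((Q.prod (line (1 : K))).prod (line (-1))) := fun Q =>
    qtrans (qprod (qrefl _) (HypForm_iso h2)) (qsymm (qassoc _ _ _))
  exact cancel_line 1 h2 one_ne_zero (cancel_line (-1) h2 (by simp)
    (qtrans (qsymm (e Q)) (qtrans h (e Q'))))

theorem HypSum_one : QIsom (HypSum K 1) (HypForm K) := by
  refine ⟨LinearEquiv.funUnique (Fin 1) K (K × K), fun x => ?_⟩
  simp [HypSum_eq, Hyp_apply, HypForm]

theorem cancel_HypSum (h2 : (2 : K) ≠ 0) (a : ℕ) {Q : QuadraticForm K V}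
    {Q' : QuadraticForm K V'} (h : QIsom (Q.prod (HypSum K a)) (Q'.prod (HypSum K a))) :
    QIsom Q Q' := by
  induction a with
  | zero =>
    have e : ∀ {V : Type} [AddCommGroup V] [Module K V] (Q : QuadraticForm K V),
        QIsom (Q.prod (HypSum K 0)) Q := fun Q =>
      ⟨LinearEquiv.prodUnique, fun x => by simp [HypSum_eq, Hyp_apply]⟩
    exact qtrans (qsymm (e Q)) (qtrans h (e Q'))
  | succ a ih =>
    have e : ∀ {V : Type} [AddCommGroup V] [Module K V] (Q : QuadraticForm K V),
        QIsom (Q.prod (HypSum K (a + 1))) ((Q.prod (HypSum K a)).prod (HypForm K)) := fun Q =>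
      qtrans (qprod (qrefl _) (qtrans (qsymm (HypSum_add a 1)) (qprod (qrefl _) HypSum_one)))
        (qsymm (qassoc _ _ _))
    exact ih (cancel_HypForm h2 (qtrans (qsymm (e Q)) (qtrans h (e Q'))))

theorem witt_cancel (h2 : (2 : K) ≠ 0) [FiniteDimensional K V] [FiniteDimensional K V']
    {Q : QuadraticForm K V} {Q' : QuadraticForm K V'} (h : WittEquiv Q Q')
    (hd : Module.finrank K V = Module.finrank K V') : QIsom Q Q' := by
  obtain ⟨a, b, h⟩ := h
  have hab : a = b := by
    obtain ⟨φ, -⟩ := h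
    have := φ.finrank_eq
    rw [Module.finrank_prod, Module.finrank_prod, Module.finrank_pi_fintype,
      Module.finrank_pi_fintype] at this
    simp at this
    omega
  subst hab
  exact cancel_HypSum h2 a h

end
end NO

namespace NO
variable {K : Type} [Field K]
section
variable {V V' V'' P P' : Type} [AddCommGroup V] [Module K V] [AddCommGroup V'] [Module K V']
  [AddCommGroup V''] [Module K V'']
  [AddCommGroup P] [Module K P] [AddCommGroup P'] [Module K P'] {W W' : Type} [AddCommGroup W]
  [Module K W] [AddCommGroup W'] [Module K W']

noncomputable def qf (B : V →ₗ[K] V →ₗ[K] K) : QuadraticForm K V :=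
  (1 / 2 : K) • LinearMap.BilinMap.toQuadraticMap B

theorem qf_apply (B : V →ₗ[K] V →ₗ[K] K) (v : V) : qf B v = 1 / 2 * B v v := by
  simp [qf]

theorem qf_polar (h2 : (2 : K) ≠ 0) (B : V →ₗ[K] V →ₗ[K] K) (hB : ∀ v w, B w v = B v w) (v w : V) :
    QuadraticMap.polar (qf B) v w = B v w := by
  simp only [QuadraticMap.polar, qf_apply, map_add, LinearMap.add_apply, hB v w]
  field_simp
  ring

/-- The form `(x, y) ↦ b x y`. -/
noncomputable def pairForm (b : W →ₗ[K] W →ₗ[K] K) : QuadraticForm K (W × W) :=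
  LinearMap.BilinMap.toQuadraticMap
    (b.compl₁₂ (LinearMap.fst K W W) (LinearMap.snd K W W))

theorem pairForm_apply (b : W →ₗ[K] W →ₗ[K] K) (x : W × W) : pairForm b x = b x.1 x.2 := by
  simp [pairForm]

theorem pairForm_hyp [FiniteDimensional K W] (b : W →ₗ[K] W →ₗ[K] K)
    (hn : ∀ v, (∀ w, b w v = 0) → v = 0) : IsHyp (pairForm b) := by
  let e := Module.finBasis K W
  let f : (W × W) →ₗ[K] (Fin (Module.finrank K W) → K × K) :=
    LinearMap.pi fun i => LinearMap.prod (e.coord i ∘ₗ LinearMap.fst K W W)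
      (b (e i) ∘ₗ LinearMap.snd K W W)
  have hf : ∀ x i, f x i = (e.repr x.1 i, b (e i) x.2) := fun x i => rfl
  have hb : ∀ x y, b x y = ∑ i, e.repr x i * b (e i) y := fun x y => by
    conv_lhs => rw [← e.sum_repr x, map_sum, LinearMap.sum_apply]
    simp only [map_smul, LinearMap.smul_apply, smul_eq_mul]
  have hinj : Function.Injective f := by
    rw [← LinearMap.ker_eq_bot, LinearMap.ker_eq_bot']
    intro x hx
    have h1 : ∀ i, e.repr x.1 i = 0 ∧ b (e i) x.2 = 0 := fun i => by
      have := congrFun hx i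
      rw [hf] at this
      simpa [Prod.ext_iff] using this
    ext
    · change x.1 = 0
      apply e.repr.injective
      ext i; simpa using (h1 i).1
    · refine hn _ fun w => ?_
      rw [hb]
      simp [(h1 _).2]
  have hd : Module.finrank K (W × W) = Module.finrank K (Fin (Module.finrank K W) → K × K) := by
    simp [Module.finrank_pi_fintype, mul_two]
  refine ⟨_, LinearEquiv.ofInjectiveOfFinrankEq f hinj hd, fun x => ?_⟩
  rw [HypSum_eq, Hyp_apply, pairForm_apply]
  change ∑ i, (f x i).1 * (f x i).2 = _
  simp only [hf]
  exact (hb _ _).symm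

/-- Splitting the two outer coordinates. -/
def outer (K : Type) [Field K] (W : Type) [AddCommGroup W] [Module K W] (k : ℕ) :
    (Fin (k + 2 + 1) → W) ≃ₗ[K] (W × W) × (Fin (k + 1) → W) where
  toFun u := ((u 0, u (Fin.last (k + 2))), fun i => u i.castSucc.succ)
  map_add' u v := rfl
  map_smul' c u := rfl
  invFun x := Fin.cons (α := fun _ => W) x.1.1 (Fin.snoc (α := fun _ => W) x.2 x.1.2)
  left_inv u := by
    ext i
    refine Fin.cases ?_ (fun i => ?_) i
    · simp
    · refine Fin.lastCases ?_ (fun i => ?_) i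
      · simp
      · simp
  right_inv x := by
    refine Prod.ext (Prod.ext ?_ ?_) ?_
    · simp
    · change (Fin.cons (α := fun _ => W) x.1.1 (Fin.snoc (α := fun _ => W) x.2 x.1.2) :
        Fin (k + 2 + 1) → W) (Fin.last (k + 1)).succ = x.1.2
      rw [Fin.cons_succ]
      exact Fin.snoc_last (α := fun _ => W) _ _
    · ext i; simp

theorem Block_step (h2 : (2 : K) ≠ 0) (k : ℕ) (b : W →ₗ[K] W →ₗ[K] K) (hs hn hs' hn') :
    QIsom (qf (Block (k + 2) b hs hn).B) ((pairForm b).prod (qf (Block k (-b) hs' hn').B)) := by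
  refine ⟨outer K W k, fun u => ?_⟩
  have e : ∀ i : Fin (k + 1), (i.castSucc.succ : Fin (k + 2 + 1)).rev = i.rev.castSucc.succ := by
    intro i; ext; simp [Fin.val_rev]; omega
  simp only [QuadraticMap.prod_apply, pairForm_apply, qf_apply, Block_B]
  rw [Fin.sum_univ_succ (n := k + 2), Fin.sum_univ_castSucc (n := k + 1)]
  have e3 : ((-1 : K)) ^ (k + 2) * (-1) ^ (k + 2) = 1 := by
    rw [← mul_pow]; simp
  have e4 := hs (u 0) (u (Fin.last (k + 2)))
  simp only [e, outer, LinearEquiv.coe_mk, LinearMap.coe_mk, AddHom.coe_mk, LinearMap.neg_apply]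
  have e5 : (Fin.last (k + 1)).succ = Fin.last (k + 2) := rfl
  rw [e5, Fin.rev_last, Fin.rev_zero, e4]
  have e6 : ∀ c : K, (-1 : K) ^ ((Fin.last (k + 2) : Fin (k + 2 + 1)) : ℕ) * ((-1) ^ (k + 2) * c) = c := by
    intro c; rw [Fin.val_last, ← mul_assoc, e3, one_mul]
  rw [e6]
  simp only [Fin.val_succ, Fin.val_castSucc, pow_succ, Fin.val_zero, pow_zero, mul_neg, neg_mul,
    mul_one, one_mul]
  field_simp
  ring

theorem neg_nd {b : W →ₗ[K] W →ₗ[K] K} (hn : ∀ v, (∀ w, b v w = 0) → v = 0) :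
    ∀ v, (∀ w, (-b) v w = 0) → v = 0 := fun v h => hn v fun w => by simpa using h w

theorem neg_sym {b : W →ₗ[K] W →ₗ[K] K} {k : ℕ} (hs : ∀ v w, b w v = (-1) ^ (k + 2) * b v w) :
    ∀ v w, (-b) w v = (-1) ^ k * (-b) v w := fun v w => by
  simp [hs v w, pow_add]

theorem nd_flip {b : W →ₗ[K] W →ₗ[K] K} {k : ℕ} (hs : ∀ v w, b w v = (-1) ^ k * b v w)
    (hn : ∀ v, (∀ w, b v w = 0) → v = 0) : ∀ v, (∀ w, b w v = 0) → v = 0 :=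
  fun v h => hn v fun w => by rw [hs w v, h w, mul_zero]

theorem Block_odd (h2 : (2 : K) ≠ 0) [FiniteDimensional K W] (k : ℕ) :
    ∀ (b : W →ₗ[K] W →ₗ[K] K) (hs hn), IsHyp (qf (Block (2 * k + 1) b hs hn).B) := by
  induction k with
  | zero =>
    intro b hs hn
    refine (pairForm_hyp b (nd_flip hs hn)).iso ⟨LinearEquiv.finTwoArrow K W, fun u => ?_⟩
    rw [pairForm_apply, qf_apply, Block_B]
    have := hs (u 0) (u 1)
    simp [Fin.sum_univ_two] at this ⊢
    rw [this]
    field_simp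
    ring
  | succ k ih =>
    intro b hs hn
    exact ((pairForm_hyp b (nd_flip hs hn)).prod
      (ih (-b) (neg_sym hs) (neg_nd hn))).iso (Block_step h2 (2 * k + 1) b hs hn _ _)

theorem Block_even (h2 : (2 : K) ≠ 0) [FiniteDimensional K W] (k : ℕ) :
    ∀ (b : W →ₗ[K] W →ₗ[K] K) (hs hn),
      HypOver (qf (Block (2 * k) b hs hn).B) (qf ((-1 : K) ^ k • b)) := by
  induction k with
  | zero =>
    intro b hs hn
    refine ⟨0, qtrans (Q' := qf b) ⟨LinearEquiv.funUnique (Fin 1) K W, fun u => ?_⟩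
      ⟨(LinearEquiv.prodUnique (R := K) (M := W) (M₂ := Fin 0 → K × K)).symm, fun x => ?_⟩⟩
    · rw [qf_apply, qf_apply, Block_B]
      simp
    · simp [qf_apply, HypSum_eq, Hyp_apply]
  | succ k ih =>
    intro b hs hn
    have := ih (-b) (neg_sym hs) (neg_nd hn)
    refine QIsom.hypOver (qtrans (Block_step h2 (2 * k) b hs hn (neg_sym hs) (neg_nd hn))
      (qcomm _ _)) ?_
    have e : (-1 : K) ^ (k + 1) • b = (-1 : K) ^ k • (-b) := by
      refine LinearMap.ext fun v => LinearMap.ext fun w => ?_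
      simp [pow_succ]
    rw [e]
    exact this.prod_hyp (pairForm_hyp b (nd_flip hs hn))

/-- Multisets of positive numbers are determined by the truncated sums. -/
theorem multiset_eq {s t : Multiset ℕ} (hs : ∀ x ∈ s, 0 < x) (ht : ∀ x ∈ t, 0 < x)
    (h : ∀ i, (s.map (fun part => min i part)).sum = (t.map (fun part => min i part)).sum) :
    s = t := by
  have key : ∀ (s : Multiset ℕ) i, (s.map (fun part => min (i + 1) part)).sum =
      (s.map (fun part => min i part)).sum + s.countP (fun x => i < x) := by
    intro s i
    induction s using Multiset.induction_on with
    | empty => simp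
    | cons a s ih =>
      rw [Multiset.map_cons, Multiset.sum_cons, Multiset.map_cons, Multiset.sum_cons, ih,
        Multiset.countP_cons]
      split_ifs <;> omega
  have hc : ∀ i, s.countP (fun x => i < x) = t.countP (fun x => i < x) := fun i => by
    have h1 := key s i
    have h3 := key t i
    rw [h, h] at h1
    omega
  have key2 : ∀ (s : Multiset ℕ) j, s.count (j + 1) + s.countP (fun x => j + 1 < x) =
      s.countP (fun x => j < x) := by
    intro s j
    induction s using Multiset.induction_on with
    | empty => simp
    | cons a s ih =>
      rw [Multiset.count_cons, Multiset.countP_cons, Multiset.countP_cons]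
      split_ifs <;> omega
  ext j
  rcases j with _ | j
  · rw [Multiset.count_eq_zero_of_notMem (fun h0 => lt_irrefl _ (hs 0 h0)),
      Multiset.count_eq_zero_of_notMem (fun h0 => lt_irrefl _ (ht 0 h0))]
  · have h1 := key2 s j
    have h3 := key2 t j
    rw [hc, hc] at h1
    omega
end
end NO

namespace NO
variable {K : Type} [Field K]
section

/-- The sign attached to a block of odd size. -/
def eps (K : Type) [Field K] (j : ℕ) : K := (-1) ^ ((j - 1) / 2)

theorem eps_mul (j : ℕ) : eps K j * eps K j = 1 := by
  rw [eps, ← mul_pow]; simp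

theorem eps_ne (j : ℕ) : eps K j ≠ 0 := fun h => by
  have := eps_mul (K := K) j
  simp [h] at this

variable {V V' W W' : Type} [AddCommGroup V] [Module K V] [AddCommGroup V'] [Module K V']
  [AddCommGroup W] [Module K W] [AddCommGroup W'] [Module K W']

theorem smul_nd {b : W →ₗ[K] W →ₗ[K] K} {c : K} (hc : c ≠ 0)
    (hn : ∀ v, (∀ w, b v w = 0) → v = 0) : ∀ v, (∀ w, (c • b) v w = 0) → v = 0 :=
  fun v h => hn v fun w => by simpa [hc] using h w

theorem Block_even' (h2 : (2 : K) ≠ 0) [FiniteDimensional K W] (k : ℕ) (hk : Even k)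
    (b : W →ₗ[K] W →ₗ[K] K) (hs hn) :
      HypOver (qf (Block k b hs hn).B) (qf ((-1 : K) ^ (k / 2) • b)) := by
  obtain ⟨m, rfl⟩ := even_iff_exists_two_mul.1 hk
  have := Block_even h2 m b hs hn
  rwa [Nat.mul_div_cancel_left _ (by norm_num)]

theorem Block_odd' (h2 : (2 : K) ≠ 0) [FiniteDimensional K W] (k : ℕ) (hk : Odd k)
    (b : W →ₗ[K] W →ₗ[K] K) (hs hn) : IsHyp (qf (Block k b hs hn).B) := by
  obtain ⟨m, rfl⟩ := hk
  exact Block_odd h2 m b hs hn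

theorem qf_prod {ε : K} (N : Nil ε V) (M : Nil ε V') :
    qf (N.prod M).B = (qf N.B).prod (qf M.B) := by
  ext x
  simp [qf_apply, mul_add]

theorem qf_pi {ε : K} {ι : Type} [Fintype ι] [DecidableEq ι] {F : ι → Type}
    [∀ i, AddCommGroup (F i)] [∀ i, Module K (F i)] (N : ∀ i, Nil ε (F i)) :
    qf (Nil.pi N).B = QuadraticMap.pi (fun i => qf (N i).B) := by
  ext x
  simp [qf_apply, Nil.pi_B, Finset.mul_sum]

theorem qf_polar_self (h2 : (2 : K) ≠ 0) (Q : QuadraticForm K V) : qf Q.polarBilin = Q := by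
  ext x
  rw [qf_apply, QuadraticMap.polarBilin_apply_apply, QuadraticMap.polar_self]
  simp only [nsmul_eq_mul, Nat.cast_ofNat]
  field_simp

theorem polar_comm (Q : QuadraticForm K V) (v w : V) :
    Q.polarBilin w v = Q.polarBilin v w := by
  simp [QuadraticMap.polar_comm]

theorem red_zero_of_pos {ε : K} {N : Nil ε V} {j k : ℕ} {b : W →ₗ[K] W →ₗ[K] K} (h : Red N k b)
    (e : k = j) : Red N j b := e ▸ h

theorem model (h2 : (2 : K) ≠ 0) (lam : Multiset ℕ) (hpos : ∀ x ∈ lam, 0 < x)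
    (hev : ∀ j, Even j → Even (lam.count j))
    (Qt : ∀ j : {j : ℕ // j ∈ lam.toFinset.filter (fun j : ℕ => Odd j)}, QF K (lam.count j.1))
    (hQt : ∀ j, QNondeg (Qt j)) :
    ∃ (V : Type) (_ : AddCommGroup V) (_ : Module K V) (_ : FiniteDimensional K V)
      (N : Nil (1 : K) V), JT N lam ∧ N.X ^ lam.sum = 0 ∧
      (∀ j, Red N j.1 (eps K j.1 • (Qt j).polarBilin)) ∧
      WittEquiv (QuadraticMap.pi fun j => Qt j) (qf N.B) := by
  have ho : ∀ j : {j : ℕ // j ∈ lam.toFinset.filter (fun j : ℕ => Odd j)},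
      j.1 ∈ lam ∧ Odd j.1 := fun j => by
    have := j.2
    rwa [Finset.mem_filter, Multiset.mem_toFinset] at this
  have he : ∀ j : {j : ℕ // j ∈ lam.toFinset.filter (fun j : ℕ => ¬ Odd j)},
      j.1 ∈ lam ∧ Even j.1 := fun j => by
    have := j.2
    rwa [Finset.mem_filter, Multiset.mem_toFinset, Nat.not_odd_iff_even] at this
  have hop : ∀ j : {j : ℕ // j ∈ lam.toFinset.filter (fun j : ℕ => Odd j)},
      j.1 - 1 + 1 = j.1 := fun j => Nat.sub_add_cancel (hpos _ (ho j).1)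
  have hep : ∀ j : {j : ℕ // j ∈ lam.toFinset.filter (fun j : ℕ => ¬ Odd j)},
      j.1 - 1 + 1 = j.1 := fun j => Nat.sub_add_cancel (hpos _ (he j).1)
  have hok : ∀ j : {j : ℕ // j ∈ lam.toFinset.filter (fun j : ℕ => Odd j)},
      Even (j.1 - 1) := fun j => Nat.Odd.sub_odd (ho j).2 odd_one
  have hek : ∀ j : {j : ℕ // j ∈ lam.toFinset.filter (fun j : ℕ => ¬ Odd j)},
      Odd (j.1 - 1) := fun j => Nat.Even.sub_odd (hpos _ (he j).1) (he j).2 odd_one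
  let NO := fun j : {j : ℕ // j ∈ lam.toFinset.filter (fun j : ℕ => Odd j)} =>
    Block (j.1 - 1) (eps K j.1 • (Qt j).polarBilin)
      (fun v w => by
        rw [(hok j).neg_one_pow, one_mul, LinearMap.smul_apply, LinearMap.smul_apply,
          LinearMap.smul_apply, LinearMap.smul_apply, polar_comm])
      (smul_nd (eps_ne _) (hQt j))
  let NE := fun j : {j : ℕ // j ∈ lam.toFinset.filter (fun j : ℕ => ¬ Odd j)} =>
    Block (j.1 - 1) (Std K (lam.count j.1 / 2)).B
      (fun v w => by rw [(hek j).neg_one_pow, (Std K _).symm v w])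
      (Std K (lam.count j.1 / 2)).nd
  refine ⟨_, inferInstance, inferInstance, inferInstance, (Nil.pi NO).prod (Nil.pi NE), ?_, ?_, ?_, ?_⟩
  · intro i
    rw [finrank_ker_prod, finrank_ker_pi, finrank_ker_pi, Finset.sum_multiset_map_count,
      ← Finset.sum_filter_add_sum_filter_not lam.toFinset (fun j : ℕ => Odd j)]
    congr 1
    · refine Eq.trans ?_ (Finset.sum_coe_sort _ _)
      refine Finset.sum_congr rfl fun j _ => ?_
      refine (finrank_ker_shift (j.1 - 1) i).trans ?_
      rw [hop j]
      simp [mul_comm]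
    · refine Eq.trans ?_ (Finset.sum_coe_sort _ _)
      refine Finset.sum_congr rfl fun j _ => ?_
      refine (finrank_ker_shift (j.1 - 1) i).trans ?_
      rw [hep j]
      have : 2 * (lam.count j.1 / 2) = lam.count j.1 := Nat.two_mul_div_two_of_even (hev _ (he j).2)
      rw [Module.finrank_pi_fintype]
      simp only [Module.finrank_prod, Module.finrank_self, Finset.sum_const, Finset.card_univ,
        Fintype.card_fin, smul_eq_mul]
      conv_rhs => rw [← this]
      ring
  · refine LinearMap.ext fun v => ?_
    rw [Nil.prod_pow]
    refine Prod.ext (funext fun j => ?_) (funext fun j => ?_)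
    · refine (Nil.pi_pow NO _ _ _).trans ?_
      simp only [NO, Block_X]
      have h1 := Multiset.le_sum_of_mem (ho j).1
      have h3 := hop j
      rw [shift_pow_top _ _ (by omega)]; rfl
    · refine (Nil.pi_pow NE _ _ _).trans ?_
      simp only [NE, Block_X]
      have h1 := Multiset.le_sum_of_mem (he j).1
      have h3 := hep j
      rw [shift_pow_top _ _ (by omega)]; rfl
  · intro j
    refine Red.prod_left (Red.pi j (red_zero_of_pos (Block_red _ _ _ _) (hop j)) fun j' hj' => ?_)
      (Zero.pi fun j' => ?_)
    · refine Block_zero _ _ _ _ _ ?_ (hpos _ (ho j).1)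
      rw [hop]
      exact fun h => hj' (Subtype.ext h.symm)
    · refine Block_zero _ _ _ _ _ ?_ (hpos _ (ho j).1)
      rw [hep]
      intro h
      have h1 := (ho j).2
      rw [h] at h1
      exact (Nat.not_odd_iff_even.2 (he j').2) h1
  · apply witt_of_hypOver
    rw [qf_prod, qf_pi, qf_pi]
    refine HypOver.prod_hyp (HypOver.pi fun j => ?_) (IsHyp.pi fun j => ?_)
    · have := Block_even' h2 (j.1 - 1) (hok j) (eps K j.1 • (Qt j).polarBilin)
        (fun v w => by
          rw [(hok j).neg_one_pow, one_mul, LinearMap.smul_apply, LinearMap.smul_apply,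
            LinearMap.smul_apply, LinearMap.smul_apply, polar_comm])
        (smul_nd (eps_ne _) (hQt j))
      have e : (-1 : K) ^ ((j.1 - 1) / 2) • (eps K j.1 • (Qt j).polarBilin) =
          (Qt j).polarBilin := by
        rw [smul_smul]
        have := eps_mul (K := K) j.1
        unfold eps at this ⊢
        rw [this, one_smul]
      rw [e, qf_polar_self h2] at this
      exact this
    · exact Block_odd' h2 _ (hek j) _ _ _
end
end NO

namespace NO
variable {K : Type} [Field K]
section
variable {V V' W W' : Type} [AddCommGroup V] [Module K V] [AddCommGroup V'] [Module K V']
  [AddCommGroup W] [Module K W] [AddCommGroup W'] [Module K W']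

theorem JT.unique {N : Nil (1 : K) V} {s t : Multiset ℕ} (hs : ∀ x ∈ s, 0 < x)
    (ht : ∀ x ∈ t, 0 < x) (h : JT N s) (h' : JT N t) : s = t :=
  multiset_eq hs ht fun i => by rw [← h i, ← h' i]

theorem red_none (h2 : (2 : K) ≠ 0) [FiniteDimensional K V] {N : Nil (1 : K) V} {k : ℕ}
    (hX : N.X ^ k = 0) {s : Multiset ℕ} (hs : ∀ x ∈ s, 0 < x) (h : JT N s) {j : ℕ} (hj : Odd j)
    (hjs : j ∉ s) : Red N j (0 : (Fin 0 → K) →ₗ[K] (Fin 0 → K) →ₗ[K] K) := by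
  obtain ⟨t, h1, h3, -, h4⟩ := exist h2 k V N hX
  obtain rfl := JT.unique hs (fun x hx => (h1 x hx).1) h h3
  obtain ⟨b, -, -, hb⟩ := h4 j hj
  have h0 := Multiset.count_eq_zero_of_notMem hjs
  have hss : ∀ x y : Fin (Multiset.count j s) → K, x = y := by
    rw [h0]; exact fun x y => Subsingleton.elim _ _
  refine hb.biso_right ⟨⟨0, 0, fun x => hss _ _, fun x => Subsingleton.elim _ _⟩, fun v w => ?_⟩
  rw [hss v 0]; simp

theorem iso_of (h2 : (2 : K) ≠ 0) [FiniteDimensional K V] [FiniteDimensional K V']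
    {N : Nil (1 : K) V} {N' : Nil (1 : K) V'} {k k' : ℕ}
    (hX : N.X ^ k = 0) (hX' : N'.X ^ k' = 0) {s : Multiset ℕ} (hs : ∀ x ∈ s, 0 < x)
    (h : JT N s) (h' : JT N' s)
    (Qt : ∀ j : {j : ℕ // j ∈ s.toFinset.filter (fun j : ℕ => Odd j)}, QF K (s.count j.1))
    (hQt : ∀ j, QNondeg (Qt j))
    (hr : ∀ j, Red N j.1 (eps K j.1 • (Qt j).polarBilin))
    (hr' : ∀ j, Red N' j.1 (eps K j.1 • (Qt j).polarBilin)) : Iso N N' := by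
  refine uniq h2 (k + k') V V' N N' (by rw [pow_add, hX, zero_mul])
    (by rw [pow_add, hX', mul_zero]) (fun i => by rw [h i, h' i]) fun j hj => ?_
  by_cases hjs : j ∈ s
  · let j' : {j : ℕ // j ∈ s.toFinset.filter (fun j : ℕ => Odd j)} :=
      ⟨j, by simp [hjs, hj]⟩
    exact ⟨_, eps K j • (Qt j').polarBilin, smul_nd (eps_ne j) (hQt j'), hr j', hr' j'⟩
  · exact ⟨0, 0, fun v _ => Subsingleton.elim _ _, red_none h2 hX hs h hj hjs,
      red_none h2 hX' hs h' hj hjs⟩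

theorem red_eps {N : Nil (1 : K) V} {j k : ℕ} {b : W →ₗ[K] W →ₗ[K] K} (e : k = j)
    (h : Red N k (eps K k • b)) : Red N j (eps K j • b) := by
  subst e; exact h

theorem qisom_of_biso (h2 : (2 : K) ≠ 0) {c : K} (hc : c ≠ 0) {Q : QuadraticForm K V}
    {Q' : QuadraticForm K V'} (h : BIso (c • Q.polarBilin) (c • Q'.polarBilin)) : QIsom Q Q' := by
  obtain ⟨φ, h⟩ := h
  refine ⟨φ, fun x => ?_⟩
  have := h x x
  simp only [LinearMap.smul_apply, smul_eq_mul] at this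
  have := mul_left_cancel₀ hc this
  rw [← qf_polar_self h2 Q, ← qf_polar_self h2 Q', qf_apply, qf_apply, this]

theorem qisom_polar {Q : QuadraticForm K V} {Q' : QuadraticForm K V'} {φ : V ≃ₗ[K] V'}
    (h : ∀ x, Q' (φ x) = Q x) (v w : V) :
    QuadraticMap.polar Q' (φ v) (φ w) = QuadraticMap.polar Q v w := by
  simp only [QuadraticMap.polar, ← map_add, h]

theorem biso_of_qisom {c : K} {Q : QuadraticForm K V}
    {Q' : QuadraticForm K V'} (h : QIsom Q Q') : BIso (c • Q.polarBilin) (c • Q'.polarBilin) := by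
  obtain ⟨φ, h⟩ := h
  refine ⟨φ, fun v w => ?_⟩
  simp [qisom_polar h]
end

section
variable {n : ℕ} (Q : QF K n) (hQ : QNondeg Q)

/-- Nilpotent elements of the Lie algebra. -/
abbrev Elt (Q : QF K n) : Type := {X : Module.End K (Fin n → K) // X ∈ soSet Q ∧ IsNilpotent X}

/-- The associated structure. -/
noncomputable def NX (X : Elt Q) : Nil (1 : K) (Fin n → K) where
  B := Q.polarBilin
  X := X.1
  symm v w := by rw [one_mul, polar_comm]
  nd := hQ
  skew v w := eq_neg_of_add_eq_zero_left (X.2.1 v w)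

/-- The relation between nilpotent elements and pairs. -/
def Rel (X : Elt Q) (pq : PairData K Q) : Prop :=
  JT (NX Q hQ X) pq.1.1.parts ∧ ∀ j, Red (NX Q hQ X) j.1 (eps K j.1 • (pq.2.1 j).polarBilin)

theorem part_pos (l : Nat.Partition n) : ∀ x ∈ l.parts, 0 < x := fun _ hx => l.parts_pos hx

theorem rel_unique (h2 : (2 : K) ≠ 0) {X : Elt Q} {pq pq' : PairData K Q} (h : Rel Q hQ X pq)
    (h' : Rel Q hQ X pq') : PairRel K Q pq pq' := by
  refine ⟨Subtype.ext (Nat.Partition.ext (JT.unique (part_pos _) (part_pos _) h.1 h'.1)),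
    fun jx jy e => ?_⟩
  have h3 := h.2 jx
  have h4 := h'.2 jy
  have h3 := red_eps e h3
  exact qisom_of_biso h2 (eps_ne _) (Red.unique (smul_nd (eps_ne _) (pq.2.2.1 jx))
    (smul_nd (eps_ne _) (pq'.2.2.1 jy)) h3 h4)

theorem rel_congr {X : Elt Q} {pq pq' : PairData K Q} (h : Rel Q hQ X pq)
    (h' : PairRel K Q pq pq') : Rel Q hQ X pq' := by
  obtain ⟨e, h'⟩ := h'
  refine ⟨e ▸ h.1, fun j => ?_⟩
  let jx : {j : ℕ // j ∈ pq.1.1.parts.toFinset.filter (fun j : ℕ => Odd j)} :=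
    ⟨j.1, by rw [e]; exact j.2⟩
  exact (h.2 jx).biso_right (biso_of_qisom (h' jx j rfl))

theorem pairRel_symm {pq pq' : PairData K Q} (h : PairRel K Q pq pq') : PairRel K Q pq' pq :=
  ⟨h.1.symm, fun jx jy e => qsymm (h.2 jy jx e.symm)⟩

theorem rel_iso {X Y : Elt Q} (h : Iso (NX Q hQ X) (NX Q hQ Y)) {pq : PairData K Q}
    (hr : Rel Q hQ X pq) : Rel Q hQ Y pq :=
  ⟨fun i => by rw [← h.finrank_ker i]; exact hr.1 i, fun j => (hr.2 j).iso h.symm⟩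

theorem iso_conj {X Y : Elt Q} {g : (Fin n → K) ≃ₗ[K] (Fin n → K)} (hg : InO Q g)
    (h : Y.1 = (LinearEquiv.conj g) X.1) : Iso (NX Q hQ X) (NX Q hQ Y) := by
  refine ⟨g, fun v w => qisom_polar hg v w, fun v => ?_⟩
  change g (X.1 v) = Y.1 (g v)
  rw [h]
  simp [LinearEquiv.conj_apply_apply]

theorem conj_iso (h2 : (2 : K) ≠ 0) {X Y : Elt Q} (h : Iso (NX Q hQ X) (NX Q hQ Y)) :
    ∃ g : (Fin n → K) ≃ₗ[K] (Fin n → K), InO Q g ∧ Y.1 = (LinearEquiv.conj g) X.1 := by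
  obtain ⟨g, h1, h3⟩ := h
  refine ⟨g, fun v => ?_, LinearMap.ext fun v => ?_⟩
  · have e : Q.polarBilin (g v) (g v) = Q.polarBilin v v := h1 v v
    conv_lhs => rw [← qf_polar_self h2 Q, qf_apply, e, ← qf_apply, qf_polar_self h2]
  · have := h3 (g.symm v)
    change g (X.1 (g.symm v)) = Y.1 (g (g.symm v)) at this
    rw [LinearEquiv.conj_apply_apply, this, LinearEquiv.apply_symm_apply]

theorem rel_conj (h2 : (2 : K) ≠ 0) {X Y : Elt Q} {pq : PairData K Q} (h : Rel Q hQ X pq)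
    (h' : Rel Q hQ Y pq) : Iso (NX Q hQ X) (NX Q hQ Y) := by
  obtain ⟨k, hk⟩ := X.2.2
  obtain ⟨k', hk'⟩ := Y.2.2
  exact iso_of h2 (k := k) (k' := k') hk hk' (part_pos _) h.1 h'.1 pq.2.1 pq.2.2.1 h.2 h'.2

theorem finrank_eq_sum {V : Type} [AddCommGroup V] [Module K V] [FiniteDimensional K V]
    {N : Nil (1 : K) V} {s : Multiset ℕ} {k : ℕ} (hs : ∀ x ∈ s, x ≤ k) (h : JT N s)
    (hk : N.X ^ k = 0) : Module.finrank K V = s.sum := by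
  have h1 := h k
  rw [hk, LinearMap.ker_zero, finrank_top] at h1
  rw [h1]
  congr 1
  conv_rhs => rw [← Multiset.map_id s]
  exact Multiset.map_congr rfl fun x hx => min_eq_right (hs x hx)

theorem rel_exists (h2 : (2 : K) ≠ 0) (X : Elt Q) : ∃ pq, Rel Q hQ X pq := by
  obtain ⟨k, hk⟩ := X.2.2
  have hk : (NX Q hQ X).X ^ k = 0 := hk
  obtain ⟨s, h1, h3, h4, h5⟩ := exist h2 k _ (NX Q hQ X) hk
  have hsum : s.sum = n := by
    rw [← finrank_eq_sum (fun x hx => (h1 x hx).2) h3 hk]; simp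
  choose b hb1 hb2 hb3 using h5
  have hodd : ∀ j : {j : ℕ // j ∈ s.toFinset.filter (fun j : ℕ => Odd j)}, Odd j.1 :=
    fun j => (Finset.mem_filter.1 j.2).2
  let Qt : ∀ j : {j : ℕ // j ∈ s.toFinset.filter (fun j : ℕ => Odd j)}, QF K (s.count j.1) :=
    fun j => qf (eps K j.1 • b j.1 (hodd j))
  have hpol : ∀ j, (Qt j).polarBilin = eps K j.1 • b j.1 (hodd j) := fun j => by
    refine LinearMap.ext fun v => LinearMap.ext fun w => ?_
    refine qf_polar h2 _ (fun v w => ?_) v w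
    simp only [LinearMap.smul_apply, hb1 _ _ v w]
  have hnd : ∀ j, QNondeg (Qt j) := fun j v hv => by
    refine smul_nd (eps_ne j.1) (hb2 j.1 (hodd j)) v fun w => ?_
    rw [← hpol]
    exact hv w
  have hred : ∀ j, Red (NX Q hQ X) j.1 (eps K j.1 • (Qt j).polarBilin) := fun j => by
    rw [hpol, smul_smul, eps_mul, one_smul]
    exact hb3 _ _
  obtain ⟨V, _, _, _, N, g1, g2, g3, g4⟩ := model h2 s (fun x hx => (h1 x hx).1) h4 Qt hnd
  obtain ⟨φ, hφ, -⟩ := iso_of h2 g2 hk (fun x hx => (h1 x hx).1) g1 h3 Qt hnd g3 hred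
  have hw : QIsom (qf N.B) Q := ⟨φ, fun x => by
    have e : Q.polarBilin (φ x) (φ x) = N.B x x := hφ x x
    conv_lhs => rw [← qf_polar_self h2 Q, qf_apply, e]
    rw [qf_apply]⟩
  exact ⟨⟨⟨⟨s, fun {i} hi => (h1 i hi).1, hsum⟩, h4⟩, Qt, hnd, witt_isom g4 hw⟩, h3, hred⟩

theorem rel_surj (h2 : (2 : K) ≠ 0) (pq : PairData K Q) : ∃ X, Rel Q hQ X pq := by
  obtain ⟨V, _, _, _, N, g1, g2, g3, g4⟩ := model h2 pq.1.1.parts (part_pos _) pq.1.2 pq.2.1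
    pq.2.2.1
  have hd : Module.finrank K V = Module.finrank K (Fin n → K) := by
    rw [finrank_eq_sum (fun x hx => Multiset.le_sum_of_mem hx) g1 g2, pq.1.1.parts_sum]; simp
  obtain ⟨φ, hφ⟩ := witt_cancel h2 (witt_trans (witt_symm g4) pq.2.2.2) hd
  have hB : ∀ v w, QuadraticMap.polar Q (φ v) (φ w) = N.B v w := fun v w => by
    rw [qisom_polar hφ, qf_polar h2]
    intro v w
    rw [N.symm v w, one_mul]
  have hX : ∀ v, (LinearEquiv.conj φ) N.X (φ v) = φ (N.X v) := fun v => by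
    simp [LinearEquiv.conj_apply_apply]
  let X : Elt Q := ⟨(LinearEquiv.conj φ) N.X, by
      intro v w
      obtain ⟨v, rfl⟩ := φ.surjective v
      obtain ⟨w, rfl⟩ := φ.surjective w
      rw [hX, hX, hB, hB, N.skew, neg_add_cancel], by
      refine ⟨pq.1.1.parts.sum, ?_⟩
      have e : ∀ i v, ((LinearEquiv.conj φ) N.X ^ i) (φ v) = φ ((N.X ^ i) v) := by
        intro i
        induction i with
        | zero => simp
        | succ i ih => intro v; simp only [pow_succ, Module.End.mul_apply, ih, hX]
      refine LinearMap.ext fun v => ?_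
      obtain ⟨v, rfl⟩ := φ.surjective v
      rw [e, g2]; simp⟩
  have hiso : Iso N (NX Q hQ X) := ⟨φ, hB, fun v => (hX v).symm⟩
  exact ⟨X, fun i => by rw [← hiso.finrank_ker i]; exact g1 i, fun j => (g3 j).iso hiso.symm⟩

theorem main (Q : QF K n) (hQ : QNondeg Q) (h2 : (2 : K) ≠ 0) :
    ∃ Φ : Quot (fun (X Y : {X : Module.End K (Fin n → K) // X ∈ soSet Q ∧ IsNilpotent X}) =>
          ∃ g : (Fin n → K) ≃ₗ[K] (Fin n → K), InO Q g ∧ Y.1 = (LinearEquiv.conj g) X.1) ≃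
        Quot (PairRel K Q),
      ∀ (X : {X : Module.End K (Fin n → K) // X ∈ soSet Q ∧ IsNilpotent X})
        (pq : PairData K Q),
        Φ (Quot.mk _ X) = Quot.mk _ pq → HasJordanType X.1 pq.1.1 := by
  choose c hc using rel_exists Q hQ h2
  let f : Quot (fun (X Y : {X : Module.End K (Fin n → K) // X ∈ soSet Q ∧ IsNilpotent X}) =>
          ∃ g : (Fin n → K) ≃ₗ[K] (Fin n → K), InO Q g ∧ Y.1 = (LinearEquiv.conj g) X.1) →
        Quot (PairRel K Q) := Quot.lift (fun X => Quot.mk _ (c X)) (by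
    rintro X Y ⟨g, hg, h⟩
    exact Quot.sound (rel_unique Q hQ h2 (rel_iso Q hQ (iso_conj Q hQ hg h) (hc X)) (hc Y)))
  let Rq : Elt Q → Quot (PairRel K Q) → Prop := fun X => Quot.lift (Rel Q hQ X)
    fun a b h => propext ⟨fun h' => rel_congr Q hQ h' h,
      fun h' => rel_congr Q hQ h' (pairRel_symm Q h)⟩
  have hR : ∀ X pq, f (Quot.mk _ X) = Quot.mk _ pq → Rel Q hQ X pq := by
    intro X pq h
    have h1 : Rq X (Quot.mk _ (c X)) := hc X
    have h3 : Quot.mk (PairRel K Q) (c X) = Quot.mk _ pq := h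
    rw [h3] at h1
    exact h1
  have hbij : Function.Bijective f := by
    constructor
    · intro a b
      induction a using Quot.ind with | mk X
      induction b using Quot.ind with | mk Y
      intro h
      exact Quot.sound (conj_iso Q hQ h2 (rel_conj Q hQ h2 (hR X (c Y) h) (hc Y)))
    · intro b
      induction b using Quot.ind with | mk pq
      obtain ⟨X, hX⟩ := rel_surj Q hQ h2 pq
      exact ⟨Quot.mk _ X, Quot.sound (rel_unique Q hQ h2 (hc X) hX)⟩
  exact ⟨Equiv.ofBijective f hbij, fun X pq h => (hR X pq h).1⟩
end
end NO

/-- Theorem (partition-type parametrization of nilpotent `O(Q)`-orbits): there is a bijection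
between `O(Q)`-orbits of nilpotent elements of `so(Q)` and pairs `(λ, c)` as above, matching
Jordan types with first components. -/
theorem statement_3 (p : ℕ) [Fact p.Prime] (hp : p ≠ 2) (K : Type) [Field K]
    [Algebra ℚ_[p] K] [FiniteDimensional ℚ_[p] K]
    (n : ℕ) (Q : QF K n) (hQ : QNondeg Q) :
    ∃ Φ : Quot (fun (X Y : {X : Module.End K (Fin n → K) // X ∈ soSet Q ∧ IsNilpotent X}) =>
          ∃ g : (Fin n → K) ≃ₗ[K] (Fin n → K), InO Q g ∧ Y.1 = (LinearEquiv.conj g) X.1) ≃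
        Quot (PairRel K Q),
      ∀ (X : {X : Module.End K (Fin n → K) // X ∈ soSet Q ∧ IsNilpotent X})
        (pq : PairData K Q),
        Φ (Quot.mk _ X) = Quot.mk _ pq → HasJordanType X.1 pq.1.1 := by
  have : CharZero K := charZero_of_injective_algebraMap (algebraMap ℚ_[p] K).injective
  exact NO.main Q hQ two_ne_zero
end

section
/- Let p be an odd prime, K a finite field extension of ℚ_p, and Q a nondegenerate quadratic form on an n-dimensional K-vector space. If X ∈ so(Q) is nilpotent and its Jordan type contains at least one odd part, then the O(Q)-conjugation orbit of X coincides with its SO(Q)-conjugation orbit: {gXg⁻¹ : g ∈ O(Q)} = {gXg⁻¹ : g ∈ SO(Q)}. -/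
theorem aux_pow {K V : Type} [Field K] [AddCommGroup V] [Module K V]
    (B : LinearMap.BilinForm K V) (X : Module.End K V)
    (hX : ∀ v w, B (X v) w + B v (X w) = 0) (a : ℕ) :
    ∀ v w, B ((X ^ a) v) w = (-1) ^ a * B v ((X ^ a) w) := by
  induction a with
  | zero => intro v w; simp
  | succ a ih =>
    intro v w
    rw [pow_succ X a, Module.End.mul_apply, ih, ← pow_succ X a, pow_succ' X a,
      Module.End.mul_apply]
    have h := hX v ((X ^ a) w)
    rw [eq_neg_of_add_eq_zero_left h]
    ring

theorem aux_range {K V : Type} [Field K] [AddCommGroup V] [Module K V] [FiniteDimensional K V]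
    (B : LinearMap.BilinForm K V) (hB : B.Nondegenerate) (hs : B.IsRefl) (X : Module.End K V)
    (hX : ∀ v w, B (X v) w + B v (X w) = 0) (j : ℕ) (y : V)
    (hy : ∀ z, (X ^ j) z = 0 → B z y = 0) : ∃ u, (X ^ j) u = y := by
  have h1 : y ∈ B.orthogonal (B.orthogonal (LinearMap.range (X ^ j))) := by
    rw [LinearMap.BilinForm.mem_orthogonal_iff]
    intro z hz
    rw [LinearMap.BilinForm.mem_orthogonal_iff] at hz
    apply hy
    apply hB.1
    intro u
    rw [aux_pow B X hX, hs _ _ (hz _ ⟨u, rfl⟩), mul_zero]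
  rw [LinearMap.BilinForm.orthogonal_orthogonal hB hs] at h1
  exact h1

theorem aux_dim {K V : Type} [Field K] [AddCommGroup V] [Module K V] [FiniteDimensional K V]
    (X : Module.End K V) (i : ℕ) :
    Module.finrank K ((LinearMap.ker (X ^ (i + 1))).map (X ^ i))
      + Module.finrank K (LinearMap.ker (X ^ i))
      = Module.finrank K (LinearMap.ker (X ^ (i + 1))) := by
  have h := LinearMap.finrank_range_add_finrank_ker
    ((X ^ i).domRestrict (LinearMap.ker (X ^ (i + 1))))
  rw [LinearMap.range_domRestrict, LinearMap.ker_domRestrict] at h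
  rw [← h]
  congr 1
  have hle : LinearMap.ker (X ^ i) ≤ LinearMap.ker (X ^ (i + 1)) := by
    intro x hx
    rw [LinearMap.mem_ker] at hx ⊢
    rw [pow_succ', Module.End.mul_apply, hx, map_zero]
  exact (LinearEquiv.finrank_eq (Submodule.comapSubtypeEquivOfLe hle)).symm

theorem aux_count (s : Multiset ℕ) (k : ℕ) :
    2 * (s.map (fun a => min (k + 1) a)).sum
      = (s.map (fun a => min k a)).sum + (s.map (fun a => min (k + 2) a)).sum
        + s.count (k + 1) := by
  induction s using Multiset.induction with
  | empty => simp
  | cons a s ih =>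
    simp only [Multiset.map_cons, Multiset.sum_cons, Multiset.count_cons]
    split_ifs with h <;> omega

/-- existence of a good vector -/
theorem aux_exists {K V : Type} [Field K] [AddCommGroup V] [Module K V] [FiniteDimensional K V]
    (h2 : (2 : K) ≠ 0)
    (B : LinearMap.BilinForm K V) (hB : B.Nondegenerate) (hs : ∀ x y, B x y = B y x)
    (X : Module.End K V)
    (hX : ∀ v w, B (X v) w + B v (X w) = 0) {n : ℕ} (lam : Nat.Partition n)
    (hlam : HasJordanType X lam) (k : ℕ) (hk : Even k) (hmem : k + 1 ∈ lam.parts) :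
    ∃ v, (X ^ (k + 1)) v = 0 ∧ B v ((X ^ k) v) ≠ 0 := by
  by_contra! hcon
  have hrefl : B.IsRefl := fun x y h => by rw [hs, h]
  have hsym : ∀ v w, B v ((X ^ k) w) = B w ((X ^ k) v) := by
    intro v w
    rw [hs, aux_pow B X hX, hk.neg_one_pow, one_mul]
  have hzero : ∀ v w, (X ^ (k + 1)) v = 0 → (X ^ (k + 1)) w = 0 → B v ((X ^ k) w) = 0 := by
    intro v w hv hw
    have h := hcon (v + w) (by rw [map_add, hv, hw, add_zero])
    simp only [map_add, LinearMap.add_apply] at h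
    rw [hcon v hv, hcon w hw, hsym w v] at h
    have : 2 * B v ((X ^ k) w) = 0 := by linear_combination h
    exact (mul_eq_zero.1 this).resolve_left h2
  have heq : (LinearMap.ker (X ^ (k + 1 + 1))).map (X ^ (k + 1))
      = (LinearMap.ker (X ^ (k + 1))).map (X ^ k) := by
    apply le_antisymm
    · rintro _ ⟨u, hu, rfl⟩
      refine ⟨X u, ?_, ?_⟩
      · have hu' : (X ^ (k + 1 + 1)) u = 0 := hu
        rw [pow_succ, Module.End.mul_apply] at hu'
        exact hu'
      · rw [pow_succ, Module.End.mul_apply]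
    · rintro _ ⟨w, hw, rfl⟩
      have hw' : (X ^ (k + 1)) w = 0 := hw
      obtain ⟨u, hu⟩ := aux_range B hB hrefl X hX (k + 1) ((X ^ k) w)
        (fun z hz => hzero z w hz hw')
      refine ⟨u, ?_, hu⟩
      change (X ^ (k + 1 + 1)) u = 0
      rw [pow_succ', Module.End.mul_apply, hu, ← Module.End.mul_apply, ← pow_succ', hw']
  have d1 := aux_dim X (k + 1)
  have d0 := aux_dim X k
  rw [heq] at d1
  have e0 := hlam k
  have e1 := hlam (k + 1)
  have e2 := hlam (k + 2)
  have hc := aux_count lam.parts k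
  have hpos : 0 < lam.parts.count (k + 1) := Multiset.count_pos.2 hmem
  have e2' : Module.finrank K (LinearMap.ker (X ^ (k + 1 + 1))) = _ := e2
  omega

theorem aux_coeff {K V : Type} [Field K] [AddCommGroup V] [Module K V]
    (B : LinearMap.BilinForm K V) (X : Module.End K V)
    (hX : ∀ v w, B (X v) w + B v (X w) = 0) (k : ℕ) (v : V)
    (hv : (X ^ (k + 1)) v = 0) (hc : B v ((X ^ k) v) ≠ 0) (c : Fin (k + 1) → K)
    (h : ∀ i : Fin (k + 1), B (∑ a, c a • (X ^ (a : ℕ)) v) ((X ^ (i : ℕ)) v) = 0) :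
    ∀ a, c a = 0 := by
  have hbig : ∀ m, k + 1 ≤ m → (X ^ m) v = 0 := by
    intro m hm
    obtain ⟨d, rfl⟩ := Nat.exists_eq_add_of_le hm
    rw [add_comm, pow_add, Module.End.mul_apply, hv, map_zero]
  have key : ∀ m (hm : m < k + 1), c ⟨m, hm⟩ = 0 := by
    intro m
    induction m using Nat.strong_induction_on with
    | _ m ih =>
      intro hm
      have h1 := h ⟨k - m, by omega⟩
      rw [map_sum, LinearMap.sum_apply, Finset.sum_eq_single (⟨m, hm⟩ : Fin (k + 1))] at h1
      · rw [map_smul, LinearMap.smul_apply, aux_pow B X hX, ← Module.End.mul_apply, ← pow_add,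
          smul_eq_mul] at h1
        have h3 : m + (k - m) = k := by omega
        simp only [h3] at h1
        have h4 : ((-1 : K)) ^ m ≠ 0 := pow_ne_zero _ (by simp)
        exact (mul_eq_zero.1 h1).resolve_right (mul_ne_zero h4 hc)
      · intro b _ hb
        rcases lt_trichotomy (b : ℕ) m with hlt | heq | hgt
        · rw [show c b = 0 from ih b hlt b.2]
          simp
        · exact absurd (Fin.ext heq) hb
        · rw [map_smul, LinearMap.smul_apply, aux_pow B X hX, ← Module.End.mul_apply, ← pow_add,
            hbig _ (by simp only; omega)]
          simp
      · intro hh; exact absurd (Finset.mem_univ _) hh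
  intro a
  exact key a a.2

/-- the centralizer of `X` in `O(Q)` contains an element of determinant `-1`. -/
theorem aux_reflection {K V : Type} [Field K] [AddCommGroup V] [Module K V]
    [FiniteDimensional K V] (Q : QuadraticForm K V) (X : Module.End K V)
    (hX : X ∈ soSet Q) (k : ℕ) (hk : Even k) (v : V)
    (hv : (X ^ (k + 1)) v = 0) (hc : QuadraticMap.polar Q v ((X ^ k) v) ≠ 0) :
    ∃ g : V ≃ₗ[K] V, InO Q g ∧ LinearMap.det (g : V →ₗ[K] V) = -1 ∧ ∀ x, g (X x) = X (g x) := by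
  set B : LinearMap.BilinForm K V := QuadraticMap.polarBilin Q with hBdef
  have hBp : ∀ x y, B x y = QuadraticMap.polar Q x y := fun x y => rfl
  have hs : ∀ x y, B x y = B y x := fun x y => by
    rw [hBp, hBp, QuadraticMap.polar_comm]
  have hrefl : B.IsRefl := fun x y h => by rw [hs, h]
  have hXB : ∀ v w, B (X v) w + B v (X w) = 0 := hX
  let f : Fin (k + 1) → V := fun i => (X ^ (i : ℕ)) v
  have hcoeff := aux_coeff B X hXB k v hv hc
  have hli : LinearIndependent K f := by
    rw [Fintype.linearIndependent_iff]
    intro c h0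
    apply hcoeff
    intro i
    change B (∑ a, c a • f a) _ = 0
    rw [h0]; simp
  let W : Submodule K V := Submodule.span K (Set.range f)
  have hfin : Module.finrank K W = k + 1 := by
    rw [finrank_span_eq_card hli, Fintype.card_fin]
  have hfW : ∀ i, f i ∈ W := fun i => Submodule.subset_span ⟨i, rfl⟩
  have hdisj : Disjoint W (B.orthogonal W) := by
    rw [Submodule.disjoint_def]
    intro x hx hx'
    obtain ⟨c, rfl⟩ := (Submodule.mem_span_range_iff_exists_fun K).1 hx
    have : ∀ a, c a = 0 := by
      apply hcoeff
      intro i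
      rw [hs]
      exact hx' _ (hfW i)
    simp [this]
  have hcompl : IsCompl W (B.orthogonal W) :=
    (LinearMap.BilinForm.isCompl_orthogonal_iff_disjoint hrefl).2 hdisj
  have hXW : ∀ w ∈ W, X w ∈ W := by
    intro w hw
    have : W ≤ W.comap X := by
      rw [Submodule.span_le]
      rintro _ ⟨i, rfl⟩
      change X ((X ^ (i : ℕ)) v) ∈ W
      rw [← Module.End.mul_apply, ← pow_succ']
      by_cases hi : (i : ℕ) + 1 < k + 1
      · exact hfW ⟨i + 1, hi⟩
      · have : (i : ℕ) + 1 = k + 1 := by omega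
        rw [this, hv]
        exact W.zero_mem
    exact this hw
  have hXP : ∀ u ∈ B.orthogonal W, X u ∈ B.orthogonal W := by
    intro u hu w hw
    have h1 := hXB w u
    have h2 : B (X w) u = 0 := hu _ (hXW w hw)
    rw [h2, zero_add] at h1
    exact h1
  let e := Submodule.prodEquivOfIsCompl W (B.orthogonal W) hcompl
  let r : (W × B.orthogonal W) ≃ₗ[K] (W × B.orthogonal W) :=
    LinearEquiv.prodCongr (LinearEquiv.neg K) (LinearEquiv.refl K _)
  let g : V ≃ₗ[K] V := (e.symm.trans r).trans e
  have hg : ∀ w ∈ W, ∀ u ∈ B.orthogonal W, g (w + u) = -w + u := by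
    intro w hw u hu
    have h1 : w + u = e (⟨w, hw⟩, ⟨u, hu⟩) := by simp [e]
    change e (r (e.symm (w + u))) = _
    rw [h1, LinearEquiv.symm_apply_apply]
    simp [r, e]
  have hdec : ∀ x, ∃ w ∈ W, ∃ u ∈ B.orthogonal W, x = w + u := by
    intro x
    obtain ⟨⟨w, u⟩, rfl⟩ := e.surjective x
    exact ⟨w, w.2, u, u.2, by simp [e]⟩
  refine ⟨g, ?_, ?_, ?_⟩
  · intro x
    obtain ⟨w, hw, u, hu, rfl⟩ := hdec x
    rw [hg w hw u hu]
    have h0 : QuadraticMap.polar Q w u = 0 := hu w hw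
    have h0' : QuadraticMap.polar Q (-w) u = 0 := by
      rw [QuadraticMap.polar_neg_left, h0, neg_zero]
    rw [QuadraticMap.map_add Q w u, QuadraticMap.map_add Q (-w) u, h0, h0',
      QuadraticMap.map_neg]
  · have h1 : (g : V →ₗ[K] V) = (e : (W × B.orthogonal W) →ₗ[K] V) ∘ₗ
        (LinearMap.prodMap (-LinearMap.id) LinearMap.id) ∘ₗ
        (e.symm : V →ₗ[K] (W × B.orthogonal W)) := by
      ext x
      rfl
    rw [h1, LinearMap.det_conj, LinearMap.det_prodMap, LinearMap.det_id, mul_one,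
      ← neg_one_smul K, LinearMap.det_smul, LinearMap.det_id, hfin, mul_one,
      hk.add_one.neg_one_pow]
  · intro x
    obtain ⟨w, hw, u, hu, rfl⟩ := hdec x
    rw [map_add X, hg _ (hXW w hw) _ (hXP u hu), hg w hw u hu, map_add, map_neg]

theorem aux_det {K : Type} [Field K] {n : ℕ} (Q : QF K n)
    (hB : (QuadraticMap.polarBilin Q).Nondegenerate)
    (g : (Fin n → K) ≃ₗ[K] (Fin n → K)) (hg : InO Q g) :
    LinearMap.det (g : (Fin n → K) →ₗ[K] (Fin n → K)) = 1 ∨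
    LinearMap.det (g : (Fin n → K) →ₗ[K] (Fin n → K)) = -1 := by
  set B : LinearMap.BilinForm K (Fin n → K) := QuadraticMap.polarBilin Q with hBdef
  set G : (Fin n → K) →ₗ[K] (Fin n → K) := (g : (Fin n → K) →ₗ[K] (Fin n → K))
  have hcomp : B.comp G G = B := by
    ext x y
    simp only [hBdef, G, LinearMap.BilinForm.comp_apply, QuadraticMap.polarBilin_apply_apply,
      QuadraticMap.polar, LinearMap.comp_apply, LinearEquiv.coe_coe, ← map_add, hg _]
  have h1 := congrArg (fun C => (LinearMap.BilinForm.toMatrix' C).det) hcomp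
  simp only [LinearMap.BilinForm.toMatrix'_comp, Matrix.det_mul, Matrix.det_transpose,
    LinearMap.det_toMatrix'] at h1
  have h2 : (LinearMap.BilinForm.toMatrix' B).det ≠ 0 :=
    Matrix.nondegenerate_iff_det_ne_zero.1 (LinearMap.BilinForm.Nondegenerate.toMatrix' hB)
  have h3 : LinearMap.det G * LinearMap.det G = 1 := by
    apply mul_right_cancel₀ h2
    linear_combination h1
  exact mul_self_eq_one_iff.1 h3

/-- If the Jordan type of a nilpotent `X ∈ so(Q)` has an odd part, the `O(Q)`-orbit of `X`
coincides with its `SO(Q)`-orbit. -/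
theorem statement_4 (p : ℕ) [Fact p.Prime] (hp : p ≠ 2) (K : Type) [Field K]
    [Algebra ℚ_[p] K] [FiniteDimensional ℚ_[p] K]
    (n : ℕ) (Q : QF K n) (hQ : QNondeg Q)
    (X : Module.End K (Fin n → K)) (hX : X ∈ soSet Q) (hnil : IsNilpotent X)
    (lam : Nat.Partition n) (hlam : HasJordanType X lam)
    (hodd : ∃ j ∈ lam.parts, Odd j) :
    {Y | ∃ g : (Fin n → K) ≃ₗ[K] (Fin n → K), InO Q g ∧ Y = (LinearEquiv.conj g) X} =
    {Y | ∃ g : (Fin n → K) ≃ₗ[K] (Fin n → K), InSO Q g ∧ Y = (LinearEquiv.conj g) X} := by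
  have hinj : Function.Injective (algebraMap ℚ_[p] K) := (algebraMap ℚ_[p] K).injective
  haveI : CharZero K := charZero_of_injective_algebraMap hinj
  have hsl : (QuadraticMap.polarBilin Q).SeparatingLeft := hQ
  have hs : ∀ x y, QuadraticMap.polarBilin Q x y = QuadraticMap.polarBilin Q y x := fun x y => by
    simp only [QuadraticMap.polarBilin_apply_apply, QuadraticMap.polar_comm]
  have hB : (QuadraticMap.polarBilin Q).Nondegenerate :=
    ⟨hsl, fun y hy => hsl y (fun x => by rw [hs, hy])⟩
  obtain ⟨j, hj, k, rfl⟩ := hodd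
  have hk : Even (2 * k) := even_two_mul k
  obtain ⟨v, hv, hc⟩ := aux_exists two_ne_zero (QuadraticMap.polarBilin Q) hB hs X hX lam hlam
    (2 * k) hk hj
  obtain ⟨r, hrO, hrdet, hrX⟩ := aux_reflection Q X hX (2 * k) hk v hv hc
  ext Y
  constructor
  · rintro ⟨g, hg, rfl⟩
    rcases aux_det Q hB g hg with h | h
    · exact ⟨g, ⟨hg, h⟩, rfl⟩
    · refine ⟨r.trans g, ⟨fun x => ?_, ?_⟩, ?_⟩
      · rw [LinearEquiv.trans_apply, hg, hrO]
      · rw [← LinearEquiv.comp_coe, LinearMap.det_comp, h, hrdet]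
        norm_num
      · apply LinearMap.ext
        intro x
        rw [LinearEquiv.conj_apply_apply, LinearEquiv.conj_apply_apply,
          LinearEquiv.trans_apply, hrX]
        congr 2
        change _ = r (r.symm (g.symm x))
        rw [LinearEquiv.apply_symm_apply]
  · rintro ⟨g, hg, rfl⟩
    exact ⟨g, hg.1, rfl⟩
end

section
/- Let p be an odd prime, K a finite field extension of ℚ_p, Q a nondegenerate quadratic form on an n-dimensional K-vector space, and Q₀ an anisotropic quadratic form of degree d over K Witt equivalent to Q. Let λ ∈ Λ(n) and let m be the number of odd parts of λ counted with multiplicity. Then there exists a nilpotent element of so(Q) with Jordan type λ if and only if m ≥ d. -/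
namespace S6
open Module

section generic
variable {K : Type} [Field K] {V : Type} [AddCommGroup V] [Module K V]

lemma nondeg_polar {Q : QuadraticForm K V} (hQ : QNondeg Q) :
    LinearMap.BilinForm.Nondegenerate (QuadraticMap.polarBilin Q) := by
  refine ⟨fun v hv => hQ v fun w => ?_, fun v hv => hQ v fun w => ?_⟩
  · simpa using hv w
  · rw [QuadraticMap.polar_comm]; simpa using hv w

lemma refl_polar (Q : QuadraticForm K V) :
    LinearMap.BilinForm.IsRefl (QuadraticMap.polarBilin Q) := by
  intro x y h
  simp only [QuadraticMap.polarBilin_apply_apply] at h ⊢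
  rw [QuadraticMap.polar_comm]; exact h

lemma polar_iso {Q : QuadraticForm K V} {W : Submodule K V} (hW : ∀ x ∈ W, Q x = 0)
    {x y : V} (hx : x ∈ W) (hy : y ∈ W) : QuadraticMap.polar Q x y = 0 := by
  simp [QuadraticMap.polar, hW x hx, hW y hy, hW _ (W.add_mem hx hy)]

/-- Dimension estimate for two totally isotropic subspaces. -/
lemma iso_inter [FiniteDimensional K V] {Q : QuadraticForm K V} (hQ : QNondeg Q)
    (W L : Submodule K V) (hW : ∀ x ∈ W, Q x = 0) :
    finrank K W + finrank K (W ⊓ L : Submodule K V) ≤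
      finrank K (W ⊓ LinearMap.BilinForm.orthogonal (QuadraticMap.polarBilin Q) L :
        Submodule K V) + finrank K L := by
  set B : LinearMap.BilinForm K V := QuadraticMap.polarBilin Q with hB
  have hn : B.Nondegenerate := nondeg_polar hQ
  have hr : B.IsRefl := refl_polar Q
  have h1 : W ⊓ L ≤ B.orthogonal W ⊓ L := by
    refine inf_le_inf_right _ fun x hx y hy => ?_
    have := polar_iso hW hy hx
    exact this
  have h2 : B.orthogonal (B.orthogonal W ⊔ L) ≤ W ⊓ B.orthogonal L := by
    refine le_inf ?_ (LinearMap.BilinForm.orthogonal_le le_sup_right)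
    refine (LinearMap.BilinForm.orthogonal_le le_sup_left).trans ?_
    rw [LinearMap.BilinForm.orthogonal_orthogonal hn hr]
  have h3 := Submodule.finrank_mono h1
  have h4 := Submodule.finrank_mono h2
  rw [LinearMap.BilinForm.finrank_orthogonal hn] at h4
  have h5 := Submodule.finrank_sup_add_finrank_inf_eq (B.orthogonal W) L
  rw [LinearMap.BilinForm.finrank_orthogonal hn] at h5
  have h6 := Submodule.finrank_le W
  have h7 := Submodule.finrank_le (B.orthogonal W ⊔ L)
  omega

end generic

section lag
variable {K : Type} [Field K] {V : Type} [AddCommGroup V] [Module K V]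

lemma prodHyp_apply (Q : QuadraticForm K V) (a : ℕ) (v : V × (Fin a → K × K)) :
    (Q.prod (HypSum K a)) v = Q v.1 + ∑ i, (v.2 i).1 * (v.2 i).2 := by
  simp [HypSum, HypForm, QuadraticMap.prod_apply, QuadraticMap.pi_apply]

lemma prodHyp_polar (Q : QuadraticForm K V) (a : ℕ) (v w : V × (Fin a → K × K)) :
    QuadraticMap.polar (Q.prod (HypSum K a)) v w = QuadraticMap.polar Q v.1 w.1 +
      ∑ i, ((v.2 i).1 * (w.2 i).2 + (w.2 i).1 * (v.2 i).2) := by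
  simp only [QuadraticMap.polar, prodHyp_apply]
  have : ∑ i, ((v + w).2 i).1 * ((v + w).2 i).2 =
      ∑ i, ((v.2 i).1 * (w.2 i).2 + (w.2 i).1 * (v.2 i).2) + ∑ i, (v.2 i).1 * (v.2 i).2
        + ∑ i, (w.2 i).1 * (w.2 i).2 := by
    rw [← Finset.sum_add_distrib, ← Finset.sum_add_distrib]
    refine Finset.sum_congr rfl fun i _ => ?_
    simp; ring
  rw [this, Prod.fst_add]; ring

/-- The standard embedding of the Lagrangian. -/
def lagMap (K V : Type) [Field K] [AddCommGroup V] [Module K V] (a : ℕ) :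
    (Fin a → K) →ₗ[K] V × (Fin a → K × K) where
  toFun x := (0, fun i => (x i, 0))
  map_add' x y := by ext <;> simp
  map_smul' c x := by ext <;> simp

lemma lagMap_inj (a : ℕ) : Function.Injective (lagMap K V a) := by
  intro x y h
  ext i
  have := congrArg (fun z => (z.2 i).1) h
  simpa [lagMap] using this

def lag (K V : Type) [Field K] [AddCommGroup V] [Module K V] (a : ℕ) :
    Submodule K (V × (Fin a → K × K)) := LinearMap.range (lagMap K V a)

lemma finrank_lag (a : ℕ) : finrank K (lag K V a) = a := by
  rw [lag, LinearMap.finrank_range_of_inj (lagMap_inj a)]; simp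

lemma lag_iso (Q : QuadraticForm K V) (a : ℕ) : ∀ x ∈ lag K V a, Q.prod (HypSum K a) x = 0 := by
  rintro _ ⟨x, rfl⟩
  rw [prodHyp_apply]; simp [lagMap]

lemma mem_lag {a : ℕ} {v : V × (Fin a → K × K)} (h1 : v.1 = 0) (h2 : ∀ i, (v.2 i).2 = 0) :
    v ∈ lag K V a := by
  refine ⟨fun i => (v.2 i).1, ?_⟩
  ext <;> simp [lagMap, h1, h2]

lemma prodHyp_nondeg {Q : QuadraticForm K V} (hQ : QNondeg Q) (a : ℕ) :
    QNondeg (Q.prod (HypSum K a)) := by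
  intro v hv
  have h1 : v.1 = 0 := by
    refine hQ _ fun w => ?_
    have := hv (w, 0)
    rw [prodHyp_polar] at this
    simpa using this
  have h2 : ∀ i, v.2 i = 0 := by
    intro i
    have hx := hv (0, Pi.single i (0, 1))
    have hy := hv (0, Pi.single i (1, 0))
    rw [prodHyp_polar, Finset.sum_eq_single i] at hx hy
    · ext
      · simpa [h1] using hx
      · simpa [h1] using hy
    all_goals simp +contextual [Pi.single_apply]
  ext i
  · simp [h1]
  all_goals simp [h2]

lemma orth_lag {Q : QuadraticForm K V} {a : ℕ} {v : V × (Fin a → K × K)}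
    (hv : v ∈ LinearMap.BilinForm.orthogonal (QuadraticMap.polarBilin (Q.prod (HypSum K a)))
      (lag K V a)) (i : Fin a) : (v.2 i).2 = 0 := by
  have := hv (lagMap K V a (Pi.single i 1)) ⟨_, rfl⟩
  change QuadraticMap.polar (Q.prod (HypSum K a)) _ _ = 0 at this
  rw [prodHyp_polar,
    Finset.sum_eq_single i] at this
  · simpa [lagMap] using this
  all_goals simp +contextual [lagMap, Pi.single_apply]

lemma aniso_nondeg {Q : QuadraticForm K V} (h2 : (2 : K) ≠ 0) (hQ : Q.Anisotropic) :
    QNondeg Q := by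
  intro v hv
  have := hv v
  rw [QuadraticMap.polar_self] at this
  exact hQ v (by simpa [h2] using this)

lemma iso_dim_le [FiniteDimensional K V] {Q : QuadraticForm K V} (h2 : (2 : K) ≠ 0)
    (hQ : Q.Anisotropic) (a : ℕ)
    (W : Submodule K (V × (Fin a → K × K))) (hW : ∀ x ∈ W, Q.prod (HypSum K a) x = 0) :
    finrank K W ≤ a := by
  have h := iso_inter (prodHyp_nondeg (aniso_nondeg h2 hQ) a) W (lag K V a) hW
  rw [finrank_lag] at h
  have h3 : W ⊓ LinearMap.BilinForm.orthogonal (QuadraticMap.polarBilin (Q.prod (HypSum K a)))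
      (lag K V a) ≤ W ⊓ lag K V a := by
    rintro v ⟨hv1, hv2⟩
    refine ⟨hv1, mem_lag ?_ (orth_lag hv2)⟩
    have := hW v hv1
    rw [prodHyp_apply] at this
    exact hQ _ (by simpa [orth_lag hv2] using this)
  have := Submodule.finrank_mono h3
  omega

/-- existence of a big isotropic subspace -/
lemma exists_iso [FiniteDimensional K V] {V₀ : Type} [AddCommGroup V₀] [Module K V₀]
    [FiniteDimensional K V₀]
    {Q : QuadraticForm K V} (hQ : QNondeg Q) {Q₀ : QuadraticForm K V₀} {a b : ℕ}
    (h : QIsom (Q₀.prod (HypSum K a)) (Q.prod (HypSum K b))) :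
    ∃ W : Submodule K V, (∀ x ∈ W, Q x = 0) ∧ a ≤ b + finrank K W := by
  obtain ⟨φ, hφ⟩ := h
  let W := (lag K V₀ a).map (φ : _ →ₗ[K] V × (Fin b → K × K))
  have hWd : finrank K W = a := by
    rw [← finrank_lag (K := K) (V := V₀) a]
    exact LinearEquiv.finrank_map_eq φ _
  have hW : ∀ x ∈ W, Q.prod (HypSum K b) x = 0 := by
    rintro _ ⟨x, hx, rfl⟩
    exact (hφ x).trans (lag_iso Q₀ a x hx)
  have h := iso_inter (prodHyp_nondeg hQ b) W (lag K V b) hW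
  rw [finrank_lag] at h
  set U := W ⊓ LinearMap.BilinForm.orthogonal (QuadraticMap.polarBilin (Q.prod (HypSum K b)))
      (lag K V b) with hU
  let f := (LinearMap.fst K V (Fin b → K × K)).domRestrict U
  refine ⟨LinearMap.range f, ?_, ?_⟩
  · rintro _ ⟨⟨x, hx⟩, rfl⟩
    have := hW x hx.1
    rw [prodHyp_apply] at this
    simpa [orth_lag hx.2, f] using this
  · have h5 := f.finrank_range_add_finrank_ker
    have h6 : finrank K (LinearMap.ker f) ≤ finrank K (W ⊓ lag K V b : Submodule K _) := by
      rw [← LinearMap.finrank_range_of_inj (f := U.subtype.domRestrict (LinearMap.ker f))]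
      · apply Submodule.finrank_mono
        rintro _ ⟨⟨⟨x, hx⟩, hx2⟩, rfl⟩
        exact ⟨hx.1, mem_lag hx2 (orth_lag hx.2)⟩
      · intro x y hxy
        exact Subtype.ext (Subtype.ext hxy)
    omega

/-- lower bound transport -/
lemma iso_le_of_witt [FiniteDimensional K V] {V₀ : Type} [AddCommGroup V₀] [Module K V₀]
    [FiniteDimensional K V₀] (h2 : (2 : K) ≠ 0)
    {Q : QuadraticForm K V} {Q₀ : QuadraticForm K V₀} (hQ₀ : Q₀.Anisotropic) {a b : ℕ}
    (h : QIsom (Q₀.prod (HypSum K a)) (Q.prod (HypSum K b)))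
    (W : Submodule K V) (hW : ∀ x ∈ W, Q x = 0) : finrank K W + b ≤ a := by
  obtain ⟨φ, hφ⟩ := h
  let g : W × (Fin b → K) →ₗ[K] V × (Fin b → K × K) :=
    LinearMap.coprod ((LinearMap.inl K V (Fin b → K × K)) ∘ₗ W.subtype) (lagMap K V b)
  have hg : Function.Injective g := by
    rw [← LinearMap.ker_eq_bot, LinearMap.ker_eq_bot']
    rintro ⟨w, x⟩ h
    have h1 := congrArg Prod.fst h
    have h3 : ∀ i, x i = 0 := fun i => by
      have := congrArg (fun z => (z.2 i).1) h
      simpa [g, lagMap] using this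
    ext i
    · simpa [g, lagMap] using h1
    · simp [h3]
  have h1 := iso_dim_le h2 hQ₀ a ((LinearMap.range g).map (φ.symm : _ →ₗ[K] _)) ?_
  · rw [LinearEquiv.finrank_map_eq φ.symm, LinearMap.finrank_range_of_inj hg] at h1
    simpa using h1
  · rintro _ ⟨_, ⟨⟨w, x⟩, rfl⟩, rfl⟩
    rw [← hφ]
    rw [LinearEquiv.coe_coe, LinearEquiv.apply_symm_apply, prodHyp_apply]
    simp [g, lagMap, hW w w.2]

end lag

section fwd
variable {K : Type} [Field K] {V : Type} [AddCommGroup V] [Module K V]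

lemma so_pow {Q : QuadraticForm K V} {X : End K V} (hX : X ∈ soSet Q) (i : ℕ) (v w : V) :
    QuadraticMap.polar Q ((X ^ i) v) w = (-1) ^ i * QuadraticMap.polar Q v ((X ^ i) w) := by
  induction i generalizing v w with
  | zero => simp
  | succ i ih =>
    have e : (X ^ (i + 1)) w = X ((X ^ i) w) := by rw [pow_succ', Module.End.mul_apply]
    rw [e, pow_succ, Module.End.mul_apply, ih, pow_succ]
    have := hX v ((X ^ i) w)
    linear_combination (-1) ^ i * this

def isoW (X : End K V) : ℕ → Submodule K V
  | 0 => ⊥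
  | k + 1 => isoW X k ⊔ (LinearMap.ker (X ^ (k + 1)) ⊓ LinearMap.range (X ^ (k + 1)))

lemma ker_pow_mono (X : End K V) {i j : ℕ} (h : i ≤ j) {x : V} (hx : (X ^ i) x = 0) :
    (X ^ j) x = 0 := by
  obtain ⟨k, rfl⟩ := Nat.exists_eq_add_of_le h
  rw [add_comm, pow_add, Module.End.mul_apply, hx, map_zero]

lemma isoW_ker (X : End K V) (k : ℕ) {x : V} (hx : x ∈ isoW X k) : (X ^ k) x = 0 := by
  induction k generalizing x with
  | zero => simpa [isoW] using hx
  | succ k ih =>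
    obtain ⟨y, hy, z, hz, rfl⟩ := Submodule.mem_sup.1 hx
    rw [map_add, ker_pow_mono X (Nat.le_succ k) (ih hy), zero_add]
    exact hz.1

lemma isoW_iso (h2 : (2 : K) ≠ 0) {Q : QuadraticForm K V} {X : End K V} (hX : X ∈ soSet Q)
    (k : ℕ) {x : V} (hx : x ∈ isoW X k) : Q x = 0 := by
  induction k generalizing x with
  | zero => have : x = 0 := by simpa [isoW] using hx
            simp [this]
  | succ k ih =>
    obtain ⟨y, hy, z, ⟨hz1, u, rfl⟩, rfl⟩ := Submodule.mem_sup.1 hx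
    have key : ∀ w, (X ^ (k + 1)) w = 0 → QuadraticMap.polar Q w ((X ^ (k + 1)) u) = 0 := by
      intro w hw
      have := so_pow hX (k + 1) w u
      rw [hw] at this
      simpa using this.symm
    have h3 := key y (ker_pow_mono X (Nat.le_succ k) (isoW_ker X k hy))
    have h4 := key _ hz1
    rw [QuadraticMap.polar_self] at h4
    have h5 : Q ((X ^ (k + 1)) u) = 0 := by simpa [h2] using h4
    rw [QuadraticMap.map_add Q, ih hy, h5, h3]; simp

lemma isoW_dim [FiniteDimensional K V] (X : End K V) (k : ℕ) :
    finrank K (isoW X k) + finrank K (LinearMap.ker (X ^ (2 * k + 2))) ≤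
      finrank K (isoW X (k + 1)) + finrank K (LinearMap.ker (X ^ (2 * k + 1))) := by
  let f := (X ^ (2 * k + 1)).domRestrict (LinearMap.ker (X ^ (2 * k + 2)))
  let g := (X ^ k).domRestrict (isoW X (k + 1))
  have hf := f.finrank_range_add_finrank_ker
  have hg := g.finrank_range_add_finrank_ker
  have h1 : finrank K (LinearMap.ker f) ≤ finrank K (LinearMap.ker (X ^ (2 * k + 1))) := by
    rw [← LinearMap.finrank_range_of_inj
      (f := (Submodule.subtype _).domRestrict (LinearMap.ker f))]
    · apply Submodule.finrank_mono
      rintro _ ⟨⟨⟨x, hx⟩, hx2⟩, rfl⟩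
      exact hx2
    · intro x y hxy
      exact Subtype.ext (Subtype.ext hxy)
  have h3 : finrank K (isoW X k) ≤ finrank K (LinearMap.ker g) := by
    have hle : isoW X k ≤ isoW X (k + 1) := le_sup_left
    let q : isoW X k →ₗ[K] LinearMap.ker g := LinearMap.codRestrict _ (Submodule.inclusion hle)
      fun x => isoW_ker X k x.2
    refine LinearMap.finrank_le_finrank_of_injective (f := q) fun x y hxy => ?_
    have := congrArg (fun z : LinearMap.ker g => ((z : isoW X (k + 1)) : V)) hxy
    exact Subtype.ext this
  have h4 : LinearMap.range f ≤ LinearMap.range g := by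
    rintro _ ⟨⟨z, hz⟩, rfl⟩
    refine ⟨⟨(X ^ (k + 1)) z, Submodule.mem_sup_right ⟨?_, z, rfl⟩⟩, ?_⟩
    · change (X ^ (k + 1)) ((X ^ (k + 1)) z) = 0
      rw [← Module.End.mul_apply, ← pow_add]
      rw [show k + 1 + (k + 1) = 2 * k + 2 by ring]; exact hz
    · change (X ^ k) ((X ^ (k + 1)) z) = (X ^ (2 * k + 1)) z
      rw [← Module.End.mul_apply, ← pow_add]
      rw [show k + (k + 1) = 2 * k + 1 by ring]
  have h5 := Submodule.finrank_mono h4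
  omega

/-- combinatorial sum -/
lemma isoW_dim_sum [FiniteDimensional K V] (X : End K V) (s : Multiset ℕ)
    (hs : ∀ i, finrank K (LinearMap.ker (X ^ i)) = (s.map (fun j => min i j)).sum) (k : ℕ) :
    (s.map (fun j => min k (j / 2))).sum ≤ finrank K (isoW X k) := by
  induction k with
  | zero => simp
  | succ k ih =>
    have h := isoW_dim X k
    rw [hs, hs] at h
    have : (s.map (fun j => min (k + 1) (j / 2))).sum + (s.map (fun j => min (2 * k + 1) j)).sum
      = (s.map (fun j => min k (j / 2))).sum + (s.map (fun j => min (2 * k + 2) j)).sum := by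
      rw [← Multiset.sum_map_add, ← Multiset.sum_map_add]
      congr 1
      refine Multiset.map_congr rfl fun j _ => ?_
      omega
    omega

lemma half_sum (s : Multiset ℕ) :
    2 * (s.map (fun j => j / 2)).sum + (s.filter (fun j => Odd j)).card = s.sum := by
  induction s using Multiset.induction_on with
  | empty => simp
  | cons j s ih =>
    by_cases hj : Odd j
    · have e : ((j ::ₘ s).filter (fun j => Odd j)).card = (s.filter (fun j => Odd j)).card + 1 := by
        simp [hj]
      rw [e, Multiset.map_cons, Multiset.sum_cons, Multiset.sum_cons]
      have := Nat.odd_iff.1 hj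
      omega
    · have e : ((j ::ₘ s).filter (fun j => Odd j)).card = (s.filter (fun j => Odd j)).card := by
        simp [hj]
      rw [e, Multiset.map_cons, Multiset.sum_cons, Multiset.sum_cons]
      have := Nat.even_iff.1 (Nat.not_odd_iff_even.1 hj)
      omega

lemma exists_iso_of_nilp [FiniteDimensional K V] (h2 : (2 : K) ≠ 0) {Q : QuadraticForm K V}
    {X : End K V} (hX : X ∈ soSet Q) (s : Multiset ℕ)
    (hs : ∀ i, finrank K (LinearMap.ker (X ^ i)) = (s.map (fun j => min i j)).sum) :
    ∃ W : Submodule K V, (∀ x ∈ W, Q x = 0) ∧ (s.map (fun j => j / 2)).sum ≤ finrank K W := by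
  refine ⟨isoW X s.sum, fun x hx => isoW_iso h2 hX _ hx, ?_⟩
  refine le_trans (le_of_eq ?_) (isoW_dim_sum X s hs _)
  congr 1
  refine Multiset.map_congr rfl fun j hj => ?_
  have := Multiset.le_sum_of_mem hj
  omega

end fwd

section bwd
variable {K : Type} [Field K] {V V' : Type} [AddCommGroup V] [Module K V]
  [AddCommGroup V'] [Module K V']

def HasNilp (Q : QuadraticForm K V) (s : Multiset ℕ) : Prop :=
  ∃ X : End K V, X ∈ soSet Q ∧
    ∀ i, finrank K (LinearMap.ker (X ^ i)) = (s.map (fun j => min i j)).sum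

lemma HasNilp.congr {Q : QuadraticForm K V} {Q' : QuadraticForm K V'} {s : Multiset ℕ}
    (h : HasNilp Q s) (e : QIsom Q Q') : HasNilp Q' s := by
  obtain ⟨X, hX, hs⟩ := h
  obtain ⟨φ, hφ⟩ := e
  have hp : ∀ v w, QuadraticMap.polar Q' (φ v) (φ w) = QuadraticMap.polar Q v w := by
    intro v w
    simp only [QuadraticMap.polar, ← map_add, hφ]
  refine ⟨φ.conjRingEquiv X, fun v w => ?_, fun i => ?_⟩
  · obtain ⟨v, rfl⟩ := φ.surjective v
    obtain ⟨w, rfl⟩ := φ.surjective w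
    simp only [LinearEquiv.conjRingEquiv_apply_apply, LinearEquiv.symm_apply_apply, hp]
    exact hX v w
  · have : LinearMap.ker (φ.conjRingEquiv (X ^ i)) = (LinearMap.ker (X ^ i)).map (φ : V →ₗ[K] V') := by
      ext v
      obtain ⟨v, rfl⟩ := φ.surjective v
      rw [LinearMap.mem_ker, LinearEquiv.conjRingEquiv_apply_apply, LinearEquiv.symm_apply_apply]
      simp
    rw [← hs, ← map_pow, this, LinearEquiv.finrank_map_eq φ]

lemma ker_prod_finrank [FiniteDimensional K V] [FiniteDimensional K V'] (X : End K V)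
    (Y : End K V') : finrank K (LinearMap.ker (X.prodMap Y)) =
      finrank K (LinearMap.ker X) + finrank K (LinearMap.ker Y) := by
  rw [← Module.finrank_prod]
  refine LinearEquiv.finrank_eq
    { toFun := fun v => (⟨v.1.1, congrArg Prod.fst v.2⟩, ⟨v.1.2, congrArg Prod.snd v.2⟩)
      invFun := fun w => ⟨(w.1.1, w.2.1), Prod.ext w.1.2 w.2.2⟩
      map_add' := fun _ _ => rfl
      map_smul' := fun _ _ => rfl
      left_inv := fun _ => rfl
      right_inv := fun _ => rfl }

lemma prodMap_pow' (X : End K V) (Y : End K V') (i : ℕ) :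
    (X.prodMap Y : End K (V × V')) ^ i = (X ^ i).prodMap (Y ^ i) := by
  induction i with
  | zero => ext <;> simp
  | succ i ih => rw [pow_succ, ih, pow_succ, pow_succ]; rfl

lemma HasNilp.prod [FiniteDimensional K V] [FiniteDimensional K V'] {Q : QuadraticForm K V}
    {Q' : QuadraticForm K V'} {s s' : Multiset ℕ}
    (h : HasNilp Q s) (h' : HasNilp Q' s') : HasNilp (Q.prod Q') (s + s') := by
  obtain ⟨X, hX, hs⟩ := h
  obtain ⟨Y, hY, hs'⟩ := h'
  have hp : ∀ v w : V × V', QuadraticMap.polar (Q.prod Q') v w =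
      QuadraticMap.polar Q v.1 w.1 + QuadraticMap.polar Q' v.2 w.2 := by
    intro v w
    simp only [QuadraticMap.polar, QuadraticMap.prod_apply, Prod.fst_add, Prod.snd_add]; ring
  refine ⟨X.prodMap Y, fun v w => ?_, fun i => ?_⟩
  · rw [hp, hp]
    have h1 := hX v.1 w.1
    have h2 := hY v.2 w.2
    simp only [LinearMap.prodMap_apply]
    linear_combination h1 + h2
  · rw [prodMap_pow', ker_prod_finrank, hs, hs', Multiset.map_add, Multiset.sum_add]

/-! single Jordan block -/

lemma ker_pow_succ_le [FiniteDimensional K V] (X : End K V) (i : ℕ) :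
    finrank K (LinearMap.ker (X ^ (i + 1))) ≤
      finrank K (LinearMap.ker (X ^ i)) + finrank K (LinearMap.ker X) := by
  let f := (X ^ i).domRestrict (LinearMap.ker (X ^ (i + 1)))
  have hf := f.finrank_range_add_finrank_ker
  have h1 : finrank K (LinearMap.ker f) ≤ finrank K (LinearMap.ker (X ^ i)) := by
    rw [← LinearMap.finrank_range_of_inj
      (f := (Submodule.subtype _).domRestrict (LinearMap.ker f))]
    · apply Submodule.finrank_mono
      rintro _ ⟨⟨⟨x, hx⟩, hx2⟩, rfl⟩
      exact hx2
    · intro x y hxy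
      exact Subtype.ext (Subtype.ext hxy)
  have h2 : LinearMap.range f ≤ LinearMap.ker X := by
    rintro _ ⟨⟨z, hz⟩, rfl⟩
    change X ((X ^ i) z) = 0
    rw [← Module.End.mul_apply, ← pow_succ']; exact hz
  have := Submodule.finrank_mono h2
  omega

lemma single_block [FiniteDimensional K V] {X : End K V} {j : ℕ} (hj : finrank K V = j)
    (h0 : X ^ j = 0) (h1 : finrank K (LinearMap.ker X) ≤ 1) (i : ℕ) :
    finrank K (LinearMap.ker (X ^ i)) = min i j := by
  have hz : ∀ i, j ≤ i → finrank K (LinearMap.ker (X ^ i)) = j := by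
    intro i hi
    rw [pow_eq_zero_of_le hi h0, LinearMap.ker_zero, finrank_top, hj]
  have ha : ∀ i t, finrank K (LinearMap.ker (X ^ (i + t))) ≤ finrank K (LinearMap.ker (X ^ i)) + t := by
    intro i t
    induction t with
    | zero => simp
    | succ t ih =>
      have := ker_pow_succ_le X (i + t)
      rw [← add_assoc]; omega
  rcases le_total j i with h | h
  · rw [hz i h, min_eq_right h]
  · have h3 := ha 0 i
    have h4 := ha i (j - i)
    rw [show i + (j - i) = j by omega, hz j le_rfl] at h4
    have h5 : finrank K (LinearMap.ker (X ^ 0)) = 0 := by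
      rw [pow_zero, Module.End.one_eq_id, LinearMap.ker_id]; simp
    rw [zero_add, h5] at h3
    omega

/-- The shift. -/
def shift (K : Type) [Field K] (j : ℕ) : End K (Fin j → K) where
  toFun v i := if h : i.1 + 1 < j then v ⟨i.1 + 1, h⟩ else 0
  map_add' v w := by ext i; by_cases h : i.1 + 1 < j <;> simp [h]
  map_smul' c w := by ext i; by_cases h : i.1 + 1 < j <;> simp [h]

lemma shift_apply (j : ℕ) (v : Fin j → K) (i : Fin j) :
    shift K j v i = if h : i.1 + 1 < j then v ⟨i.1 + 1, h⟩ else 0 := rfl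

lemma shift_pow (j t : ℕ) (v : Fin j → K) (i : Fin j) :
    (shift K j ^ t) v i = if h : i.1 + t < j then v ⟨i.1 + t, h⟩ else 0 := by
  induction t generalizing i with
  | zero => simp
  | succ t ih =>
    rw [pow_succ', Module.End.mul_apply, shift_apply]
    by_cases h : i.1 + 1 < j
    · rw [dif_pos h, ih]
      simp only [show i.1 + 1 + t = i.1 + (t + 1) by ring]
    · rw [dif_neg h, dif_neg (by omega)]

lemma shift_nil (j : ℕ) : shift K j ^ j = 0 := by
  ext v i
  simp [shift_pow]

lemma shift_ker (j : ℕ) : finrank K (LinearMap.ker (shift K j)) ≤ 1 := by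
  cases j with
  | zero => simpa using (Submodule.finrank_le (LinearMap.ker (shift K 0))).trans (by simp)
  | succ j =>
    let f : LinearMap.ker (shift K (j + 1)) →ₗ[K] K := (LinearMap.proj 0).domRestrict _
    have : Function.Injective f := by
      rw [← LinearMap.ker_eq_bot, LinearMap.ker_eq_bot']
      rintro ⟨v, hv⟩ h
      have h0 : v 0 = 0 := h
      ext i
      change v i = 0
      obtain ⟨i, hi⟩ := i
      cases i with
      | zero => exact h0
      | succ i =>
        have := congrFun (show shift K (j + 1) v = 0 from hv) ⟨i, by omega⟩
        rw [shift_apply, dif_pos hi] at this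
        exact this
    simpa using LinearMap.finrank_le_finrank_of_injective this

lemma shift_fin (j i : ℕ) : finrank K (LinearMap.ker (shift K j ^ i)) = min i j :=
  single_block (j := j) (Module.finrank_fin_fun K) (shift_nil j) (shift_ker j) i

lemma neg_shift_fin (j i : ℕ) : finrank K (LinearMap.ker ((-shift K j) ^ i)) = min i j := by
  refine single_block (j := j) (Module.finrank_fin_fun K) ?_ ?_ i
  · exact (neg_pow (shift K j) j).trans (by rw [shift_nil, mul_zero])
  · have : LinearMap.ker (-shift K j) = LinearMap.ker (shift K j) := by
      ext v; simp
    rw [this]; exact shift_ker j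

def B0 (K : Type) [Field K] (j : ℕ) : (Fin j → K) →ₗ[K] (Fin j → K) →ₗ[K] K :=
  LinearMap.mk₂ K (fun v w => ∑ i, v i * w i.rev)
    (fun _ _ _ => by simp [add_mul, Finset.sum_add_distrib])
    (fun _ _ _ => by simp [Finset.mul_sum, mul_assoc])
    (fun _ _ _ => by simp [mul_add, Finset.sum_add_distrib])
    (fun _ _ _ => by simp [Finset.mul_sum, mul_left_comm])

lemma B0_apply (j : ℕ) (v w : Fin j → K) : B0 K j v w = ∑ i, v i * w i.rev := rfl

lemma B0_shift (j : ℕ) (v w : Fin j → K) : B0 K j (shift K j v) w = B0 K j v (shift K j w) := by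
  cases j with
  | zero => simp [B0_apply]
  | succ j =>
    rw [B0_apply, B0_apply, Fin.sum_univ_castSucc, Fin.sum_univ_succ]
    have e1 : shift K (j + 1) v (Fin.last j) = 0 := by simp [shift_apply]
    have e2 : shift K (j + 1) w (Fin.rev 0) = 0 := by simp [shift_apply]
    rw [e1, e2, zero_mul, mul_zero, zero_add, add_zero]
    refine Finset.sum_congr rfl fun i _ => ?_
    have e3 : ∀ (u : Fin (j + 1) → K) (i : Fin j), shift K (j + 1) u i.castSucc = u i.succ := by
      intro u i
      rw [shift_apply, dif_pos (by simp)]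
      rfl
    rw [Fin.rev_succ, e3, e3, Fin.rev_castSucc]

/-- Hyperbolic form. -/
noncomputable def hypF (K : Type) [Field K] (ι : Type) [Fintype ι] :
    QuadraticForm K ((ι → K) × (ι → K)) :=
  ∑ i, QuadraticMap.linMulLin ((LinearMap.proj i).comp (LinearMap.fst K _ _))
    ((LinearMap.proj i).comp (LinearMap.snd K _ _))

lemma hypF_apply (ι : Type) [Fintype ι] (v : (ι → K) × (ι → K)) :
    hypF K ι v = ∑ i, v.1 i * v.2 i := by
  simp [hypF]

noncomputable def MQ {κ : Type} [Fintype κ] (a : κ → K) (ι : Type) [Fintype ι] :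
    QuadraticForm K ((κ → K) × ((ι → K) × (ι → K))) :=
  (QuadraticMap.weightedSumSquares K a).prod (hypF K ι)

lemma MQ_apply {κ : Type} [Fintype κ] (a : κ → K) (ι : Type) [Fintype ι]
    (v : (κ → K) × ((ι → K) × (ι → K))) :
    MQ a ι v = ∑ k, a k * (v.1 k * v.1 k) + ∑ i, v.2.1 i * v.2.2 i := by
  simp [MQ, hypF_apply, QuadraticMap.weightedSumSquares_apply]

lemma even_block (j : ℕ) : HasNilp (MQ (Empty.elim : Empty → K) (Fin j)) {j, j} := by
  let C : LinearMap.BilinMap K ((Fin j → K) × (Fin j → K)) K :=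
    (B0 K j).compl₁₂ (LinearMap.fst K _ _) (LinearMap.snd K _ _)
  have h : HasNilp C.toQuadraticMap {j, j} := by
    refine ⟨(shift K j).prodMap (-shift K j), fun v w => ?_, fun i => ?_⟩
    · rw [LinearMap.BilinMap.polar_toQuadraticMap, LinearMap.BilinMap.polar_toQuadraticMap]
      simp [C, B0_shift]
      ring
    · rw [prodMap_pow', ker_prod_finrank, shift_fin, neg_shift_fin]
      simp
  refine h.congr ⟨
    { toFun := fun v => (0, (v.1, fun i => v.2 i.rev))
      invFun := fun w => (w.2.1, fun i => w.2.2 i.rev)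
      map_add' := fun v w => by ext <;> simp
      map_smul' := fun c v => by ext <;> simp
      left_inv := fun v => by ext <;> simp
      right_inv := fun v => by
        ext i
        · exact i.elim
        · simp
        · simp }, fun v => ?_⟩
  rw [MQ_apply]
  simp [C, B0_apply]

lemma sum_fold (k : ℕ) (F : ℕ → K) : ∑ i ∈ Finset.range (2 * k + 1), F i =
    F k + ∑ i ∈ Finset.range k, (F i + F (2 * k - i)) := by
  induction k generalizing F with
  | zero => simp
  | succ k ih =>
    rw [show 2 * (k + 1) + 1 = (2 * k + 1 + 1) + 1 by ring, Finset.sum_range_succ,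
      Finset.sum_range_succ', ih (fun i => F (i + 1)), Finset.sum_range_succ' _ k]
    have : ∀ i ∈ Finset.range k, F (i + 1) + F (2 * k - i + 1) =
        F (i + 1) + F (2 * (k + 1) - (i + 1)) := by
      intro i hi
      have := Finset.mem_range.1 hi
      rw [show 2 * k - i + 1 = 2 * (k + 1) - (i + 1) by omega]
    rw [Finset.sum_congr rfl this, show 2 * (k + 1) - 0 = 2 * k + 1 + 1 by omega]
    ring

lemma odd_block (h2 : (2 : K) ≠ 0) (k : ℕ) (a : K) (ha : a ≠ 0) :
    HasNilp (MQ (fun _ : Unit => a) (Fin k)) {2 * k + 1} := by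
  let α : K := (-1) ^ k * a
  have hα : α ≠ 0 := mul_ne_zero (pow_ne_zero _ (by simp)) ha
  let D : End K (Fin (2 * k + 1) → K) :=
    { toFun := fun v i => (-1) ^ i.1 * v i
      map_add' := fun v w => by ext; simp [mul_add]
      map_smul' := fun c w => by ext; simp [mul_left_comm] }
  have hD : ∀ v, D (shift K _ v) = - shift K _ (D v) := by
    intro v
    ext i
    simp only [D, LinearMap.coe_mk, AddHom.coe_mk, shift_apply, Pi.neg_apply]
    split_ifs
    · simp [pow_succ]
    · simp
  let C : LinearMap.BilinMap K (Fin (2 * k + 1) → K) K := α • (B0 K (2 * k + 1)).comp D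
  have hC : ∀ v w, C v w = α * B0 K (2 * k + 1) (D v) w := fun v w => rfl
  have h : HasNilp C.toQuadraticMap {2 * k + 1} := by
    refine ⟨shift K _, fun v w => ?_, fun i => ?_⟩
    · rw [LinearMap.BilinMap.polar_toQuadraticMap, LinearMap.BilinMap.polar_toQuadraticMap]
      simp only [hC, hD, map_neg, LinearMap.neg_apply, B0_shift]
      ring
    · rw [shift_fin]; simp
  let f : (Fin (2 * k + 1) → K) →ₗ[K] (Unit → K) × ((Fin k → K) × (Fin k → K)) :=
    { toFun := fun v => (fun _ => v ⟨k, by omega⟩, (fun i => v ⟨i.1, by omega⟩,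
        fun i => 2 * α * (-1) ^ i.1 * v ⟨2 * k - i.1, by omega⟩))
      map_add' := fun v w => by ext <;> simp [mul_add]
      map_smul' := fun c w => by ext <;> simp [mul_left_comm] }
  have hf : Function.Injective f := by
    rw [← LinearMap.ker_eq_bot, LinearMap.ker_eq_bot']
    intro v hv
    ext ⟨i, hi⟩
    rcases lt_trichotomy i k with h | h | h
    · exact congrFun (congrArg (fun z => z.2.1) hv) ⟨i, h⟩
    · subst h; exact congrFun (congrArg (fun z => z.1) hv) ()
    · have := congrFun (congrArg (fun z => z.2.2) hv) ⟨2 * k - i, by omega⟩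
      simp only [f, LinearMap.coe_mk, AddHom.coe_mk, Prod.snd_zero, Pi.zero_apply] at this
      have h3 : 2 * α * (-1) ^ (2 * k - i) ≠ 0 :=
        mul_ne_zero (mul_ne_zero h2 hα) (pow_ne_zero _ (by simp))
      have h4 := (mul_eq_zero.1 this).resolve_left h3
      have h5 : (⟨2 * k - (2 * k - i), by omega⟩ : Fin (2 * k + 1)) = ⟨i, hi⟩ := by
        ext; simp; omega
      rw [h5] at h4; exact h4
  refine h.congr ⟨f.linearEquivOfInjective hf (by simp; ring), fun v => ?_⟩
  rw [LinearMap.linearEquivOfInjective_apply, MQ_apply, LinearMap.BilinMap.toQuadraticMap_apply,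
    hC, B0_apply]
  let u : ℕ → K := fun i => if h : i < 2 * k + 1 then v ⟨i, h⟩ else 0
  have hu : ∀ i : Fin (2 * k + 1), v i = u i := fun i => by simp only [u]; rw [dif_pos i.2]
  have e1 : ∑ i : Fin (2 * k + 1), D v i * v i.rev =
      ∑ i ∈ Finset.range (2 * k + 1), (-1) ^ i * u i * u (2 * k - i) := by
    rw [Finset.sum_range]
    refine Finset.sum_congr rfl fun i _ => ?_
    simp only [D, LinearMap.coe_mk, AddHom.coe_mk, hu, Fin.val_rev]
    rw [show 2 * k + 1 - (i.1 + 1) = 2 * k - i.1 by omega]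
  rw [e1, sum_fold]
  simp only [f, LinearMap.coe_mk, AddHom.coe_mk, hu, Finset.univ_unique, Finset.sum_singleton]
  rw [mul_add, Finset.mul_sum, Finset.sum_range]
  congr 1
  · rw [show 2 * k - k = k by omega]
    have : ((-1 : K) ^ k) * (-1) ^ k = 1 := by rw [← mul_pow]; simp
    simp only [α]
    linear_combination -(a * u k * u k) * this
  · refine Finset.sum_congr rfl fun i _ => ?_
    have hi : i.1 < k := i.2
    rw [show 2 * k - (2 * k - i.1) = i.1 by omega]
    have : (-1 : K) ^ (2 * k - i.1) = (-1) ^ i.1 := by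
      apply neg_one_pow_congr
      rw [Nat.even_sub (by omega)]; simp
    rw [this]; ring

lemma MQ_add {κ κ' ι ι' : Type} [Fintype κ] [Fintype κ'] [Fintype ι] [Fintype ι']
    {a : κ → K} {a' : κ' → K} {s s' : Multiset ℕ}
    (h : HasNilp (MQ a ι) s) (h' : HasNilp (MQ a' ι') s') :
    HasNilp (MQ (Sum.elim a a') (ι ⊕ ι')) (s + s') := by
  refine (h.prod h').congr ⟨
    { toFun := fun v => (Sum.elim v.1.1 v.2.1, (Sum.elim v.1.2.1 v.2.2.1, Sum.elim v.1.2.2 v.2.2.2))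
      invFun := fun w => ((w.1 ∘ Sum.inl, (w.2.1 ∘ Sum.inl, w.2.2 ∘ Sum.inl)),
        (w.1 ∘ Sum.inr, (w.2.1 ∘ Sum.inr, w.2.2 ∘ Sum.inr)))
      map_add' := fun v w => by ext i <;> (try cases i) <;> simp
      map_smul' := fun c v => by ext i <;> (try cases i) <;> simp
      left_inv := fun v => by ext <;> simp
      right_inv := fun v => by ext i <;> (try cases i) <;> simp }, fun v => ?_⟩
  rw [QuadraticMap.prod_apply, MQ_apply, MQ_apply, MQ_apply]
  simp only [LinearEquiv.coe_mk, LinearMap.coe_mk, AddHom.coe_mk, Fintype.sum_sum_type, Sum.elim_inl, Sum.elim_inr]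
  ring

lemma MQ_reindex {κ κ' ι ι' : Type} [Fintype κ] [Fintype κ'] [Fintype ι] [Fintype ι']
    {a : κ → K} {s : Multiset ℕ} (e : κ' ≃ κ) (e' : ι' ≃ ι)
    (h : HasNilp (MQ (a ∘ e) ι') s) : HasNilp (MQ a ι) s := by
  refine h.congr ⟨(LinearEquiv.funCongrLeft K K e.symm).prodCongr
    ((LinearEquiv.funCongrLeft K K e'.symm).prodCongr (LinearEquiv.funCongrLeft K K e'.symm)),
    fun v => ?_⟩
  rw [MQ_apply, MQ_apply, ← e.sum_comp, ← e'.sum_comp]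
  simp [LinearEquiv.funCongrLeft_apply, LinearMap.funLeft_apply]

lemma model_nilp (h2 : (2 : K) ≠ 0) (N : ℕ) : ∀ s : Multiset ℕ, s.card ≤ N →
    (∀ j, Even j → Even (s.count j)) → ∀ (κ ι : Type) [Fintype κ] [Fintype ι] (a : κ → K),
    (∀ k, a k ≠ 0) → Fintype.card κ = (s.filter (fun j => Odd j)).card →
    Fintype.card ι = (s.map (fun j => j / 2)).sum → HasNilp (MQ a ι) s := by
  induction N with
  | zero =>
    intro s hs _ κ ι _ _ a _ hκ hι
    obtain rfl : s = 0 := by simpa using hs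
    have : IsEmpty κ := Fintype.card_eq_zero_iff.1 (by simpa using hκ)
    have : IsEmpty ι := Fintype.card_eq_zero_iff.1 (by simpa using hι)
    refine ⟨0, fun v w => by simp, fun i => ?_⟩
    simp [Module.finrank_zero_of_subsingleton]
  | succ N ih =>
    intro s hs hev κ ι _ _ a ha hκ hι
    by_cases hodd : ∃ j ∈ s, Odd j
    · obtain ⟨j, hj, k, rfl⟩ := hodd
      obtain ⟨t, rfl⟩ := Multiset.exists_cons_of_mem hj
      have hoj : Odd (2 * k + 1) := ⟨k, rfl⟩
      have e1 : (((2 * k + 1) ::ₘ t).filter (fun j => Odd j)).card =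
          (t.filter (fun j => Odd j)).card + 1 := by simp [hoj]
      rw [e1] at hκ
      rw [Multiset.map_cons, Multiset.sum_cons, show (2 * k + 1) / 2 = k by omega] at hι
      let m := (t.filter (fun j => Odd j)).card
      let r := (t.map (fun j => j / 2)).sum
      have e : Unit ⊕ Fin m ≃ κ := Fintype.equivOfCardEq (by
        rw [hκ, Fintype.card_sum]; simp [m]; ring)
      have e' : Fin k ⊕ Fin r ≃ ι := Fintype.equivOfCardEq (by simp [hι, r])
      refine MQ_reindex e e' ?_
      have h := MQ_add (odd_block h2 k (a (e (Sum.inl ()))) (ha _))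
        (ih t (by simpa using hs) ?_ (Fin m) (Fin r) (fun i => a (e (Sum.inr i)))
          (fun _ => ha _) (by rw [Fintype.card_fin]) (by rw [Fintype.card_fin]))
      · rw [Multiset.singleton_add] at h
        convert h using 2
        ext i
        rcases i with i | i <;> rfl
      · intro j hj
        have := hev j hj
        rwa [Multiset.count_cons_of_ne] at this
        rintro rfl
        exact (Nat.not_even_iff_odd.2 hoj) hj
    · push Not at hodd
      rcases s.empty_or_exists_mem with rfl | ⟨j, hj⟩
      · exact ih 0 (by simp) hev κ ι a ha hκ hι
      obtain ⟨t, rfl⟩ := Multiset.exists_cons_of_mem hj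
      have hje : Even j := Nat.not_odd_iff_even.1 (hodd j hj)
      have hjt : j ∈ t := by
        by_contra hn
        have := hev j hje
        rw [Multiset.count_cons_self, Multiset.count_eq_zero.2 hn] at this
        simp at this
      obtain ⟨t, rfl⟩ := Multiset.exists_cons_of_mem hjt
      have hno : ¬ Odd j := hodd j hj
      have e1 : ((j ::ₘ j ::ₘ t).filter (fun j => Odd j)).card =
          (t.filter (fun j => Odd j)).card := by simp [hno]
      rw [e1] at hκ
      rw [Multiset.map_cons, Multiset.sum_cons, Multiset.map_cons, Multiset.sum_cons] at hι
      have hj2 := Nat.even_iff.1 hje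
      let r := (t.map (fun j => j / 2)).sum
      have e : Empty ⊕ κ ≃ κ := Equiv.emptySum _ _
      have e' : Fin j ⊕ Fin r ≃ ι := Fintype.equivOfCardEq (by
        rw [hι, Fintype.card_sum, Fintype.card_fin, Fintype.card_fin]; simp only [r]; omega)
      refine MQ_reindex e e' ?_
      have h := MQ_add (even_block (K := K) j)
        (ih t (by simp at hs; omega) ?_ κ (Fin r) (fun i => a (e (Sum.inr i)))
          (fun _ => ha _) hκ (by rw [Fintype.card_fin]))
      · have e2 : ({j, j} : Multiset ℕ) + t = j ::ₘ j ::ₘ t := by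
          simp [Multiset.insert_eq_cons]
        rw [e2] at h
        convert h using 2
        ext i
        rcases i with i | i
        · exact i.elim
        · rfl
      · intro i hi
        have := hev i hi
        rw [Multiset.count_cons, Multiset.count_cons] at this
        split_ifs at this
        · rw [add_assoc, Nat.even_add] at this
          exact this.2 (by decide)
        · exact this
end bwd

section split
variable {K : Type} [Field K] {V V' : Type} [AddCommGroup V] [Module K V]
  [AddCommGroup V'] [Module K V']

lemma polar_map {Q : QuadraticForm K V} {Q' : QuadraticForm K V'} (f : V →ₗ[K] V')
    (h : ∀ v, Q' (f v) = Q v) (v w : V) :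
    QuadraticMap.polar Q' (f v) (f w) = QuadraticMap.polar Q v w := by
  simp only [QuadraticMap.polar, ← map_add, h]

lemma inj_of_isom {Q : QuadraticForm K V} {Q' : QuadraticForm K V'} (hQ : QNondeg Q)
    (f : V →ₗ[K] V') (h : ∀ v, Q' (f v) = Q v) : Function.Injective f := by
  rw [← LinearMap.ker_eq_bot, LinearMap.ker_eq_bot']
  intro v hv
  refine hQ v fun w => ?_
  rw [← polar_map f h, hv, QuadraticMap.polar_zero_left]

lemma hypF_polar (ι : Type) [Fintype ι] (v w : (ι → K) × (ι → K)) :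
    QuadraticMap.polar (hypF K ι) v w = ∑ i, (v.1 i * w.2 i + w.1 i * v.2 i) := by
  simp only [QuadraticMap.polar, hypF_apply, ← Finset.sum_sub_distrib]
  refine Finset.sum_congr rfl fun i _ => ?_
  simp; ring

lemma hypF_nondeg (ι : Type) [Fintype ι] : QNondeg (hypF K ι) := by
  classical
  intro v hv
  have h2 : ∀ i, v.1 i = 0 ∧ v.2 i = 0 := by
    intro i
    have hx := hv (0, Pi.single i 1)
    have hy := hv (Pi.single i 1, 0)
    rw [hypF_polar, Finset.sum_eq_single i] at hx hy
    · exact ⟨by simpa using hx, by simpa using hy⟩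
    all_goals simp +contextual
  ext i
  · simp [h2]
  · simp [h2]

lemma MQ_polar {κ : Type} [Fintype κ] (a : κ → K) (ι : Type) [Fintype ι]
    (v w : (κ → K) × ((ι → K) × (ι → K))) :
    QuadraticMap.polar (MQ a ι) v w = ∑ k, 2 * (a k * v.1 k * w.1 k) +
      QuadraticMap.polar (hypF K ι) v.2 w.2 := by
  have e : ∑ k, 2 * (a k * v.1 k * w.1 k) = ∑ k, a k * ((v + w).1 k * (v + w).1 k) -
      ∑ k, a k * (v.1 k * v.1 k) - ∑ k, a k * (w.1 k * w.1 k) := by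
    simp only [← Finset.sum_sub_distrib]
    refine Finset.sum_congr rfl fun i _ => ?_
    simp; ring
  rw [e]
  simp only [QuadraticMap.polar, MQ_apply, hypF_apply, Prod.snd_add]
  ring

lemma MQ_nondeg (h2 : (2 : K) ≠ 0) {κ : Type} [Fintype κ] (a : κ → K) (ha : ∀ k, a k ≠ 0)
    (ι : Type) [Fintype ι] : QNondeg (MQ a ι) := by
  classical
  intro v hv
  refine Prod.ext ?_ (hypF_nondeg ι _ fun w => ?_)
  · ext i
    have hx := hv (Pi.single i 1, 0)
    rw [MQ_polar, QuadraticMap.polar_zero_right, Finset.sum_eq_single i] at hx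
    · simpa [h2, ha] using hx
    all_goals simp +contextual
  · have := hv (0, w)
    rw [MQ_polar] at this
    simpa using this

lemma exists_hyp [FiniteDimensional K V] (h2 : (2 : K) ≠ 0) {Q : QuadraticForm K V}
    (hQ : QNondeg Q) (W : Submodule K V) (hW : ∀ x ∈ W, Q x = 0) {e : ℕ}
    (he : finrank K W = e) :
    ∃ φ : ((Fin e → K) × (Fin e → K)) →ₗ[K] V, ∀ v, Q (φ v) = hypF K (Fin e) v := by
  let w := finBasisOfFinrankEq K W he
  let B : LinearMap.BilinForm K V := QuadraticMap.polarBilin Q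
  have hB : B.Nondegenerate := nondeg_polar hQ
  have hsymm : ∀ x y, B x y = B y x := fun x y => QuadraticMap.polar_comm Q x y
  have hy : ∀ j, ∃ y : V, ∀ i, B y (w i) = if i = j then 1 else 0 := by
    intro j
    obtain ⟨g, hg⟩ := LinearMap.exists_extend (w.coord j)
    refine ⟨(LinearMap.BilinForm.toDual B hB).symm g, fun i => ?_⟩
    rw [LinearMap.BilinForm.apply_toDual_symm_apply]
    have := LinearMap.congr_fun hg (w i)
    rw [LinearMap.comp_apply, Submodule.subtype_apply] at this
    rw [this, Basis.coord_apply, Basis.repr_self, Finsupp.single_apply]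
  choose y hy using hy
  have hww : ∀ i j, B (w i) (w j) = 0 := fun i j => polar_iso hW (w i).2 (w j).2
  let y' : Fin e → V := fun j => y j - ∑ i, (2⁻¹ * B (y i) (y j)) • (w i : V)
  have hy'w : ∀ j i, B (y' j) (w i) = if i = j then 1 else 0 := by
    intro j i
    simp [y', hy, hww]
  have hwy : ∀ i j, B (w i) (y j) = if i = j then 1 else 0 := by
    intro i j; rw [hsymm, hy]
  have hyy : ∀ i j, B (y' i) (y' j) = 0 := by
    intro i j
    have : B (y' i) (y' j) = B (y' i) (y j) - 2⁻¹ * B (y i) (y j) := by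
      conv_lhs => rw [show y' j = y j - ∑ k, (2⁻¹ * B (y k) (y j)) • (w k : V) from rfl]
      simp [hy'w]
    rw [this]
    have : B (y' i) (y j) = B (y i) (y j) - 2⁻¹ * B (y j) (y i) := by
      simp [y', hwy]
    rw [this, hsymm (y j) (y i)]
    field_simp
    ring
  let φ1 : (Fin e → K) →ₗ[K] V := Fintype.linearCombination K (fun i => (w i : V))
  let φ2 : (Fin e → K) →ₗ[K] V := Fintype.linearCombination K y'
  refine ⟨φ1.coprod φ2, fun v => ?_⟩
  rw [LinearMap.coprod_apply, QuadraticMap.map_add Q, hypF_apply]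
  have q1 : Q (φ1 v.1) = 0 := hW _ (by
    simp only [φ1, Fintype.linearCombination_apply]
    exact Submodule.sum_mem _ fun i _ => Submodule.smul_mem _ _ (w i).2)
  have q2 : Q (φ2 v.2) = 0 := by
    have : B (φ2 v.2) (φ2 v.2) = 0 := by
      simp [φ2, Fintype.linearCombination_apply, hyy]
    have h3 : QuadraticMap.polar Q (φ2 v.2) (φ2 v.2) = 0 := this
    rw [QuadraticMap.polar_self] at h3
    simpa [h2] using h3
  have q3 : QuadraticMap.polar Q (φ1 v.1) (φ2 v.2) = B (φ1 v.1) (φ2 v.2) := rfl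
  have hwy' : ∀ i j, B (w i) (y' j) = if i = j then 1 else 0 := by
    intro i j; rw [hsymm, hy'w]
  rw [q1, q2, q3]
  simp [φ1, φ2, Fintype.linearCombination_apply, hwy', mul_comm]

lemma split [FiniteDimensional K V] (h2 : (2 : K) ≠ 0) {Q : QuadraticForm K V}
    (hQ : QNondeg Q) (W : Submodule K V) (hW : ∀ x ∈ W, Q x = 0) {e : ℕ}
    (he : finrank K W = e) :
    ∃ (m : ℕ) (a : Fin m → K), m + 2 * e = finrank K V ∧ (∀ i, a i ≠ 0) ∧
      QIsom (MQ a (Fin e)) Q := by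
  obtain ⟨φ, hφ⟩ := exists_hyp h2 hQ W hW he
  have hinj := inj_of_isom (hypF_nondeg (Fin e)) φ hφ
  let B : LinearMap.BilinForm K V := QuadraticMap.polarBilin Q
  have hB : B.Nondegenerate := nondeg_polar hQ
  have hr : B.IsRefl := refl_polar Q
  let H := LinearMap.range φ
  have hdis : Disjoint H (B.orthogonal H) := by
    rw [Submodule.disjoint_def]
    rintro _ ⟨u, rfl⟩ hu
    rw [hypF_nondeg (Fin e) u fun u' => ?_, map_zero]
    rw [QuadraticMap.polar_comm, ← polar_map φ hφ]
    exact hu (φ u') ⟨u', rfl⟩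
  have hc : IsCompl H (B.orthogonal H) :=
    (LinearMap.BilinForm.isCompl_orthogonal_iff_disjoint hr).2 hdis
  have hfr : finrank K H = 2 * e := by
    rw [LinearMap.finrank_range_of_inj hinj]; simp; ring
  have hfr2 := Submodule.finrank_add_eq_of_isCompl hc
  let Q' : QuadraticForm K (B.orthogonal H) := Q.comp (B.orthogonal H).subtype
  have hQ' : QNondeg Q' := by
    intro v hv
    have : (v : V) = 0 := by
      refine hQ _ fun x => ?_
      obtain ⟨h, hh, o, ho, rfl⟩ := Submodule.mem_sup.1
        (show x ∈ H ⊔ B.orthogonal H by rw [hc.sup_eq_top]; trivial)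
      rw [QuadraticMap.polar_add_right]
      have e1 : QuadraticMap.polar Q v h = 0 := by
        rw [QuadraticMap.polar_comm]; exact v.2 h hh
      have e2 : QuadraticMap.polar Q v o = 0 := hv ⟨o, ho⟩
      rw [e1, e2, add_zero]
    exact Subtype.ext this
  letI : Invertible (2 : K) := invertibleOfNonzero h2
  obtain ⟨a, ⟨ψ⟩⟩ := QuadraticForm.equivalent_weightedSumSquares_units_of_nondegenerate' Q' (by
    intro v hv
    refine hQ' v fun w => ?_
    have := hv w
    rw [← QuadraticMap.polarBilin_apply_apply, ← QuadraticMap.two_nsmul_associated K Q']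
    rw [LinearMap.smul_apply, LinearMap.smul_apply, this, smul_zero])
  refine ⟨_, fun i => (a i : K), ?_, fun i => (a i).ne_zero, ?_⟩
  · omega
  let F : ((Fin (finrank K (B.orthogonal H)) → K) × ((Fin e → K) × (Fin e → K))) →ₗ[K] V :=
    LinearMap.coprod ((B.orthogonal H).subtype ∘ₗ ψ.symm.toLinearEquiv.toLinearMap) φ
  have hF : ∀ v, Q (F v) = MQ (fun i => (a i : K)) (Fin e) v := by
    intro v
    have e1 : F v = (ψ.symm v.1 : B.orthogonal H) + φ v.2 := rfl
    have e2 : QuadraticMap.polar Q (ψ.symm v.1 : B.orthogonal H) (φ v.2) = 0 := by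
      rw [QuadraticMap.polar_comm]
      exact (ψ.symm v.1).2 _ ⟨_, rfl⟩
    have e3 : Q (ψ.symm v.1 : B.orthogonal H) = QuadraticMap.weightedSumSquares K a v.1 :=
      ψ.symm.map_app v.1
    rw [e1, QuadraticMap.map_add Q, e2, e3, hφ, MQ_apply, hypF_apply]
    simp [QuadraticMap.weightedSumSquares_apply, Units.smul_def]
  refine ⟨F.linearEquivOfInjective
    (inj_of_isom (MQ_nondeg h2 _ (fun i => (a i).ne_zero) _) F hF) ?_, hF⟩
  simp; omega

lemma exists_sub_finrank [FiniteDimensional K V] (W : Submodule K V) {r : ℕ}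
    (h : r ≤ finrank K W) : ∃ U ≤ W, finrank K U = r := by
  obtain ⟨f, hf⟩ := exists_linearIndependent_of_le_finrank h
  refine ⟨(Submodule.span K (Set.range f)).map W.subtype, Submodule.map_subtype_le _ _, ?_⟩
  rw [Submodule.finrank_map_subtype_eq, finrank_span_eq_card hf, Fintype.card_fin]

end split

end S6
/-- A nilpotent element of `so(Q)` of Jordan type `λ ∈ Λ(n)` exists if and only if the number
of odd parts of `λ` (with multiplicity) is at least the anisotropic dimension of `Q`. -/
theorem statement_6 (p : ℕ) [Fact p.Prime] (hp : p ≠ 2) (K : Type) [Field K]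
    [Algebra ℚ_[p] K] [FiniteDimensional ℚ_[p] K]
    (n : ℕ) (Q : QF K n) (hQ : QNondeg Q)
    (d : ℕ) (Q₀ : QF K d) (hQ₀ : QuadraticMap.Anisotropic Q₀) (hW : WittEquiv Q₀ Q)
    (lam : Nat.Partition n) (hlam : lam ∈ LambdaSet n)
    (m : ℕ) (hm : m = (lam.parts.filter (fun j => Odd j)).card) :
    (∃ X : Module.End K (Fin n → K),
        X ∈ soSet Q ∧ IsNilpotent X ∧ HasJordanType X lam) ↔ d ≤ m := by
  classical
  have h2 : (2 : K) ≠ 0 := by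
    have : CharZero K := charZero_of_injective_algebraMap (algebraMap ℚ_[p] K).injective
    exact two_ne_zero
  obtain ⟨a, b, hab⟩ := hW
  have hdim : d + 2 * a = n + 2 * b := by
    obtain ⟨φ, -⟩ := hab
    have := φ.finrank_eq
    simp [Module.finrank_pi_fintype] at this
    omega
  have hhalf := S6.half_sum lam.parts
  rw [← hm, lam.parts_sum] at hhalf
  constructor
  · rintro ⟨X, hX, -, hJ⟩
    obtain ⟨W, hW, hWd⟩ := S6.exists_iso_of_nilp h2 hX lam.parts hJ
    have := S6.iso_le_of_witt h2 hQ₀ hab W hW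
    omega
  · intro hdm
    obtain ⟨W, hW, hWd⟩ := S6.exists_iso hQ hab
    obtain ⟨U, hUW, hU⟩ := S6.exists_sub_finrank W
      (show (lam.parts.map (fun j => j / 2)).sum ≤ Module.finrank K W by omega)
    obtain ⟨m', c, hm', hc, hiso⟩ := S6.split h2 hQ U (fun x hx => hW x (hUW hx)) hU
    have hmm : m' = m := by
      simp at hm'; omega
    obtain ⟨X, hX, hJ⟩ := (S6.model_nilp h2 _ lam.parts le_rfl hlam (Fin m') (Fin _) c hc
      (by rw [Fintype.card_fin, hmm, hm]) (by rw [Fintype.card_fin])).congr hiso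
    refine ⟨X, hX, ⟨n, ?_⟩, hJ⟩
    have h := hJ n
    have e : (lam.parts.map (fun j => min n j)).sum = n := by
      conv_rhs => rw [← lam.parts_sum]
      congr 1
      conv_rhs => rw [← Multiset.map_id lam.parts]
      refine Multiset.map_congr rfl fun j hj => ?_
      have := Multiset.le_sum_of_mem hj
      rw [lam.parts_sum] at this
      simpa using this
    rw [e] at h
    have h3 : LinearMap.ker (X ^ n) = ⊤ := Submodule.eq_top_of_finrank_eq (by simpa using h)
    exact LinearMap.ker_eq_top.1 h3
end
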